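/- arXiv:2210.03064 — 2 statements merged into one kernel-verified Lean document; each statement's English description precedes it below -/
import Mathlib

section
/- For every integer r ≥ 2 there exists α₀ = α₀(r) > 0 such that for every 0 < α < α₀ there exist θ = θ(r,α) > 0, C = C(r,α) > 0, and n₀ such that the following holds for all n ≥ n₀ with r | n. Let G be an n-vertex graph with minimum degree δ(G) ≥ (r−1)n/r − θn such that G is not (r,α)-sparse, and, in the case r = 2, such that G is additionally not α-disconnected. Then there exists a (C/n^{r−1})-spread distribution on the set of K_r-factors of G, where the ground set is the set of r-cliques of G. -/
open Finset

/-- `F` is a `K_r`-factor of `G`: a collection of pairwise vertex-disjoint `r`-cliques of `G`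
covering every vertex. -/
def IsKrFactor {V : Type*} [Fintype V] [DecidableEq V] (G : SimpleGraph V) (r : ℕ)
    (F : Finset (Finset V)) : Prop :=
  (∀ K ∈ F, G.IsNClique r K) ∧ (F : Set (Finset V)).PairwiseDisjoint id ∧
    F.biUnion id = Finset.univ

/-- `μ` is a `q`-spread probability distribution on the collection of finite subsets (of the
ground set of elements of type `α`) satisfying `Fam`. -/
def IsSpreadDist {α : Type*} [Fintype α] [DecidableEq α] (q : ℝ)
    (Fam : Finset α → Prop) (μ : Finset α → ℝ) : Prop :=
  (∀ A, 0 ≤ μ A) ∧ (∑ A : Finset α, μ A = 1) ∧ (∀ A, μ A ≠ 0 → Fam A) ∧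
    ∀ S : Finset α, ∑ A ∈ Finset.univ.filter (fun A : Finset α => S ⊆ A), μ A ≤ q ^ S.card

/-- Twice the number of edges of `G` inside the vertex set `A` (ordered adjacent pairs in `A`). -/
def doubleEdgesInside {V : Type*} [Fintype V] [DecidableEq V] (G : SimpleGraph V)
    [DecidableRel G.Adj] (A : Finset V) : ℕ :=
  ((A ×ˢ A).filter (fun p : V × V => G.Adj p.1 p.2)).card

/-- The number of edges of `G` between the disjoint vertex sets `A` and `B`. -/
def edgesBetween {V : Type*} [Fintype V] [DecidableEq V] (G : SimpleGraph V)
    [DecidableRel G.Adj] (A B : Finset V) : ℕ :=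
  ((A ×ˢ B).filter (fun p : V × V => G.Adj p.1 p.2)).card

/-- `G` is `(r,α)`-sparse: some vertex set `A` of size `⌊n/r⌋` has edge density
`e_G(A)/C(|A|,2) ≤ α`. -/
def IsSparse {V : Type*} [Fintype V] [DecidableEq V] (G : SimpleGraph V) [DecidableRel G.Adj]
    (r : ℕ) (α : ℝ) : Prop :=
  ∃ A : Finset V, A.card = Fintype.card V / r ∧
    (doubleEdgesInside G A : ℝ) / 2 ≤ α * (A.card.choose 2 : ℝ)

/-- `G` is `α`-disconnected: there is a partition `V = A ∪ B` with `|A| = ⌊n/2⌋` and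
`d_G(A,B) ≤ α`. -/
def IsDisconnectedGraph {V : Type*} [Fintype V] [DecidableEq V] (G : SimpleGraph V)
    [DecidableRel G.Adj] (α : ℝ) : Prop :=
  ∃ A : Finset V, A.card = Fintype.card V / 2 ∧
    (edgesBetween G A Aᶜ : ℝ) ≤ α * (A.card : ℝ) * (Aᶜ.card : ℝ)

/-! ### Lopsided local lemma for random permutations -/

/-- The permutation `σ` contains the pattern `Q`. -/
def PermHolds {V : Type*} (Q : Finset (V × V)) (σ : Equiv.Perm V) : Prop :=
  ∀ x ∈ Q, σ x.1 = x.2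

/-- Permutations containing the pattern `P` and none of the patterns in `S`. -/
noncomputable def permAvoid {V : Type*} [Fintype V] [DecidableEq V] (P : Finset (V × V))
    (S : Finset (Finset (V × V))) : Finset (Equiv.Perm V) := by
  classical exact univ.filter (fun σ => PermHolds P σ ∧ ∀ Q ∈ S, ¬ PermHolds Q σ)

/-- Two patterns conflict if they share a row or a column. -/
def PatConflict {V : Type*} (P Q : Finset (V × V)) : Prop :=
  ∃ x ∈ P, ∃ y ∈ Q, x.1 = y.1 ∨ x.2 = y.2

lemma sum_biUnion_le_sum_sum {α β : Type*} [DecidableEq β] (s : Finset α) (t : α → Finset β)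
    {f : β → ℝ} (hf : ∀ b, 0 ≤ f b) :
    ∑ b ∈ s.biUnion t, f b ≤ ∑ a ∈ s, ∑ b ∈ t a, f b := by
  classical
  induction s using Finset.induction_on with
  | empty => simp
  | insert a s ha ih =>
    rw [biUnion_insert, sum_insert ha]
    have h := sum_union_inter (s₁ := t a) (s₂ := s.biUnion t) (f := f)
    have h2 : 0 ≤ ∑ b ∈ t a ∩ s.biUnion t, f b := sum_nonneg fun b _ => hf b
    linarith

section PermLocalLemma

variable {V : Type*} [Fintype V] [DecidableEq V]

lemma mem_permAvoid {P : Finset (V × V)} {S : Finset (Finset (V × V))} {σ : Equiv.Perm V} :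
    σ ∈ permAvoid P S ↔ PermHolds P σ ∧ ∀ Q ∈ S, ¬ PermHolds Q σ := by
  simp [permAvoid]

lemma permAvoid_mono {P : Finset (V × V)} {S T : Finset (Finset (V × V))} (h : S ⊆ T) :
    permAvoid P T ⊆ permAvoid P S := by
  intro σ hσ
  rw [mem_permAvoid] at hσ ⊢
  exact ⟨hσ.1, fun Q hQ => hσ.2 Q (h hQ)⟩

lemma card_le_of_permHolds {P : Finset (V × V)} {σ : Equiv.Perm V} (h : PermHolds P σ) :
    P.card ≤ Fintype.card V := by
  have : P.card = (P.image Prod.fst).card := by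
    rw [Finset.card_image_of_injOn]
    intro x hx y hy hxy
    have h1 := h x hx
    have h2 := h y hy
    rw [Prod.ext_iff]
    exact ⟨hxy, by rw [← h1, ← h2, hxy]⟩
  rw [this]
  exact Finset.card_le_univ _

lemma card_permAvoid_insert_mul_le {P : Finset (V × V)} {S : Finset (Finset (V × V))}
    {x : V × V} (hx : x ∉ P) (hS : ∀ Q ∈ S, ∀ y ∈ Q, y.1 ≠ x.1 ∧ y.2 ≠ x.2) :
    (permAvoid (insert x P) S).card * (Fintype.card V - P.card) ≤ (permAvoid P S).card := by
  rcases (permAvoid (insert x P) S).eq_empty_or_nonempty with h0 | ⟨σ₀, hσ₀⟩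
  · simp [h0]
  rw [mem_permAvoid] at hσ₀
  have hxcol : ∀ y ∈ P, y.2 ≠ x.2 := by
    intro y hy hyx
    have h1 := hσ₀.1 y (mem_insert_of_mem hy)
    have h2 := hσ₀.1 x (mem_insert_self _ _)
    have h3 : y.1 = x.1 := σ₀.injective (by rw [h1, h2, hyx])
    exact hx (by rw [← Prod.ext h3 hyx]; exact hy)
  have hcard : (univ \ P.image Prod.snd : Finset V).card = Fintype.card V - P.card := by
    rw [card_sdiff_of_subset (subset_univ _), card_univ, card_image_of_injOn]
    intro y hy z hz hyz
    have h1 := hσ₀.1 y (mem_insert_of_mem hy)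
    have h2 := hσ₀.1 z (mem_insert_of_mem hz)
    have h3 : y.1 = z.1 := σ₀.injective (by rw [h1, h2]; exact hyz)
    exact Prod.ext h3 hyz
  rw [← hcard, ← card_product]
  apply card_le_card_of_injOn (fun z : Equiv.Perm V × V => Equiv.swap x.2 z.2 * z.1)
  · rintro ⟨σ, v⟩ hz
    simp only [coe_product, Set.mem_prod, mem_coe, mem_sdiff, mem_univ, true_and,
      mem_image, not_exists, not_and] at hz
    obtain ⟨hσ, hv⟩ := hz
    rw [mem_permAvoid] at hσ
    have hσx := hσ.1 x (mem_insert_self _ _)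
    simp only [mem_coe]
    rw [mem_permAvoid]
    constructor
    · intro y hy
      have h1 := hσ.1 y (mem_insert_of_mem hy)
      simp only [Equiv.Perm.mul_apply, h1]
      exact Equiv.swap_apply_of_ne_of_ne (hxcol y hy) (hv y hy)
    · intro Q hQ hh
      apply hσ.2 Q hQ
      intro y hy
      have h1 := hh y hy
      obtain ⟨h2, h3⟩ := hS Q hQ y hy
      simp only [Equiv.Perm.mul_apply] at h1
      have h4 : σ y.1 ≠ x.2 := by
        intro h; exact h2 (σ.injective (by rw [h, hσx]))
      by_cases h5 : σ y.1 = v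
      · rw [h5, Equiv.swap_apply_right] at h1
        exact absurd h1.symm h3
      · rwa [Equiv.swap_apply_of_ne_of_ne h4 h5] at h1
  · rintro ⟨σ, v⟩ hz ⟨τ, w⟩ hw heq
    simp only [coe_product, Set.mem_prod, mem_coe] at hz hw
    have hσx := (mem_permAvoid.1 hz.1).1 x (mem_insert_self _ _)
    have hτx := (mem_permAvoid.1 hw.1).1 x (mem_insert_self _ _)
    simp only at heq
    have h1 : v = w := by
      have := congrArg (fun ρ : Equiv.Perm V => ρ x.1) heq
      simpa [Equiv.Perm.mul_apply, hσx, hτx] using this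
    subst h1
    have h2 : σ = τ := mul_left_cancel heq
    rw [h2]

/-- A pattern is negatively correlated with avoiding non-conflicting patterns. -/
lemma card_permAvoid_mul_descFactorial_le {P : Finset (V × V)} {S : Finset (Finset (V × V))}
    (hS : ∀ Q ∈ S, ¬ PatConflict P Q) :
    (permAvoid P S).card * (Fintype.card V).descFactorial P.card ≤ (permAvoid ∅ S).card := by
  induction P using Finset.induction_on with
  | empty => simp
  | insert x P hx ih =>
    have h1 : (permAvoid (insert x P) S).card * (Fintype.card V - P.card)
        ≤ (permAvoid P S).card := by
      apply card_permAvoid_insert_mul_le hx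
      intro Q hQ y hy
      have := hS Q hQ
      constructor
      · intro h; exact this ⟨x, mem_insert_self _ _, y, hy, Or.inl h.symm⟩
      · intro h; exact this ⟨x, mem_insert_self _ _, y, hy, Or.inr h.symm⟩
    have h2 := ih (fun Q hQ ⟨y, hy, z, hz, h⟩ =>
      hS Q hQ ⟨y, mem_insert_of_mem hy, z, hz, h⟩)
    rw [card_insert_of_notMem hx, Nat.descFactorial_succ, ← mul_assoc]
    exact (Nat.mul_le_mul_right _ h1).trans h2

/-- The probability that a uniformly random permutation contains a pattern of size `k`. -/
noncomputable def patWeight (n k : ℕ) : ℝ := 1 / (n.descFactorial k : ℝ)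

lemma patWeight_nonneg (n k : ℕ) : 0 ≤ patWeight n k := by
  unfold patWeight; positivity

lemma card_permAvoid_le_patWeight_mul {P : Finset (V × V)} {S : Finset (Finset (V × V))}
    (hS : ∀ Q ∈ S, ¬ PatConflict P Q) :
    ((permAvoid P S).card : ℝ) ≤
      patWeight (Fintype.card V) P.card * ((permAvoid ∅ S).card : ℝ) := by
  rcases (permAvoid P S).eq_empty_or_nonempty with h0 | ⟨σ, hσ⟩
  · rw [h0]; simp only [card_empty, Nat.cast_zero]
    exact mul_nonneg (patWeight_nonneg _ _) (Nat.cast_nonneg _)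
  · have h1 := card_le_of_permHolds (mem_permAvoid.1 hσ).1
    have h2 := card_permAvoid_mul_descFactorial_le hS
    have h3 : 0 < (Fintype.card V).descFactorial P.card := Nat.descFactorial_pos.2 h1
    unfold patWeight
    rw [one_div, inv_mul_eq_div, le_div_iff₀ (by exact_mod_cast h3)]
    exact_mod_cast h2

lemma card_permAvoid_sub_sum_le (S T : Finset (Finset (V × V))) :
    ((permAvoid ∅ S).card : ℝ) - ∑ Q ∈ T, ((permAvoid Q S).card : ℝ)
      ≤ ((permAvoid ∅ (S ∪ T)).card : ℝ) := by
  have h : permAvoid ∅ S ⊆ permAvoid ∅ (S ∪ T) ∪ T.biUnion (fun Q => permAvoid Q S) := by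
    intro σ hσ
    rw [mem_permAvoid] at hσ
    by_cases hh : ∀ Q ∈ T, ¬ PermHolds Q σ
    · apply mem_union_left
      rw [mem_permAvoid]
      refine ⟨hσ.1, fun Q hQ => ?_⟩
      rcases mem_union.1 hQ with h1 | h1
      · exact hσ.2 Q h1
      · exact hh Q h1
    · push Not at hh
      obtain ⟨Q, hQ, h1⟩ := hh
      apply mem_union_right
      rw [mem_biUnion]
      exact ⟨Q, hQ, mem_permAvoid.2 ⟨h1, hσ.2⟩⟩
  have h1 := (card_le_card h).trans (card_union_le _ _)
  have h2 := h1.trans (Nat.add_le_add_left card_biUnion_le _)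
  have h3 : ((permAvoid ∅ S).card : ℝ) ≤ ((permAvoid ∅ (S ∪ T)).card : ℝ) +
      ∑ Q ∈ T, ((permAvoid Q S).card : ℝ) := by exact_mod_cast h2
  linarith

/-- Local sparsity of the family `𝓑` of forbidden patterns: the total probability of forbidden
patterns through any given cell is at most `ε / n`. -/
def CellSparse (𝓑 : Finset (Finset (V × V))) (ε : ℝ) : Prop :=
  ∀ p v : V, ∑ Q ∈ 𝓑.filter (fun Q => (p, v) ∈ Q), patWeight (Fintype.card V) Q.card
    ≤ ε / Fintype.card V

lemma sum_patWeight_line_le {𝓑 : Finset (Finset (V × V))} {ε : ℝ} (hε : 0 ≤ ε)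
    (h : CellSparse 𝓑 ε) (x : V × V) {T : Finset (Finset (V × V))} (hT : T ⊆ 𝓑)
    (hx : ∀ Q ∈ T, ∃ y ∈ Q, x.1 = y.1 ∨ x.2 = y.2) :
    ∑ Q ∈ T, patWeight (Fintype.card V) Q.card ≤ 2 * ε := by
  have hsub : T ⊆ (univ.biUnion fun v : V => 𝓑.filter (fun Q => (x.1, v) ∈ Q)) ∪
      (univ.biUnion fun p : V => 𝓑.filter (fun Q => (p, x.2) ∈ Q)) := by
    intro Q hQ
    obtain ⟨y, hy, h1 | h1⟩ := hx Q hQ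
    · apply mem_union_left
      simp only [mem_biUnion, mem_univ, true_and, mem_filter]
      exact ⟨y.2, hT hQ, by rw [h1]; exact hy⟩
    · apply mem_union_right
      simp only [mem_biUnion, mem_univ, true_and, mem_filter]
      exact ⟨y.1, hT hQ, by rw [h1]; exact hy⟩
  have hw : ∀ Q : Finset (V × V), 0 ≤ patWeight (Fintype.card V) Q.card :=
    fun Q => patWeight_nonneg _ _
  have hn : (Fintype.card V : ℝ) * (ε / Fintype.card V) ≤ ε := by
    rcases Nat.eq_zero_or_pos (Fintype.card V) with h0 | h0
    · rw [h0]; simpa using hε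
    · have : (Fintype.card V : ℝ) ≠ 0 := by positivity
      rw [mul_div_cancel₀ _ this]
  have hbi : ∀ f : V → Finset (Finset (V × V)),
      (∀ v, ∑ Q ∈ f v, patWeight (Fintype.card V) Q.card ≤ ε / Fintype.card V) →
      ∑ Q ∈ univ.biUnion f, patWeight (Fintype.card V) Q.card ≤ ε := by
    intro f hf
    calc _ ≤ ∑ v : V, ∑ Q ∈ f v, patWeight (Fintype.card V) Q.card :=
          sum_biUnion_le_sum_sum _ _ hw
      _ ≤ ∑ v : V, ε / Fintype.card V := sum_le_sum fun v _ => hf v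
      _ ≤ ε := by simpa using hn
  have h1 := hbi _ fun v => h x.1 v
  have h2 := hbi _ fun p => h p x.2
  have h3 := sum_le_sum_of_subset_of_nonneg hsub (fun Q _ _ => hw Q)
  have h4 := sum_union_inter
    (s₁ := univ.biUnion fun v : V => 𝓑.filter (fun Q => (x.1, v) ∈ Q))
    (s₂ := univ.biUnion fun p : V => 𝓑.filter (fun Q => (p, x.2) ∈ Q))
    (f := fun Q => patWeight (Fintype.card V) Q.card)
  have h5 := sum_nonneg (s := (univ.biUnion fun v : V => 𝓑.filter (fun Q => (x.1, v) ∈ Q)) ∩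
    (univ.biUnion fun p : V => 𝓑.filter (fun Q => (p, x.2) ∈ Q))) fun Q _ => hw Q
  linarith

lemma sum_patWeight_conflict_le {𝓑 : Finset (Finset (V × V))} {ε : ℝ} (hε : 0 ≤ ε)
    (h : CellSparse 𝓑 ε) (P : Finset (V × V)) {T : Finset (Finset (V × V))} (hT : T ⊆ 𝓑)
    (hx : ∀ Q ∈ T, PatConflict P Q) :
    ∑ Q ∈ T, patWeight (Fintype.card V) Q.card ≤ P.card * (2 * ε) := by
  classical
  have hsub : T ⊆ P.biUnion fun x => T.filter (fun Q => ∃ y ∈ Q, x.1 = y.1 ∨ x.2 = y.2) := by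
    intro Q hQ
    obtain ⟨x, hxP, h1⟩ := hx Q hQ
    simp only [mem_biUnion, mem_filter]
    exact ⟨x, hxP, hQ, h1⟩
  have hw : ∀ Q : Finset (V × V), 0 ≤ patWeight (Fintype.card V) Q.card :=
    fun Q => patWeight_nonneg _ _
  calc _ ≤ _ := sum_le_sum_of_subset_of_nonneg hsub (fun Q _ _ => hw Q)
    _ ≤ ∑ x ∈ P, ∑ Q ∈ T.filter (fun Q => ∃ y ∈ Q, x.1 = y.1 ∨ x.2 = y.2),
          patWeight (Fintype.card V) Q.card :=
        sum_biUnion_le_sum_sum _ _ hw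
    _ ≤ ∑ x ∈ P, 2 * ε := sum_le_sum fun x _ =>
        sum_patWeight_line_le hε h x ((filter_subset _ _).trans hT)
          (fun Q hQ => (mem_filter.1 hQ).2)
    _ = P.card * (2 * ε) := by simp

variable {𝓑 : Finset (Finset (V × V))} {ε : ℝ} {K : ℕ}

lemma card_permAvoid_le_two_mul (hε : 0 ≤ ε) (hKε : 8 * K * ε ≤ 1) (h : CellSparse 𝓑 ε)
    (hK : ∀ Q ∈ 𝓑, Q.card ≤ K) :
    ∀ S ⊆ 𝓑, ∀ Q : Finset (V × V), Q.card ≤ K →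
      ((permAvoid Q S).card : ℝ) ≤
        2 * patWeight (Fintype.card V) Q.card * ((permAvoid ∅ S).card : ℝ) := by
  classical
  intro S
  induction S using Finset.strongInduction with
  | H S ih =>
  intro hS Q hQ
  set S1 := S.filter (fun Q' => PatConflict Q Q') with hS1
  set S2 := S.filter (fun Q' => ¬ PatConflict Q Q') with hS2
  have hw := patWeight_nonneg (Fintype.card V) Q.card
  have hun : S2 ∪ S1 = S := by rw [union_comm]; exact filter_union_filter_not_eq _ S
  have h1 : ((permAvoid Q S).card : ℝ) ≤
      patWeight (Fintype.card V) Q.card * ((permAvoid ∅ S2).card : ℝ) := by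
    refine le_trans ?_ (card_permAvoid_le_patWeight_mul fun Q' hQ' => (mem_filter.1 hQ').2)
    exact_mod_cast card_le_card (permAvoid_mono (filter_subset _ _))
  have h2 : ((permAvoid ∅ S2).card : ℝ) ≤ 2 * ((permAvoid ∅ S).card : ℝ) := by
    rcases S1.eq_empty_or_nonempty with h0 | ⟨Q₀, hQ₀⟩
    · rw [h0, union_empty] at hun
      rw [hun]
      linarith [Nat.cast_nonneg (α := ℝ) (permAvoid ∅ S).card]
    · have hss : S2 ⊂ S := by
        refine ⟨filter_subset _ _, fun hh => ?_⟩
        have := hh (mem_filter.1 hQ₀).1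
        exact (mem_filter.1 this).2 (mem_filter.1 hQ₀).2
      have h3 := card_permAvoid_sub_sum_le S2 S1
      rw [hun] at h3
      have h4 : ∑ Q' ∈ S1, ((permAvoid Q' S2).card : ℝ) ≤
          ∑ Q' ∈ S1, 2 * patWeight (Fintype.card V) Q'.card * ((permAvoid ∅ S2).card : ℝ) :=
        sum_le_sum fun Q' hQ' => ih S2 hss ((filter_subset _ _).trans hS) Q'
          (hK Q' (hS (mem_filter.1 hQ').1))
      have h5 : ∑ Q' ∈ S1, patWeight (Fintype.card V) Q'.card ≤ Q.card * (2 * ε) :=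
        sum_patWeight_conflict_le hε h Q ((filter_subset _ _).trans hS)
          (fun Q' hQ' => (mem_filter.1 hQ').2)
      have h6 : (Q.card : ℝ) * (2 * ε) ≤ 1 / 4 := by
        have : (Q.card : ℝ) ≤ K := by exact_mod_cast hQ
        nlinarith
      rw [← sum_mul, ← mul_sum] at h4
      have h7 : (0 : ℝ) ≤ ((permAvoid ∅ S2).card : ℝ) := Nat.cast_nonneg _
      nlinarith
  nlinarith

lemma half_card_permAvoid_le (hε : 0 ≤ ε) (hKε : 8 * K * ε ≤ 1) (hε8 : 8 * ε ≤ 1)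
    (h : CellSparse 𝓑 ε) (hK : ∀ Q ∈ 𝓑, Q.card ≤ K) (x : V × V)
    {S T : Finset (Finset (V × V))} (hS : S ⊆ 𝓑) (hT : T ⊆ 𝓑)
    (hx : ∀ Q ∈ T, ∃ y ∈ Q, x.1 = y.1 ∨ x.2 = y.2) :
    ((permAvoid ∅ S).card : ℝ) ≤ 2 * ((permAvoid ∅ (S ∪ T)).card : ℝ) := by
  have h3 := card_permAvoid_sub_sum_le S T
  have h4 : ∑ Q' ∈ T, ((permAvoid Q' S).card : ℝ) ≤
      ∑ Q' ∈ T, 2 * patWeight (Fintype.card V) Q'.card * ((permAvoid ∅ S).card : ℝ) :=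
    sum_le_sum fun Q' hQ' => card_permAvoid_le_two_mul hε hKε h hK S hS Q' (hK Q' (hT hQ'))
  have h5 := sum_patWeight_line_le hε h x hT hx
  rw [← sum_mul, ← mul_sum] at h4
  have h7 : (0 : ℝ) ≤ ((permAvoid ∅ S).card : ℝ) := Nat.cast_nonneg _
  nlinarith

lemma card_permAvoid_pos (hε : 0 ≤ ε) (hKε : 8 * K * ε ≤ 1) (hε8 : 8 * ε ≤ 1)
    (h : CellSparse 𝓑 ε) (hK : ∀ Q ∈ 𝓑, Q.card ≤ K) (hne : ∀ Q ∈ 𝓑, Q.Nonempty) :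
    0 < (permAvoid ∅ 𝓑).card := by
  suffices H : ∀ S ⊆ 𝓑, 0 < (permAvoid ∅ S).card from H 𝓑 subset_rfl
  intro S
  induction S using Finset.induction_on with
  | empty =>
    intro _
    rw [card_pos]
    exact ⟨1, mem_permAvoid.2 ⟨by simp [PermHolds], by simp⟩⟩
  | insert Q S hQ ih =>
    intro hS
    have h1 := ih ((subset_insert _ _).trans hS)
    obtain ⟨x, hx⟩ := hne Q (hS (mem_insert_self _ _))
    have h2 := half_card_permAvoid_le hε hKε hε8 h hK x ((subset_insert _ _).trans hS)
      (T := {Q}) (by simpa using hS (mem_insert_self _ _))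
      (fun Q' hQ' => ⟨x, by rw [mem_singleton.1 hQ']; exact hx, Or.inl rfl⟩)
    rw [union_comm, ← insert_eq] at h2
    have h3 : (0 : ℝ) < ((permAvoid ∅ S).card : ℝ) := by exact_mod_cast h1
    have h4 : (0 : ℝ) < ((permAvoid ∅ (insert Q S)).card : ℝ) := by linarith
    exact_mod_cast h4

/-- Conditioning on avoiding all forbidden patterns distorts the probability of a pattern `P` by
at most a factor `2 ^ |P|`. -/
lemma card_permAvoid_le_two_pow (hε : 0 ≤ ε) (hKε : 8 * K * ε ≤ 1) (hε8 : 8 * ε ≤ 1)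
    (h : CellSparse 𝓑 ε) (hK : ∀ Q ∈ 𝓑, Q.card ≤ K) (P : Finset (V × V)) :
    ((permAvoid P 𝓑).card : ℝ) ≤
      2 ^ P.card * patWeight (Fintype.card V) P.card * ((permAvoid ∅ 𝓑).card : ℝ) := by
  classical
  have key : ∀ P' : Finset (V × V),
      ((permAvoid ∅ (𝓑.filter (fun Q => ¬ PatConflict P' Q))).card : ℝ) ≤
        2 ^ P'.card * ((permAvoid ∅ 𝓑).card : ℝ) := by
    intro P'
    induction P' using Finset.induction_on with
    | empty => simp [PatConflict]
    | insert x P' hx ih =>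
      have h1 := half_card_permAvoid_le hε hKε hε8 h hK x
        (S := 𝓑.filter (fun Q => ¬ PatConflict (insert x P') Q))
        (T := 𝓑.filter (fun Q => ¬ PatConflict P' Q ∧ ∃ y ∈ Q, x.1 = y.1 ∨ x.2 = y.2))
        (filter_subset _ _) (filter_subset _ _) (fun Q hQ => (mem_filter.1 hQ).2.2)
      have h2 : 𝓑.filter (fun Q => ¬ PatConflict (insert x P') Q) ∪
          𝓑.filter (fun Q => ¬ PatConflict P' Q ∧ ∃ y ∈ Q, x.1 = y.1 ∨ x.2 = y.2) =
          𝓑.filter (fun Q => ¬ PatConflict P' Q) := by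
        have hc : ∀ Q : Finset (V × V), PatConflict (insert x P') Q ↔
            (∃ y ∈ Q, x.1 = y.1 ∨ x.2 = y.2) ∨ PatConflict P' Q := by
          intro Q
          simp only [PatConflict, mem_insert, exists_eq_or_imp]
        ext Q
        rw [mem_union, mem_filter, mem_filter, mem_filter, hc]
        generalize (∃ y ∈ Q, x.1 = y.1 ∨ x.2 = y.2) = a
        generalize PatConflict P' Q = b
        tauto
      rw [h2] at h1
      rw [card_insert_of_notMem hx, pow_succ]
      linarith
  have h1 : ((permAvoid P 𝓑).card : ℝ) ≤ patWeight (Fintype.card V) P.card *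
      ((permAvoid ∅ (𝓑.filter (fun Q => ¬ PatConflict P Q))).card : ℝ) := by
    refine le_trans ?_ (card_permAvoid_le_patWeight_mul fun Q' hQ' => (mem_filter.1 hQ').2)
    exact_mod_cast card_le_card (permAvoid_mono (filter_subset _ _))
  calc _ ≤ _ := h1
    _ ≤ _ := mul_le_mul_of_nonneg_left (key P) (patWeight_nonneg _ _)
    _ = _ := by ring

end PermLocalLemma

/-! ### Tilings by cliques -/

/-- `A` can be partitioned into `r`-cliques of `H`. -/
def Tileable {U : Type*} [DecidableEq U] (H : SimpleGraph U) (r : ℕ) (A : Finset U) : Prop :=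
  ∃ F : Finset (Finset U), (∀ K ∈ F, H.IsNClique r K) ∧ (F : Set (Finset U)).PairwiseDisjoint id ∧
    F.biUnion id = A

section Tileable

variable {U : Type*} [DecidableEq U] {H : SimpleGraph U} {r : ℕ} {A B : Finset U}

lemma tileable_empty : Tileable H r ∅ := ⟨∅, by simp, by simp, by simp⟩

lemma tileable_of_isNClique (h : H.IsNClique r A) : Tileable H r A :=
  ⟨{A}, by simpa using h, by simp, by simp⟩

lemma Tileable.union (hA : Tileable H r A) (hB : Tileable H r B) (h : Disjoint A B) :
    Tileable H r (A ∪ B) := by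
  obtain ⟨F, h1, h2, h3⟩ := hA
  obtain ⟨F', h1', h2', h3'⟩ := hB
  have hsub : ∀ K ∈ F, K ⊆ A := fun K hK => h3 ▸ subset_biUnion_of_mem id hK
  have hsub' : ∀ K ∈ F', K ⊆ B := fun K hK => h3' ▸ subset_biUnion_of_mem id hK
  refine ⟨F ∪ F', ?_, ?_, ?_⟩
  · intro K hK
    exact (mem_union.1 hK).elim (h1 K) (h1' K)
  · intro K hK K' hK' hne
    rw [coe_union] at hK hK'
    rcases hK with hK | hK <;> rcases hK' with hK' | hK'
    · exact h2 hK hK' hne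
    · exact disjoint_of_subset_left (hsub _ hK) (disjoint_of_subset_right (hsub' _ hK') h)
    · exact disjoint_of_subset_left (hsub' _ hK) (disjoint_of_subset_right (hsub _ hK') h.symm)
    · exact h2' hK hK' hne
  · rw [union_biUnion, h3, h3']

lemma Tileable.dvd_card (hA : Tileable H r A) : r ∣ A.card := by
  obtain ⟨F, h1, h2, h3⟩ := hA
  rw [← h3, card_biUnion h2]
  exact dvd_sum fun K hK => (h1 K hK).card_eq ▸ dvd_rfl

lemma Tileable.image {W : Type*} [DecidableEq W] {G : SimpleGraph W} {φ : U → W}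
    (hA : Tileable (G.comap φ) r A) (hφ : Set.InjOn φ A) : Tileable G r (A.image φ) := by
  obtain ⟨F, h1, h2, h3⟩ := hA
  have hsub : ∀ K ∈ F, K ⊆ A := fun K hK => h3 ▸ subset_biUnion_of_mem id hK
  refine ⟨F.image (fun K => K.image φ), ?_, ?_, ?_⟩
  · intro K' hK'
    obtain ⟨K, hK, rfl⟩ := mem_image.1 hK'
    have h := h1 K hK
    rw [SimpleGraph.isNClique_iff]
    constructor
    · intro x hx y hy hxy
      simp only [coe_image, Set.mem_image, mem_coe] at hx hy
      obtain ⟨u, hu, rfl⟩ := hx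
      obtain ⟨v, hv, rfl⟩ := hy
      exact h.isClique hu hv (fun huv => hxy (by rw [huv]))
    · rw [card_image_of_injOn (hφ.mono (by exact_mod_cast hsub K hK)), h.card_eq]
  · intro x hx y hy hxy
    simp only [coe_image, Set.mem_image, mem_coe] at hx hy
    obtain ⟨K, hK, rfl⟩ := hx
    obtain ⟨K', hK', rfl⟩ := hy
    have hne : K ≠ K' := fun h => hxy (by rw [h])
    have hd := h2 hK hK' hne
    simp only [Function.onFun, id] at hd ⊢
    rw [disjoint_left] at hd ⊢
    intro z hz hz'
    obtain ⟨u, hu, rfl⟩ := mem_image.1 hz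
    obtain ⟨v, hv, huv⟩ := mem_image.1 hz'
    have : v = u := hφ (hsub _ hK' hv) (hsub _ hK hu) huv
    exact hd hu (this ▸ hv)
  · rw [← h3]
    ext x
    simp only [mem_biUnion, mem_image, id]
    constructor
    · rintro ⟨_, ⟨K, hK, rfl⟩, hx⟩
      obtain ⟨u, hu, rfl⟩ := mem_image.1 hx
      exact ⟨u, ⟨K, hK, hu⟩, rfl⟩
    · rintro ⟨u, ⟨K, hK, hu⟩, rfl⟩
      exact ⟨_, ⟨K, hK, rfl⟩, mem_image_of_mem _ hu⟩

end Tileable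

/-! ### Heavy cliques in weighted graphs of large minimum degree -/

section HeavyClique

variable {V : Type*} [DecidableEq V]

lemma exists_sorted_values (W : Finset V) (hW : W.Nonempty) (y : V → ℝ) :
    ∃ Y : ℕ → ℝ, Monotone Y ∧ ∑ i ∈ range W.card, Y i = ∑ v ∈ W, y v ∧
      (∃ v ∈ W, Y 0 = y v) ∧ (∀ v ∈ W, Y 0 ≤ y v) ∧
      ∀ k ≤ W.card, ∃ L ⊆ W, L.card = k ∧ ∀ x ∈ L, y x ≤ Y (k - 1) := by
  classical
  set m := W.card with hm
  have hm0 : 0 < m := hW.card_pos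
  let f : Fin m ≃ W := W.equivFin.symm
  let σ := Tuple.sort (fun i => y (f i))
  have hσ : Monotone (fun i => y (f (σ i))) := Tuple.monotone_sort (fun i => y (f i))
  have hlt : ∀ i, min i (m - 1) < m := fun i => by omega
  refine ⟨fun i => y (f (σ ⟨min i (m - 1), hlt i⟩)), ?_, ?_, ?_, ?_, ?_⟩
  · intro i j hij
    exact hσ (by simp only [Fin.mk_le_mk]; omega)
  · rw [Finset.sum_range, ← Finset.sum_coe_sort W]
    rw [← Equiv.sum_comp (σ.trans f) (fun v : W => y v)]
    refine Finset.sum_congr rfl fun i _ => ?_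
    have : (⟨min (i : ℕ) (m - 1), hlt i⟩ : Fin m) = i := by
      apply Fin.ext
      have := i.2
      simp only
      omega
    rw [this]; rfl
  · exact ⟨_, (f _).2, rfl⟩
  · intro v hv
    obtain ⟨i, hi⟩ := (σ.trans f).surjective ⟨v, hv⟩
    have : y v = y (f (σ i)) := by
      have := congrArg Subtype.val hi
      simp only [Equiv.trans_apply] at this
      rw [this]
    rw [this]
    exact hσ (by rw [Fin.le_def]; simp)
  · intro k hk
    refine ⟨(univ.filter (fun i : Fin m => (i : ℕ) < k)).image (fun i => (f (σ i) : V)),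
      ?_, ?_, ?_⟩
    · intro x hx
      obtain ⟨i, _, rfl⟩ := mem_image.1 hx
      exact (f (σ i)).2
    · rw [card_image_of_injective]
      · rw [Fin.card_filter_val_lt]; omega
      · intro i j hij
        exact σ.injective (f.injective (Subtype.ext hij))
    · intro x hx
      obtain ⟨i, hi, rfl⟩ := mem_image.1 hx
      have hi := (mem_filter.1 hi).2
      apply hσ
      rw [Fin.le_def]
      simp only
      have := i.2
      omega

/-- Vertices of `W` adjacent to all of `K`. -/
lemma card_le_card_common_nbhd (H : SimpleGraph V) [DecidableRel H.Adj] (W K : Finset V) {D : ℕ}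
    (hK : K ⊆ W) (hdeg : ∀ v ∈ W, (W.filter (fun u => ¬ H.Adj v u)).card ≤ D) :
    (W \ W.filter (fun u => ∀ v ∈ K, H.Adj v u)).card ≤ K.card * D := by
  have : W \ W.filter (fun u => ∀ v ∈ K, H.Adj v u) ⊆
      K.biUnion fun v => W.filter (fun u => ¬ H.Adj v u) := by
    intro u hu
    simp only [mem_sdiff, mem_filter, not_and, not_forall] at hu
    obtain ⟨v, hv, h⟩ := hu.2 hu.1
    exact mem_biUnion.2 ⟨v, hv, mem_filter.2 ⟨hu.1, h⟩⟩
  exact (card_le_card this).trans (card_biUnion_le_card_mul _ _ _ fun v hv => hdeg v (hK hv))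

lemma exists_clique_insert {H : SimpleGraph V} [DecidableRel H.Adj] {W K : Finset V} {D i : ℕ}
    (hdeg : ∀ v ∈ W, (W.filter (fun u => ¬ H.Adj v u)).card ≤ D) {y : V → ℝ} {Y : ℕ → ℝ}
    (hY : ∀ k ≤ W.card, ∃ L ⊆ W, L.card = k ∧ ∀ x ∈ L, y x ≤ Y (k - 1))
    (hi : i * D < W.card) (hKW : K ⊆ W) (hK : H.IsNClique i K) :
    ∃ K' ⊆ W, H.IsNClique (i + 1) K' ∧ ∑ v ∈ K', y v ≤ ∑ v ∈ K, y v + Y (i * D) := by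
  obtain ⟨L, hLW, hLc, hL⟩ := hY (i * D + 1) hi
  have h1 := card_le_card_common_nbhd H W K hKW hdeg
  rw [hK.card_eq] at h1
  have : ∃ x ∈ L, x ∉ W \ W.filter (fun u => ∀ v ∈ K, H.Adj v u) := by
    apply exists_mem_notMem_of_card_lt_card
    omega
  obtain ⟨x, hxL, hx⟩ := this
  have hxW := hLW hxL
  have hadj : ∀ v ∈ K, H.Adj v x := by
    by_contra hcon
    exact hx (mem_sdiff.2 ⟨hxW, fun hh => hcon (mem_filter.1 hh).2⟩)
  have hxK : x ∉ K := fun hh => H.loopless.irrefl x (hadj x hh)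
  refine ⟨insert x K, insert_subset hxW hKW, hK.insert fun v hv => (hadj v hv).symm, ?_⟩
  rw [sum_insert hxK]
  have := hL x hxL
  simp only [Nat.add_sub_cancel] at this
  linarith

lemma exists_clique_extend {H : SimpleGraph V} [DecidableRel H.Adj] {W K : Finset V} {D i : ℕ}
    (hdeg : ∀ v ∈ W, (W.filter (fun u => ¬ H.Adj v u)).card ≤ D) {y : V → ℝ} {Y : ℕ → ℝ}
    (hY : ∀ k ≤ W.card, ∃ L ⊆ W, L.card = k ∧ ∀ x ∈ L, y x ≤ Y (k - 1))
    (hKW : K ⊆ W) (hK : H.IsNClique i K) {j : ℕ} (hij : i ≤ j) (hj : ∀ t < j, t * D < W.card) :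
    ∃ K' ⊆ W, H.IsNClique j K' ∧ ∑ v ∈ K', y v ≤ ∑ v ∈ K, y v + ∑ t ∈ Ico i j, Y (t * D) := by
  induction j, hij using Nat.le_induction with
  | base => exact ⟨K, hKW, hK, by simp⟩
  | succ j hij ih =>
    obtain ⟨K', h1, h2, h3⟩ := ih fun t ht => hj t (by omega)
    obtain ⟨K'', h4, h5, h6⟩ := exists_clique_insert hdeg hY (hj j (by omega)) h1 h2
    refine ⟨K'', h4, h5, ?_⟩
    rw [Finset.sum_Ico_succ_top hij]
    linarith

lemma sum_range_mul_ge {Y : ℕ → ℝ} (hY : Monotone Y) {D e : ℕ} (he : e ≤ D) (k : ℕ) :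
    D * ∑ t ∈ range k, Y (t * D) + e * ∑ t ∈ range k, (Y ((t + 1) * D - e) - Y (t * D)) ≤
      ∑ i ∈ range (k * D), Y i := by
  induction k with
  | zero => simp
  | succ k ih =>
    have h0 : (k + 1) * D = k * D + D := by ring
    rw [sum_range_succ, sum_range_succ, h0, sum_range_add]
    have h1 : ∑ i ∈ range D, Y (k * D + i) =
        ∑ i ∈ range (D - e), Y (k * D + i) + ∑ i ∈ range e, Y (k * D + (D - e) + i) := by
      obtain ⟨c, rfl⟩ : ∃ c, D = c + e := ⟨D - e, by omega⟩
      rw [Nat.add_sub_cancel, sum_range_add]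
      simp only [add_assoc]
    have h2 : ((D - e : ℕ) : ℝ) * Y (k * D) ≤ ∑ i ∈ range (D - e), Y (k * D + i) := by
      have := Finset.card_nsmul_le_sum (range (D - e)) (fun i => Y (k * D + i)) (Y (k * D))
        (fun i _ => hY (by omega))
      simpa using this
    have h3 : (e : ℝ) * Y (k * D + D - e) ≤ ∑ i ∈ range e, Y (k * D + (D - e) + i) := by
      have := Finset.card_nsmul_le_sum (range e) (fun i => Y (k * D + (D - e) + i))
        (Y (k * D + D - e)) (fun i _ => hY (by omega))
      simpa using this
    rw [Nat.cast_sub he] at h2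
    rw [h1]
    linarith

/-- In a graph where every vertex misses at most about a `1/r` proportion of `W`, and where
no set of slightly fewer than `|W|/r` vertices is independent, every weighting admits an `r`-clique
of at least average weight. -/
lemma exists_heavy_clique (H : SimpleGraph V) [DecidableRel H.Adj] (W : Finset V) {r D e s : ℕ}
    (hr : 2 ≤ r) (hD : r * D = W.card + s) (hse : 3 * s ≤ e) (heD : e ≤ D)
    (hs : 4 * r ^ 2 * s ≤ W.card) (hW : W.Nonempty)
    (hdeg : ∀ v ∈ W, (W.filter (fun u => ¬ H.Adj v u)).card ≤ D)
    (hind : ∀ X ⊆ W, D - e ≤ X.card → ∃ x ∈ X, ∃ y ∈ X, H.Adj x y) (p : V → ℝ) :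
    ∃ K ⊆ W, H.IsNClique r K ∧ r * ∑ v ∈ W, p v ≤ W.card * ∑ v ∈ K, p v := by
  obtain ⟨v₀, hv₀, hmax⟩ := exists_max_image W p hW
  set y : V → ℝ := fun v => p v₀ - p v with hy
  have hy0 : ∀ v ∈ W, 0 ≤ y v := fun v hv => sub_nonneg.2 (hmax v hv)
  suffices h : ∃ K ⊆ W, H.IsNClique r K ∧ W.card * ∑ v ∈ K, y v ≤ r * ∑ v ∈ W, y v by
    obtain ⟨K, hKW, hK, h⟩ := h
    refine ⟨K, hKW, hK, ?_⟩
    simp only [hy, sum_sub_distrib, sum_const, nsmul_eq_mul, hK.card_eq] at h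
    nlinarith
  obtain ⟨Y, hmono, hsum, ⟨v₁, hv₁, hY1⟩, hYle, hY⟩ := exists_sorted_values W hW y
  have hY0 : Y 0 = 0 := le_antisymm ((hYle v₀ hv₀).trans (by simp [hy])) (hY1 ▸ hy0 v₁ hv₁)
  have hYnn : ∀ i, 0 ≤ Y i := fun i => hY0 ▸ hmono (Nat.zero_le i)
  by_contra hcon
  push Not at hcon
  have hm0 : 0 < W.card := hW.card_pos
  have hsD : s < D := by
    rcases Nat.eq_zero_or_pos s with h | h
    · rcases Nat.eq_zero_or_pos D with h' | h'
      · subst h h'; omega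
      · omega
    · omega
  obtain ⟨q, rfl⟩ : ∃ q, r = q + 1 := ⟨r - 1, by omega⟩
  have hqD : q * D + D = W.card + s := by rw [← hD]; ring
  have htD : ∀ t < q + 1, t * D < W.card := by
    intro t ht
    have : t * D ≤ q * D := Nat.mul_le_mul_right _ (by omega)
    omega
  set A : ℝ := ∑ t ∈ range (q + 1), Y (t * D) with hA
  set G : ℝ := ∑ t ∈ range q, (Y ((t + 1) * D - e) - Y (t * D)) with hG
  set J : ℝ := ∑ t ∈ range q, (Y ((t + 1) * D) - Y ((t + 1) * D - e)) with hJ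
  have hA0 : 0 ≤ A := sum_nonneg fun t _ => hYnn _
  have hG0 : 0 ≤ G := sum_nonneg fun t _ => sub_nonneg.2 (hmono (by
    have : (t + 1) * D = t * D + D := by ring
    omega))
  have hJ0 : 0 ≤ J := sum_nonneg fun t _ => sub_nonneg.2 (hmono (by omega))
  have hGJ : Y (q * D) = G + J := by
    rw [hG, hJ, ← sum_add_distrib]
    have := Finset.sum_range_sub (fun t => Y (t * D)) q
    simp only [zero_mul, hY0, sub_zero] at this
    rw [← this]
    exact sum_congr rfl fun t _ => by ring
  have hbound : (D : ℝ) * A + e * G - s * (G + J) ≤ ∑ v ∈ W, y v := by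
    rw [← hsum]
    have h1 := sum_range_mul_ge hmono heD q
    have h2 : W.card = q * D + (D - s) := by omega
    rw [h2, sum_range_add, hA, sum_range_succ, ← hGJ]
    have h3 : ((D - s : ℕ) : ℝ) * Y (q * D) ≤ ∑ i ∈ range (D - s), Y (q * D + i) := by
      have := Finset.card_nsmul_le_sum (range (D - s)) (fun i => Y (q * D + i)) (Y (q * D))
        (fun i _ => hmono (by omega))
      simpa using this
    rw [Nat.cast_sub hsD.le] at h3
    linarith
  have hDr : ((q + 1 : ℕ) : ℝ) * D = W.card + s := by exact_mod_cast hD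
  set m : ℝ := (W.card : ℝ) with hm
  have hmpos : 0 < m := by rw [hm]; exact_mod_cast hm0
  set r' : ℝ := ((q + 1 : ℕ) : ℝ) with hr'
  have hrpos : 0 < r' := by rw [hr']; positivity
  have hs' : (0 : ℝ) ≤ s := Nat.cast_nonneg _
  have he' : (0 : ℝ) ≤ e := Nat.cast_nonneg _
  have hbound' : (m + s) * A + r' * (e * G) - r' * (s * (G + J)) ≤ r' * ∑ v ∈ W, y v := by
    have := mul_le_mul_of_nonneg_left hbound hrpos.le
    rw [← hDr]
    linarith
  have hsA : 0 ≤ s * A := mul_nonneg hs' hA0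
  have hbase : r' * (e * G) < r' * (s * (G + J)) := by
    obtain ⟨K, h1, h2, h3⟩ := exists_clique_extend (K := ∅) (i := 0) (j := q + 1) hdeg hY
      (empty_subset _) (by simp [SimpleGraph.isNClique_iff]) (Nat.zero_le _) htD
    rw [sum_empty, zero_add, ← range_eq_Ico, ← hA] at h3
    have h4 := hcon K h1 h2
    have h5 := mul_le_mul_of_nonneg_left h3 hmpos.le
    linarith
  have hstep : ∀ t ∈ range q, -(r' * (s * (G + J))) ≤
      m * ((Y ((t + 1) * D - e) - Y (t * D)) - (Y ((t + 1) * D) - Y ((t + 1) * D - e))) := by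
    intro j hj
    have hj := mem_range.1 hj
    obtain ⟨K₀, h1, h2, h3⟩ := exists_clique_extend (K := ∅) (i := 0) (j := j) hdeg hY
      (empty_subset _) (by simp [SimpleGraph.isNClique_iff]) (Nat.zero_le _)
      (fun t ht => htD t (by omega))
    obtain ⟨L, hLW, hLc, hL⟩ := hY ((j + 1) * D - e) (by
      have := htD (j + 1) (by omega)
      omega)
    have hc := card_le_card_common_nbhd H W K₀ h1 hdeg
    rw [h2.card_eq] at hc
    set N := W.filter (fun u => ∀ v ∈ K₀, H.Adj v u) with hN
    have hX : D - e ≤ (L ∩ N).card := by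
      have h5 : (L \ N).card ≤ j * D := (card_le_card (sdiff_subset_sdiff hLW subset_rfl)).trans hc
      have h6 := card_inter_add_card_sdiff L N
      have h7 : (j + 1) * D = j * D + D := by ring
      omega
    obtain ⟨x, hx, x', hx', hadj⟩ := hind _ (inter_subset_left.trans hLW) hX
    rw [mem_inter] at hx hx'
    have hxN := (mem_filter.1 hx.2).2
    have hxN' := (mem_filter.1 hx'.2).2
    have hxK : x ∉ K₀ := fun hh => H.loopless.irrefl x (hxN x hh)
    have hxK' : x' ∉ insert x K₀ := by
      rw [mem_insert]
      rintro (h | h)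
      · exact hadj.ne h.symm
      · exact H.loopless.irrefl x' (hxN' x' h)
    have hK1 : H.IsNClique (j + 1) (insert x K₀) := h2.insert fun v hv => (hxN v hv).symm
    have hK2 : H.IsNClique (j + 1 + 1) (insert x' (insert x K₀)) := hK1.insert fun v hv => by
      rcases mem_insert.1 hv with rfl | hv
      · exact hadj.symm
      · exact (hxN' v hv).symm
    obtain ⟨K, h8, h9, h10⟩ := exists_clique_extend (j := q + 1) hdeg hY
      (insert_subset (hLW hx'.1) (insert_subset (hLW hx.1) h1)) hK2 (by omega) htD
    rw [sum_insert hxK', sum_insert hxK] at h10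
    have h11 : y x ≤ Y ((j + 1) * D - e) := (hL x hx.1).trans (hmono (by omega))
    have h12 : y x' ≤ Y ((j + 1) * D - e) := (hL x' hx'.1).trans (hmono (by omega))
    have h13 : A = ∑ t ∈ Ico 0 j, Y (t * D) + Y (j * D) + Y ((j + 1) * D) +
        ∑ t ∈ Ico (j + 1 + 1) (q + 1), Y (t * D) := by
      rw [hA, range_eq_Ico, ← Finset.sum_Ico_succ_top (Nat.zero_le j),
        ← Finset.sum_Ico_succ_top (Nat.zero_le (j + 1)),
        Finset.sum_Ico_consecutive _ (Nat.zero_le _) (by omega)]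
    have h14 := hcon K h8 h9
    rw [sum_empty] at h3
    have h15 : ∑ v ∈ K, y v ≤ A - Y (j * D) - Y ((j + 1) * D) + 2 * Y ((j + 1) * D - e) := by
      linarith
    have h16 := mul_le_mul_of_nonneg_left h15 hmpos.le
    have h17 : 0 ≤ r' * (e * G) := by positivity
    nlinarith
  have hsumstep := sum_le_sum hstep
  rw [← mul_sum, sum_sub_distrib, ← hG, ← hJ, sum_const, card_range, nsmul_eq_mul] at hsumstep
  have hq : (q : ℝ) = r' - 1 := by rw [hr']; push_cast; ring
  have hsm : 4 * r' ^ 2 * s ≤ m := by rw [hm, hr']; exact_mod_cast hs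
  have hse' : 3 * (s : ℝ) ≤ e := by exact_mod_cast hse
  have hGJ0 : 0 ≤ G + J := by linarith
  have h1 : -((G + J) / 4) ≤ G - J := by
    have h2 : (r' - 1) * (r' * (s * (G + J))) ≤ m * ((G + J) / 4) := by
      have h3 := mul_le_mul_of_nonneg_right hsm hGJ0
      have h4 : 0 ≤ r' * (s * (G + J)) := by positivity
      nlinarith
    have h5 : m * -((G + J) / 4) ≤ m * (G - J) := by
      rw [hq] at hsumstep
      linarith
    exact le_of_mul_le_mul_left h5 hmpos
  have h2 : (e : ℝ) * G < s * (G + J) := lt_of_mul_lt_mul_left hbase hrpos.le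
  have h3 : s * (G + J) ≤ s * (8 / 3 * G) := mul_le_mul_of_nonneg_left (by linarith) hs'
  have h4 : 3 * (s : ℝ) * G ≤ e * G := mul_le_mul_of_nonneg_right hse' hG0
  have h5 : 0 ≤ s * G := mul_nonneg hs' hG0
  linarith

end HeavyClique

/-! ### Greedy tiling guided by an exponential potential -/

section Potential

variable {U : Type*} [DecidableEq U] {ι : Type*} [Fintype ι]

/-- Exponential potential measuring how far the densities of the sets `X i` in `W` exceed `ρ i`. -/
noncomputable def devPotential (X : ι → Finset U) (ρ : ι → ℝ) (lam : ℝ) (W : Finset U) : ℝ :=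
  ∑ i, Real.exp (lam * (((X i ∩ W).card : ℝ) / W.card - ρ i))

lemma exp_le_one_add_add_sq {t : ℝ} (ht : |t| ≤ 1) : Real.exp t ≤ 1 + t + t ^ 2 := by
  have := Real.abs_exp_sub_one_sub_id_le ht
  have := (abs_le.1 this).2
  linarith

lemma devPotential_step (X : ι → Finset U) (ρ : ι → ℝ) {lam : ℝ} (hlam : 0 ≤ lam)
    {W K : Finset U} (hKW : K ⊆ W) {r : ℕ} (hK : K.card = r) (hr : r < W.card)
    (hsmall : lam * (r / (W.card - r)) ≤ 1)
    (hp : r * ∑ v ∈ W, ∑ i, (if v ∈ X i then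
        Real.exp (lam * (((X i ∩ W).card : ℝ) / W.card - ρ i)) else 0) ≤
      W.card * ∑ v ∈ K, ∑ i, (if v ∈ X i then
        Real.exp (lam * (((X i ∩ W).card : ℝ) / W.card - ρ i)) else 0)) :
    devPotential X ρ lam (W \ K) ≤
      devPotential X ρ lam W * Real.exp ((lam * (r / (W.card - r))) ^ 2) := by
  set E : ι → ℝ := fun i => Real.exp (lam * (((X i ∩ W).card : ℝ) / W.card - ρ i)) with hE
  have hsum : ∀ T : Finset U, ∑ v ∈ T, ∑ i, (if v ∈ X i then E i else 0) =
      ∑ i, E i * ((X i ∩ T).card : ℝ) := by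
    intro T
    rw [sum_comm]
    refine sum_congr rfl fun i _ => ?_
    rw [← sum_filter, sum_const, nsmul_eq_mul, mul_comm, filter_mem_eq_inter, inter_comm]
  rw [hsum, hsum] at hp
  have hw0 : (0 : ℝ) < W.card := by
    have : 0 < W.card := by omega
    exact_mod_cast this
  have hwr : (0 : ℝ) < W.card - r := by
    have : (r : ℝ) < W.card := by exact_mod_cast hr
    linarith
  have hcard : ((W \ K).card : ℝ) = W.card - r := by
    rw [card_sdiff_of_subset hKW, hK, Nat.cast_sub hr.le]
  set d : ι → ℝ := fun i =>
    (r * ((X i ∩ W).card / W.card) - (X i ∩ K).card) / (W.card - r) with hd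
  have hdd : ∀ i, ((X i ∩ (W \ K)).card : ℝ) / (W \ K).card =
      (X i ∩ W).card / W.card + d i := by
    intro i
    have h1 : ((X i ∩ (W \ K)).card : ℝ) = (X i ∩ W).card - (X i ∩ K).card := by
      have h2 : X i ∩ (W \ K) = (X i ∩ W) \ (X i ∩ K) := by
        ext x; simp only [mem_inter, mem_sdiff]; tauto
      rw [h2, card_sdiff_of_subset (inter_subset_inter_left hKW),
        Nat.cast_sub (card_le_card (inter_subset_inter_left hKW))]
    rw [h1, hcard, hd]
    field_simp
    ring
  have hdabs : ∀ i, |d i| ≤ r / (W.card - r) := by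
    intro i
    rw [hd]
    simp only
    rw [abs_div, abs_of_pos hwr]
    apply div_le_div_of_nonneg_right _ hwr.le
    have h1 : ((X i ∩ W).card : ℝ) / W.card ≤ 1 := by
      rw [div_le_one hw0]; exact_mod_cast card_le_card inter_subset_right
    have h2 : (0 : ℝ) ≤ ((X i ∩ W).card : ℝ) / W.card := by positivity
    have h3 : ((X i ∩ K).card : ℝ) ≤ r := by
      rw [← hK]; exact_mod_cast card_le_card inter_subset_right
    have h4 : (0 : ℝ) ≤ ((X i ∩ K).card : ℝ) := by positivity
    have h5 : (0 : ℝ) ≤ (r : ℝ) := by positivity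
    rw [abs_le]
    constructor <;> nlinarith
  set a : ℝ := lam * (r / (W.card - r)) with ha
  have hterm : ∀ i, Real.exp (lam * (((X i ∩ (W \ K)).card : ℝ) / (W \ K).card - ρ i)) ≤
      E i * (1 + a ^ 2) + lam * (E i * d i) := by
    intro i
    have h1 : |lam * d i| ≤ a := by
      rw [abs_mul, abs_of_nonneg hlam]
      exact mul_le_mul_of_nonneg_left (hdabs i) hlam
    have h2 := exp_le_one_add_add_sq (h1.trans hsmall)
    have h3 : (lam * d i) ^ 2 ≤ a ^ 2 := by
      rw [← sq_abs]; exact pow_le_pow_left₀ (abs_nonneg _) h1 2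
    have h4 : Real.exp (lam * (((X i ∩ (W \ K)).card : ℝ) / (W \ K).card - ρ i)) =
        E i * Real.exp (lam * d i) := by
      rw [hdd, hE, ← Real.exp_add]
      congr 1; ring
    have h5 : 0 ≤ E i := (Real.exp_pos _).le
    rw [h4]
    nlinarith
  have hneg : ∑ i, E i * d i ≤ 0 := by
    have h1 : ∑ i, E i * d i = (r * ∑ i, E i * ((X i ∩ W).card : ℝ) -
        W.card * ∑ i, E i * ((X i ∩ K).card : ℝ)) / (W.card * (W.card - r)) := by
      rw [mul_sum, mul_sum, ← sum_sub_distrib, sum_div]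
      refine sum_congr rfl fun i _ => ?_
      rw [hd]
      field_simp
    rw [h1]
    exact div_nonpos_of_nonpos_of_nonneg (by linarith) (by positivity)
  have hΦ : devPotential X ρ lam W = ∑ i, E i := rfl
  have hΦ0 : 0 ≤ devPotential X ρ lam W := sum_nonneg fun i _ => (Real.exp_pos _).le
  calc devPotential X ρ lam (W \ K) ≤ ∑ i, (E i * (1 + a ^ 2) + lam * (E i * d i)) :=
        sum_le_sum fun i _ => hterm i
    _ = devPotential X ρ lam W * (1 + a ^ 2) + lam * ∑ i, E i * d i := by
        rw [sum_add_distrib, ← sum_mul, ← mul_sum, hΦ]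
    _ ≤ devPotential X ρ lam W * (1 + a ^ 2) := by nlinarith
    _ ≤ _ := by
        apply mul_le_mul_of_nonneg_left _ hΦ0
        have := Real.add_one_le_exp (a ^ 2)
        linarith

set_option maxHeartbeats 1000000 in
/-- If every subset of `R` with typical densities has, for all weights, an `r`-clique of at least
average weight, then all but an `η` proportion of `R` can be tiled with `r`-cliques. -/
lemma exists_tiling_small_leftover (H : SimpleGraph U) (R : Finset U) (X : ι → Finset U)
    (ρ : ι → ℝ) {r : ℕ} (hr : 1 ≤ r) {η dev : ℝ} (hη : 0 < η) (hη1 : η ≤ 1) (hdev : 0 < dev)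
    (hdev1 : dev ≤ 1) (hX : ∀ i, ((X i ∩ R).card : ℝ) ≤ ρ i * R.card)
    (hclique : ∀ W ⊆ R, η * R.card ≤ W.card →
      (∀ i, ((X i ∩ W).card : ℝ) ≤ (ρ i + dev) * W.card) → ∀ p : U → ℝ,
      ∃ K ⊆ W, H.IsNClique r K ∧ r * ∑ v ∈ W, p v ≤ W.card * ∑ v ∈ K, p v)
    (hι : (Fintype.card ι : ℝ) ≤ Real.exp (dev ^ 2 * η ^ 2 / (16 * r) * R.card))
    (hbig : 2 * r ≤ η * R.card) :
    ∃ L ⊆ R, (L.card : ℝ) < η * R.card ∧ Tileable H r (R \ L) := by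
  have hr0 : (0 : ℝ) < r := by exact_mod_cast hr
  set n : ℝ := (R.card : ℝ) with hn
  have hn0 : 0 < n := by
    by_contra h
    nlinarith
  set κ : ℝ := dev * η ^ 2 / (8 * r) with hκ
  have hκ0 : 0 < κ := by positivity
  set lam : ℝ := κ * n with hlam
  have hlam0 : 0 < lam := by positivity
  set q : ℝ := 4 * κ ^ 2 * r / η ^ 2 with hq
  have hq0 : 0 < q := by positivity
  have hqκ : q = κ * (dev / 2) := by
    rw [hq, hκ]; field_simp; ring
  have hηn : 0 < η * n := mul_pos hη hn0
  suffices h : ∀ k : ℕ, ∀ W ⊆ R, W.card = k → Tileable H r (R \ W) →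
      devPotential X ρ lam W ≤ Fintype.card ι * Real.exp (q * (n - W.card)) →
      ∃ L ⊆ R, (L.card : ℝ) < η * n ∧ Tileable H r (R \ L) by
    refine h _ R subset_rfl rfl (by simpa using tileable_empty) ?_
    rw [← hn, sub_self, mul_zero, Real.exp_zero, mul_one]
    unfold devPotential
    have h1 : ∀ i ∈ (univ : Finset ι),
        Real.exp (lam * (((X i ∩ R).card : ℝ) / R.card - ρ i)) ≤ 1 := by
      intro i _
      rw [Real.exp_le_one_iff]
      apply mul_nonpos_of_nonneg_of_nonpos hlam0.le
      rw [sub_nonpos, div_le_iff₀ hn0]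
      exact hX i
    simpa using sum_le_sum h1
  intro k
  induction k using Nat.strong_induction_on with
  | _ k ih =>
  intro W hWR hWk htile hpot
  by_cases hsmall : (W.card : ℝ) < η * n
  · exact ⟨W, hWR, hsmall, htile⟩
  push Not at hsmall
  have hdens : ∀ i, ((X i ∩ W).card : ℝ) ≤ (ρ i + dev) * W.card := by
    intro i
    have hw0 : (0 : ℝ) < W.card := by linarith
    rw [← div_le_iff₀ hw0]
    have h1 : Real.exp (lam * (((X i ∩ W).card : ℝ) / W.card - ρ i)) ≤
        devPotential X ρ lam W :=
      single_le_sum (f := fun i => Real.exp (lam * (((X i ∩ W).card : ℝ) / W.card - ρ i)))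
        (fun i _ => (Real.exp_pos _).le) (mem_univ i)
    have h2 : Real.exp (lam * (((X i ∩ W).card : ℝ) / W.card - ρ i)) ≤
        Real.exp (dev ^ 2 * η ^ 2 / (16 * r) * n + q * (n - W.card)) := by
      rw [Real.exp_add]
      exact (h1.trans hpot).trans (mul_le_mul_of_nonneg_right hι (Real.exp_pos _).le)
    have h3 := Real.exp_le_exp.1 h2
    have h4 : dev ^ 2 * η ^ 2 / (16 * r) = κ * (dev / 2) := by
      rw [hκ]; field_simp; ring
    have h5 : lam * (((X i ∩ W).card : ℝ) / W.card - ρ i) ≤ lam * dev := by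
      rw [h4] at h3
      have : q * (n - W.card) ≤ q * n := mul_le_mul_of_nonneg_left (by linarith) hq0.le
      rw [hlam]
      rw [hqκ] at this h3
      linarith
    have := le_of_mul_le_mul_left h5 hlam0
    linarith
  obtain ⟨K, hKW, hK, hp⟩ := hclique W hWR hsmall hdens _
  have hKr := hK.card_eq
  have hwr2 : (r : ℝ) + η * n / 2 ≤ W.card := by linarith
  have hrW : r < W.card := by
    have : (r : ℝ) < W.card := by linarith
    exact_mod_cast this
  have hratio : (r : ℝ) / (W.card - r) ≤ 2 * r / (η * n) := by
    rw [div_le_div_iff₀ (by linarith) (by positivity)]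
    have := mul_le_mul_of_nonneg_left hwr2 hr0.le
    linarith
  have ha : lam * ((r : ℝ) / (W.card - r)) ≤ 2 * κ * r / η := by
    calc _ ≤ lam * (2 * r / (η * n)) := mul_le_mul_of_nonneg_left hratio hlam0.le
      _ = _ := by rw [hlam]; field_simp
  have ha1 : 2 * κ * r / η ≤ 1 := by
    have : 2 * κ * r / η = dev * η / 4 := by rw [hκ]; field_simp; ring
    rw [this]; nlinarith
  have ha0 : 0 ≤ lam * ((r : ℝ) / (W.card - r)) := by
    apply mul_nonneg hlam0.le
    apply div_nonneg hr0.le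
    linarith
  have hstep := devPotential_step X ρ hlam0.le hKW hKr hrW (ha.trans ha1) hp
  refine ih (W \ K).card ?_ (W \ K) (sdiff_subset.trans hWR) rfl ?_ ?_
  · rw [card_sdiff_of_subset hKW, hKr]; omega
  · have h1 : R \ (W \ K) = (R \ W) ∪ K := by
      ext x
      have := @hKW x
      have := @hWR x
      simp only [mem_sdiff, mem_union]
      tauto
    rw [h1]
    exact htile.union (tileable_of_isNClique hK)
      (disjoint_of_subset_right hKW sdiff_disjoint)
  · have h1 : ((W \ K).card : ℝ) = W.card - r := by
      rw [card_sdiff_of_subset hKW, hKr, Nat.cast_sub hrW.le]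
    have h2 : (lam * ((r : ℝ) / (W.card - r))) ^ 2 ≤ q * r := by
      have h3 : q * r = (2 * κ * r / η) ^ 2 := by rw [hq]; field_simp; ring
      rw [h3]
      exact pow_le_pow_left₀ ha0 ha 2
    calc _ ≤ _ := hstep
      _ ≤ (Fintype.card ι * Real.exp (q * (n - W.card))) * Real.exp (q * r) := by
          apply mul_le_mul hpot (Real.exp_le_exp.2 h2) (Real.exp_pos _).le
          positivity
      _ = _ := by
          rw [mul_assoc, ← Real.exp_add, h1]
          congr 2; ring

end Potential

/-! ### Absorption -/

section Absorption

variable {U : Type*} [DecidableEq U]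

lemma tileable_biUnion {H : SimpleGraph U} {r : ℕ} {α : Type*} {A : α → Finset U}
    (s : Finset α) (hA : ∀ j ∈ s, Tileable H r (A j)) (hd : (s : Set α).PairwiseDisjoint A) :
    Tileable H r (s.biUnion A) := by
  classical
  induction s using Finset.induction_on with
  | empty => simpa using tileable_empty
  | insert j s hj ih =>
    rw [biUnion_insert]
    refine (hA j (mem_insert_self _ _)).union
      (ih (fun i hi => hA i (mem_insert_of_mem hi)) (hd.subset (by simp))) ?_
    rw [disjoint_biUnion_right]
    intro i hi
    exact hd (by simp) (by simp [hi]) (by rintro rfl; exact hj hi)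

lemma tileable_absorb {H : SimpleGraph U} {r : ℕ} {α : Type*} [DecidableEq α] {A : α → Finset U}
    (t : ℕ) : ∀ (L : Finset U) (s : Finset α), L.card = r * t →
    (∀ j ∈ s, Tileable H r (A j)) → (s : Set α).PairwiseDisjoint A →
    (∀ j ∈ s, Disjoint L (A j)) →
    (∀ S ⊆ L, S.card = r → ∃ g ⊆ s, t ≤ g.card ∧ ∀ j ∈ g, Tileable H r (A j ∪ S)) →
    Tileable H r (L ∪ s.biUnion A) := by
  induction t with
  | zero =>
    intro L s hL hA hd _ _
    rw [mul_zero, card_eq_zero] at hL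
    rw [hL, empty_union]
    exact tileable_biUnion s hA hd
  | succ t ih =>
    intro L s hL hA hd hLA hg
    obtain ⟨S, hSL, hS⟩ := exists_subset_card_eq (s := L) (n := r) (by rw [hL]; nlinarith)
    obtain ⟨g, hgs, hgc, hgT⟩ := hg S hSL hS
    obtain ⟨j, hj⟩ := card_pos.1 (show 0 < g.card by omega)
    have hjs := hgs hj
    have h1 := ih (L \ S) (s.erase j)
      (by rw [card_sdiff_of_subset hSL, hL, hS, mul_add, mul_one, Nat.add_sub_cancel])
      (fun i hi => hA i (mem_of_mem_erase hi)) (hd.subset (by simp))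
      (fun i hi => disjoint_of_subset_left sdiff_subset (hLA i (mem_of_mem_erase hi)))
      (by
        intro S' hS' hSc
        obtain ⟨g', hgs', hgc', hgT'⟩ := hg S' (hS'.trans sdiff_subset) hSc
        refine ⟨g'.erase j, erase_subset_erase _ hgs', ?_, fun i hi => hgT' i (mem_of_mem_erase hi)⟩
        have := pred_card_le_card_erase (s := g') (a := j)
        omega)
    have h2 := h1.union (hgT j hj) (by
      rw [disjoint_union_left]
      constructor
      · rw [disjoint_union_right]
        exact ⟨disjoint_of_subset_left sdiff_subset (hLA j hjs), sdiff_disjoint⟩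
      · rw [disjoint_biUnion_left]
        intro i hi
        rw [disjoint_union_right]
        exact ⟨hd (mem_of_mem_erase hi) hjs (ne_of_mem_erase hi),
          (disjoint_of_subset_left hSL (hLA i (mem_of_mem_erase hi))).symm⟩)
    have h3 : L \ S ∪ (s.erase j).biUnion A ∪ (A j ∪ S) = L ∪ s.biUnion A := by
      conv_rhs => rw [← insert_erase hjs, biUnion_insert]
      ext x
      have := @hSL x
      simp only [mem_union, mem_sdiff]
      tauto
    rwa [h3] at h2

lemma exists_heavy_clique_of_density (H : SimpleGraph U) [DecidableRel H.Adj] {W : Finset U}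
    {r : ℕ} (hr : 2 ≤ r) {γ δ : ℝ} (hγ : 0 < γ) (hδ1 : δ ≤ 1)
    (hγδ : 64 * r ^ 3 * γ ≤ δ) (hW : 16 * r ^ 3 ≤ δ * W.card)
    (hdeg : ∀ v ∈ W, ((W.filter (fun u => ¬ H.Adj v u)).card : ℝ) ≤ (1 / r + 4 * γ) * W.card)
    (hind : ∀ X ⊆ W, X.Nonempty → (∀ x ∈ X, ∀ y ∈ X, ¬ H.Adj x y) →
      (X.card : ℝ) ≤ (1 / r - δ + 3 * γ) * W.card) (p : U → ℝ) :
    ∃ K ⊆ W, H.IsNClique r K ∧ r * ∑ v ∈ W, p v ≤ W.card * ∑ v ∈ K, p v := by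
  set w : ℝ := (W.card : ℝ) with hw
  have hr2 : (2 : ℝ) ≤ r := by exact_mod_cast hr
  have hr0 : (0 : ℝ) < r := by linarith
  have hrr : (r : ℝ) ≤ r ^ 3 := by
    have : (1 : ℝ) ≤ (r : ℝ) ^ 2 := by nlinarith
    nlinarith
  have hrr2 : (r : ℝ) ^ 2 ≤ r ^ 3 := by nlinarith [sq_nonneg (r : ℝ)]
  have hw0 : 0 ≤ w := Nat.cast_nonneg _
  have hr3 : 0 < (r : ℝ) ^ 3 := by positivity
  have hδ0 : 0 < δ := lt_of_lt_of_le (by positivity) hγδ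
  have hδw : δ * w ≤ w := by nlinarith
  have hwpos : 0 < w := by nlinarith
  set D : ℕ := ⌈(1 / r + 4 * γ) * w⌉₊ with hD
  have hD1 : (1 / r + 4 * γ) * w ≤ D := Nat.le_ceil _
  have hD2 : (D : ℝ) < (1 / r + 4 * γ) * w + 1 := Nat.ceil_lt_add_one (by positivity)
  have hrD : (r : ℝ) * ((1 / r + 4 * γ) * w) = w + 4 * r * γ * w := by field_simp
  have hrγw : 0 ≤ r * γ * w := by positivity
  have hle : W.card ≤ r * D := by
    have : w ≤ r * D := by nlinarith
    rw [hw] at this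
    exact_mod_cast this
  obtain ⟨s, hs⟩ := Nat.exists_eq_add_of_le hle
  have hs' : (r : ℝ) * D = w + s := by rw [hw]; exact_mod_cast hs
  have hsle : (s : ℝ) ≤ 4 * r * γ * w + r := by nlinarith
  have hγw : 64 * r ^ 3 * γ * w ≤ δ * w := mul_le_mul_of_nonneg_right hγδ hw0
  have hγw1 : 64 * (r * γ * w) ≤ δ * w := by
    refine le_trans ?_ hγw
    have := mul_le_mul_of_nonneg_right hrr (mul_nonneg hγ.le hw0)
    nlinarith
  have hcardW : W.Nonempty := by
    rw [← card_pos]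
    rw [hw] at hwpos
    exact_mod_cast hwpos
  have heD : 3 * s ≤ D := by
    have h1 : (3 : ℝ) * s ≤ D := by
      have h2 : r * ((3 : ℝ) * s) ≤ r * D := by
        rw [hs']
        have h3 : r * (s : ℝ) ≤ r * (4 * r * γ * w + r) := mul_le_mul_of_nonneg_left hsle hr0.le
        have h4 : (r : ℝ) ^ 2 * (γ * w) ≤ r ^ 3 * (γ * w) :=
          mul_le_mul_of_nonneg_right hrr2 (mul_nonneg hγ.le hw0)
        have h5 : (0 : ℝ) ≤ s := Nat.cast_nonneg _
        nlinarith
      exact le_of_mul_le_mul_left h2 hr0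
    exact_mod_cast h1
  refine exists_heavy_clique H W hr hs le_rfl heD ?_ hcardW ?_ ?_ p
  · have h1 : 4 * (r : ℝ) ^ 2 * s ≤ w := by
      have h3 : (r : ℝ) ^ 2 * s ≤ r ^ 2 * (4 * r * γ * w + r) :=
        mul_le_mul_of_nonneg_left hsle (by positivity)
      nlinarith
    rw [hw] at h1
    exact_mod_cast h1
  · intro v hv
    have := (hdeg v hv).trans hD1
    exact_mod_cast this
  · intro X hX hXc
    by_contra hcon
    push Not at hcon
    have h1 : (D : ℝ) - 3 * s ≤ X.card := by
      rw [Nat.sub_le_iff_le_add] at hXc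
      have : (D : ℝ) ≤ X.card + 3 * s := by exact_mod_cast hXc
      linarith
    have h2 : (1 / r - δ + 3 * γ) * w < (D : ℝ) - 3 * s := by nlinarith
    have hne : X.Nonempty := by
      rw [nonempty_iff_ne_empty]
      rintro rfl
      have h4 : (0 : ℝ) < 1 / r * w := by positivity
      have h5 : r * ((D : ℝ) - 3 * s) > 0 := by
        have h3 : r * (s : ℝ) ≤ r * (4 * r * γ * w + r) := mul_le_mul_of_nonneg_left hsle hr0.le
        have h4 : (r : ℝ) ^ 2 * (γ * w) ≤ r ^ 3 * (γ * w) :=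
          mul_le_mul_of_nonneg_right hrr2 (mul_nonneg hγ.le hw0)
        have h5 : (0 : ℝ) ≤ s := Nat.cast_nonneg _
        nlinarith
      rw [card_empty, Nat.cast_zero] at h1
      nlinarith
    have h3 := hind X hX hne hcon
    linarith

set_option maxHeartbeats 1000000 in
/-- A deterministic criterion for perfect clique tilings: small disjoint absorbing groups, almost
minimum degree `(1 - 1/r) m`, and a small family of small sets containing all independent sets. -/
lemma tileable_univ_of_absorb [Fintype U] (H : SimpleGraph U) [DecidableRel H.Adj] {r : ℕ}
    (hr : 2 ≤ r) (hdvd : r ∣ Fintype.card U) {α ι : Type*} [Fintype α] [DecidableEq α] [Fintype ι]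
    (A : α → Finset U) (hd : Pairwise fun i j => Disjoint (A i) (A j)) {γ δ η : ℝ} {l : ℕ}
    (hγ : 0 < γ) (hδ1 : δ ≤ 1) (hγδ : 64 * r ^ 3 * γ ≤ δ) (hη : 0 < η) (hη1 : η ≤ 1)
    (hAcard : ∑ j, ((A j).card : ℝ) ≤ γ * Fintype.card U)
    (hl : η * Fintype.card U ≤ r * l)
    (habs : ∀ S : Finset U, S.card = r → (∀ j, Tileable H r (A j) → Disjoint (A j) S) →
      ∃ g : Finset α, l ≤ g.card ∧ ∀ j ∈ g, Tileable H r (A j) ∧ Tileable H r (A j ∪ S))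
    (hdeg : ∀ v, ((univ.filter (fun u => ¬ H.Adj v u)).card : ℝ) ≤
      (1 / r + γ) * Fintype.card U)
    (B : ι → Finset U) (hB : ∀ i, ((B i).card : ℝ) ≤ (1 / r - δ) * Fintype.card U)
    (hind : ∀ X : Finset U, X.Nonempty → (∀ x ∈ X, ∀ y ∈ X, ¬ H.Adj x y) → ∃ i, X ⊆ B i)
    (hι : (Fintype.card U + Fintype.card ι : ℝ) ≤
      Real.exp (γ ^ 2 * η ^ 2 / (32 * r) * Fintype.card U))
    (hbig : 32 * r ^ 3 ≤ δ * η * Fintype.card U) :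
    Tileable H r univ := by
  classical
  set m : ℝ := (Fintype.card U : ℝ) with hm
  have hr2 : (2 : ℝ) ≤ r := by exact_mod_cast hr
  have hr0 : (0 : ℝ) < r := by linarith
  have hrr : 8 * (r : ℝ) ≤ 2 * r ^ 3 := by
    have : (4 : ℝ) ≤ (r : ℝ) ^ 2 := by nlinarith
    nlinarith
  have hm0 : 0 ≤ m := Nat.cast_nonneg _
  have hδ0 : 0 < δ := lt_of_lt_of_le (by positivity) hγδ
  have hγ1 : 256 * γ ≤ 1 := by
    have : (8 : ℝ) ≤ r ^ 3 := by nlinarith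
    nlinarith
  have hrinv : 1 / (r : ℝ) ≤ 1 / 2 := one_div_le_one_div_of_le (by norm_num) hr2
  have hrinv0 : 0 < 1 / (r : ℝ) := by positivity
  set T : Finset α := univ.filter (fun j => Tileable H r (A j)) with hT
  have hTt : ∀ j ∈ T, Tileable H r (A j) := fun j hj => (mem_filter.1 hj).2
  have hTd : (T : Set α).PairwiseDisjoint A := fun i _ j _ hij => hd hij
  set R : Finset U := univ \ T.biUnion A with hR
  have hRm : (R.card : ℝ) ≤ m := by rw [hm]; exact_mod_cast card_le_univ _
  have hRge : (1 - γ) * m ≤ R.card := by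
    have h1 : ((T.biUnion A).card : ℝ) ≤ ∑ j, ((A j).card : ℝ) := by
      have := (card_biUnion_le (s := T) (t := A)).trans
        (sum_le_sum_of_subset (f := fun j => (A j).card) (subset_univ T))
      exact_mod_cast this
    have h2 : (R.card : ℝ) = m - (T.biUnion A).card := by
      rw [hR, card_sdiff_of_subset (subset_univ _), card_univ, Nat.cast_sub (card_le_univ _)]
    rw [h2]; linarith
  have hRhalf : m / 2 ≤ R.card := by nlinarith
  have hδη : δ * (η * m) ≤ η * m := by
    have : 0 ≤ η * m := by positivity
    nlinarith
  have hηR : η * m ≤ 2 * (η * R.card) := by nlinarith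
  have hmR : m ≤ (1 + 2 * γ) * R.card := by nlinarith
  let X : U ⊕ ι → Finset U := Sum.elim (fun v => univ.filter (fun u => ¬ H.Adj v u)) B
  let ρ : U ⊕ ι → ℝ := Sum.elim (fun _ => 1 / r + 3 * γ) (fun _ => 1 / r - δ + 2 * γ)
  have hRc0 : (0 : ℝ) ≤ R.card := Nat.cast_nonneg _
  obtain ⟨L, hLR, hLc, hLt⟩ := exists_tiling_small_leftover H R X ρ (r := r) (by omega) hη hη1 hγ
    (by linarith) (by
      have hX : ∀ i, ((X i ∩ R).card : ℝ) ≤ (X i).card := fun i => by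
        exact_mod_cast card_le_card inter_subset_left
      rintro (v | i)
      · refine ((hX _).trans (hdeg v)).trans ?_
        simp only [ρ, Sum.elim_inl]
        have h1 := mul_le_mul_of_nonneg_left hmR (show 0 ≤ 1 / (r : ℝ) + γ by positivity)
        have h2 : (1 / (r : ℝ) + γ) * (1 + 2 * γ) ≤ 1 / r + 3 * γ := by nlinarith
        have h3 := mul_le_mul_of_nonneg_right h2 hRc0
        linarith
      · refine ((hX _).trans (hB i)).trans ?_
        simp only [ρ, Sum.elim_inr]
        rcases le_total 0 (1 / (r : ℝ) - δ) with h0 | h0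
        · have h1 := mul_le_mul_of_nonneg_left hmR h0
          have h2 : (1 / (r : ℝ) - δ) * (1 + 2 * γ) ≤ 1 / r - δ + 2 * γ := by nlinarith
          have h3 := mul_le_mul_of_nonneg_right h2 hRc0
          linarith
        · have h1 := mul_le_mul_of_nonpos_left hRm h0
          have h3 : 0 ≤ 2 * γ * R.card := by positivity
          linarith)
    (by
      intro W hWR hWη hWd p
      refine exists_heavy_clique_of_density H hr hγ hδ1 hγδ ?_ ?_ ?_ p
      · have := mul_le_mul_of_nonneg_left hWη hδ0.le
        nlinarith
      · intro v _
        have := hWd (Sum.inl v)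
        simp only [X, ρ, Sum.elim_inl] at this
        have h2 : (univ.filter (fun u => ¬ H.Adj v u)) ∩ W = W.filter (fun u => ¬ H.Adj v u) := by
          ext x; simp only [mem_inter, mem_filter, mem_univ, true_and]; tauto
        rw [h2] at this
        linarith
      · intro Y hYW hYne hYind
        obtain ⟨i, hi⟩ := hind Y hYne hYind
        have := hWd (Sum.inr i)
        simp only [X, ρ, Sum.elim_inr] at this
        have h2 : (Y.card : ℝ) ≤ (B i ∩ W).card := by
          exact_mod_cast card_le_card (subset_inter hi hYW)
        linarith)
    (by
      rw [Fintype.card_sum]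
      push_cast
      refine hι.trans (Real.exp_le_exp.2 ?_)
      have h1 : γ ^ 2 * η ^ 2 / (16 * r) * R.card = γ ^ 2 * η ^ 2 / (32 * r) * (2 * R.card) := by
        field_simp; ring
      rw [h1]
      exact mul_le_mul_of_nonneg_left (by linarith) (by positivity))
    (by nlinarith)
  have hbi := tileable_biUnion T hTt hTd
  have hun : univ = R \ L ∪ (L ∪ T.biUnion A) := by
    ext x
    have := @hLR x
    simp only [hR, mem_sdiff, mem_univ, true_and, mem_union, true_iff] at this ⊢
    tauto
  have hdisj : Disjoint (T.biUnion A) R := disjoint_sdiff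
  have hdisj2 : Disjoint (R \ L) (L ∪ T.biUnion A) := by
    rw [disjoint_union_right]
    exact ⟨sdiff_disjoint, disjoint_of_subset_left sdiff_subset hdisj.symm⟩
  have hLdvd : r ∣ L.card := by
    have h1 : Fintype.card U = (R \ L).card + (L.card + (T.biUnion A).card) := by
      rw [← card_univ, hun, card_union_of_disjoint hdisj2,
        card_union_of_disjoint (disjoint_of_subset_left hLR hdisj.symm)]
    rw [h1] at hdvd
    have h2 := (Nat.dvd_add_right hLt.dvd_card).1 hdvd
    exact (Nat.dvd_add_left hbi.dvd_card).1 h2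
  obtain ⟨t, ht⟩ := hLdvd
  have htl : t ≤ l := by
    have h1 : (r : ℝ) * t ≤ r * l := by
      have h2 : (L.card : ℝ) = r * t := by exact_mod_cast ht
      nlinarith
    exact_mod_cast le_of_mul_le_mul_left h1 hr0
  have habsL := tileable_absorb t L T ht hTt hTd
    (fun j hj => disjoint_of_subset_left hLR
      (disjoint_of_subset_right (subset_biUnion_of_mem A hj) hdisj.symm))
    (by
      intro S hS hSc
      obtain ⟨g, hg, hgT⟩ := habs S hSc (fun j hj =>
        disjoint_of_subset_left (subset_biUnion_of_mem A (mem_filter.2 ⟨mem_univ _, hj⟩))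
          (disjoint_of_subset_right (hS.trans hLR) hdisj))
      exact ⟨g, fun j hj => mem_filter.2 ⟨mem_univ _, (hgT j hj).1⟩, htl.trans hg,
        fun j hj => (hgT j hj).2⟩)
  rw [hun]
  exact hLt.union habsL hdisj2

end Absorption

/-! ### Edge counts in non-sparse graphs -/

section EdgeCounts

variable {V : Type*} [Fintype V] [DecidableEq V] (G : SimpleGraph V) [DecidableRel G.Adj]

lemma edgesBetween_mono {A A' B B' : Finset V} (hA : A ⊆ A') (hB : B ⊆ B') :
    edgesBetween G A B ≤ edgesBetween G A' B' :=
  card_le_card (filter_subset_filter _ (product_subset_product hA hB))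

lemma edgesBetween_comm (A B : Finset V) : edgesBetween G A B = edgesBetween G B A := by
  unfold edgesBetween
  apply card_bij (fun x _ => (x.2, x.1))
  · intro x hx
    simp only [mem_filter, mem_product] at hx ⊢
    exact ⟨⟨hx.1.2, hx.1.1⟩, hx.2.symm⟩
  · rintro ⟨a, b⟩ _ ⟨c, d⟩ _ h
    simp only [Prod.mk.injEq] at h ⊢
    exact ⟨h.2, h.1⟩
  · rintro ⟨a, b⟩ hx
    simp only [mem_filter, mem_product] at hx
    exact ⟨(b, a), by simp only [mem_filter, mem_product]; exact ⟨⟨hx.1.2, hx.1.1⟩, hx.2.symm⟩, rfl⟩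

lemma edgesBetween_eq_sum (A B : Finset V) :
    edgesBetween G A B = ∑ u ∈ A, (B.filter (fun v => G.Adj u v)).card := by
  unfold edgesBetween
  rw [card_filter, sum_product]
  refine sum_congr rfl fun u _ => ?_
  rw [card_filter]

lemma edgesBetween_le_of_almost_subset (A A' B B' : Finset V) :
    edgesBetween G A' B' ≤ edgesBetween G A B +
      (A' \ A).card * Fintype.card V + (B' \ B).card * Fintype.card V := by
  unfold edgesBetween
  have h : (A' ×ˢ B').filter (fun p : V × V => G.Adj p.1 p.2) ⊆
      ((A ×ˢ B).filter (fun p : V × V => G.Adj p.1 p.2) ∪ (A' \ A) ×ˢ univ) ∪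
        univ ×ˢ (B' \ B) := by
    rintro ⟨x, y⟩ h
    simp only [mem_filter, mem_product, mem_union, mem_sdiff, mem_univ, true_and, and_true] at h ⊢
    tauto
  refine (card_le_card h).trans ((card_union_le _ _).trans ?_)
  refine (Nat.add_le_add_right (card_union_le _ _) _).trans ?_
  rw [card_product, card_product, card_univ, mul_comm (Fintype.card V)]

/-- In a graph that is not `(r, α)`-sparse, sets of almost `n / r` vertices span a positive
proportion of all pairs. -/
lemma edgesBetween_self_ge_of_not_isSparse {r : ℕ} (hr : 2 ≤ r) (hdvd : r ∣ Fintype.card V)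
    {α : ℝ} (hα : 0 < α) (hn : 2 * r ≤ Fintype.card V) (h : ¬ IsSparse G r α) (X : Finset V)
    (hX : (1 / r - α / (8 * r)) * Fintype.card V ≤ X.card) :
    α / (4 * r ^ 2) * (Fintype.card V : ℝ) ^ 2 ≤ edgesBetween G X X := by
  obtain ⟨a, ha⟩ := hdvd
  have hr0 : 0 < r := by omega
  have hdiv : Fintype.card V / r = a := by rw [ha]; exact Nat.mul_div_cancel_left _ hr0
  have han : (Fintype.card V : ℝ) = r * a := by exact_mod_cast ha
  have ha2 : 2 ≤ a := by
    by_contra hcon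
    have : r * a ≤ r * 1 := Nat.mul_le_mul_left _ (by omega)
    omega
  have ha2' : (2 : ℝ) ≤ a := by exact_mod_cast ha2
  have hr0' : (0 : ℝ) < r := by exact_mod_cast hr0
  have key : ∀ A : Finset V, A.card = a → α * a ^ 2 / 2 < edgesBetween G A A := by
    intro A hA
    by_contra hcon
    push Not at hcon
    apply h
    refine ⟨A, by rw [hA, hdiv], ?_⟩
    change (edgesBetween G A A : ℝ) / 2 ≤ _
    rw [hA, Nat.cast_choose_two]
    nlinarith
  have hgoal : α / (4 * r ^ 2) * (Fintype.card V : ℝ) ^ 2 = α * a ^ 2 / 4 := by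
    rw [han]; field_simp
  rw [hgoal]
  rcases le_total a X.card with hc | hc
  · obtain ⟨A, hAX, hA⟩ := exists_subset_card_eq hc
    have h1 := key A hA
    have h2 : (edgesBetween G A A : ℝ) ≤ edgesBetween G X X := by
      exact_mod_cast edgesBetween_mono G hAX hAX
    nlinarith [sq_nonneg (a : ℝ)]
  · obtain ⟨A, hXA, -, hA⟩ := exists_subsuperset_card_eq (subset_univ X) hc
      (by rw [card_univ, ha]; nlinarith)
    have h1 := key A hA
    have h2 : edgesBetween G A A ≤ edgesBetween G X X + (A \ X).card * a + (A \ X).card * a := by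
      have h3 : (A ×ˢ A).filter (fun p : V × V => G.Adj p.1 p.2) ⊆
          ((X ×ˢ X).filter (fun p : V × V => G.Adj p.1 p.2) ∪ (A \ X) ×ˢ A) ∪ A ×ˢ (A \ X) := by
        rintro ⟨x, y⟩ h
        simp only [mem_filter, mem_product, mem_union, mem_sdiff] at h ⊢
        tauto
      refine (card_le_card h3).trans ((card_union_le _ _).trans ?_)
      refine (Nat.add_le_add_right (card_union_le _ _) _).trans ?_
      rw [card_product, card_product, hA, mul_comm a]
      rfl
    have h4 : ((A \ X).card : ℝ) ≤ α / 8 * a := by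
      rw [card_sdiff_of_subset hXA, hA, Nat.cast_sub hc]
      have : (1 / r - α / (8 * r)) * (r * a : ℝ) = a - α / 8 * a := by field_simp
      rw [han, this] at hX
      linarith
    have h5 : (edgesBetween G A A : ℝ) ≤
        edgesBetween G X X + (A \ X).card * a + (A \ X).card * a := by exact_mod_cast h2
    nlinarith

variable {G}

set_option maxHeartbeats 1000000 in
/-- If `G` has almost minimum degree `n / 2`, is not close to disconnected and has no sparse set of
almost `n / 2` vertices, then there are many edges between any two neighbourhoods. -/
lemma edgesBetween_neighborFinset_ge {α θ : ℝ} (hα : 0 < α) (hα1 : α < 1)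
    (heven : 2 ∣ Fintype.card V) (hV : 0 < Fintype.card V)
    (hθ : 0 ≤ θ) (hθα : 100 * θ ≤ α)
    (hdeg : ∀ v, (1 / 2 - θ) * Fintype.card V ≤ G.degree v)
    (hN : ∀ X : Finset V, (1 / 2 - α / 16) * Fintype.card V ≤ X.card →
      α / 16 * (Fintype.card V : ℝ) ^ 2 ≤ edgesBetween G X X)
    (hdisc : ¬ IsDisconnectedGraph G α) (a b : V) :
    α ^ 2 / 1024 * (Fintype.card V : ℝ) ^ 2 ≤
      edgesBetween G (G.neighborFinset a) (G.neighborFinset b) := by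
  by_contra hcon
  push Not at hcon
  set A := G.neighborFinset a with hA
  set B := G.neighborFinset b with hB
  set n : ℝ := (Fintype.card V : ℝ) with hn
  have hn0 : 0 < n := by rw [hn]; exact_mod_cast hV
  have hAc : (1 / 2 - θ) * n ≤ A.card := by
    have := hdeg a; rwa [← SimpleGraph.card_neighborFinset_eq_degree] at this
  have hBc : (1 / 2 - θ) * n ≤ B.card := by
    have := hdeg b; rwa [← SimpleGraph.card_neighborFinset_eq_degree] at this
  set I := A ∩ B with hI
  have hII : (edgesBetween G I I : ℝ) ≤ edgesBetween G A B := by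
    exact_mod_cast edgesBetween_mono G inter_subset_left inter_subset_right
  have hα2 : α ^ 2 ≤ α := by nlinarith
  have hn2 : 0 < n ^ 2 := by positivity
  have hI1 : (I.card : ℝ) < (1 / 2 - α / 16) * n := by
    by_contra h
    push Not at h
    have := hN I h
    nlinarith
  have hunion : ((A ∪ B).card : ℝ) + I.card = A.card + B.card := by
    exact_mod_cast card_union_add_card_inter A B
  have hcompl : (((A ∪ B)ᶜ : Finset V).card : ℝ) = n - (A ∪ B).card := by
    rw [card_compl, Nat.cast_sub (card_le_univ _)]
  have hI2 : (I.card : ℝ) * (n / 2 - 3 * θ * n - I.card) ≤ 2 * (α ^ 2 / 1024 * n ^ 2) := by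
    have h1 : (edgesBetween G I (A ∪ B) : ℝ) ≤ 2 * edgesBetween G A B := by
      have h2 : edgesBetween G I (A ∪ B) ≤ edgesBetween G I A + edgesBetween G I B := by
        unfold edgesBetween
        rw [product_union, filter_union]
        exact card_union_le _ _
      have h3 : edgesBetween G I B ≤ edgesBetween G A B :=
        edgesBetween_mono G inter_subset_left subset_rfl
      have h4 : edgesBetween G I A ≤ edgesBetween G A B := by
        rw [edgesBetween_comm G I A]
        exact edgesBetween_mono G subset_rfl inter_subset_right
      have : edgesBetween G I (A ∪ B) ≤ 2 * edgesBetween G A B := by omega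
      exact_mod_cast this
    have h2 : (I.card : ℝ) * (n / 2 - 3 * θ * n - I.card) ≤ edgesBetween G I (A ∪ B) := by
      rw [edgesBetween_eq_sum]
      push_cast
      have h3 : ∀ u ∈ I, n / 2 - 3 * θ * n - I.card ≤
          (((A ∪ B).filter (fun v => G.Adj u v)).card : ℝ) := by
        intro u _
        have h4 : G.neighborFinset u ⊆ (A ∪ B).filter (fun v => G.Adj u v) ∪ (A ∪ B)ᶜ := by
          intro v hv
          rw [SimpleGraph.mem_neighborFinset] at hv
          simp only [mem_union, mem_filter, mem_compl]
          tauto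
        have h5 := (card_le_card h4).trans (card_union_le _ _)
        rw [SimpleGraph.card_neighborFinset_eq_degree] at h5
        have h6 : (G.degree u : ℝ) ≤ ((A ∪ B).filter (fun v => G.Adj u v)).card +
            (((A ∪ B)ᶜ : Finset V).card : ℝ) := by exact_mod_cast h5
        have h7 := hdeg u
        rw [hcompl] at h6
        nlinarith
      have := card_nsmul_le_sum I _ _ h3
      rwa [nsmul_eq_mul] at this
    linarith
  have hI3 : (I.card : ℝ) ≤ α / 16 * n := by
    have h1 : α / 32 * n ≤ n / 2 - 3 * θ * n - I.card := by nlinarith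
    have h2 : (I.card : ℝ) * (α / 32 * n) ≤ I.card * (n / 2 - 3 * θ * n - I.card) :=
      mul_le_mul_of_nonneg_left h1 (Nat.cast_nonneg _)
    have h3 : (I.card : ℝ) * (α / 32 * n) ≤ α / 16 * n * (α / 32 * n) := by nlinarith
    exact le_of_mul_le_mul_right h3 (by positivity)
  obtain ⟨h, hh⟩ := heven
  have hnh : n = 2 * h := by rw [hn]; exact_mod_cast hh
  have hout : (((A ∪ B)ᶜ : Finset V).card : ℝ) ≤ (2 * θ + α / 16) * n := by
    rw [hcompl]; nlinarith
  have hAup : (A.card : ℝ) ≤ (1 / 2 + θ + α / 16) * n := by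
    have : ((A ∪ B).card : ℝ) ≤ n := by rw [hn]; exact_mod_cast card_le_univ _
    nlinarith
  have hA' : ∃ A' : Finset V, A'.card = h ∧ ((A' \ A).card : ℝ) ≤ θ * n ∧
      ((A \ A').card : ℝ) ≤ (θ + α / 16) * n := by
    rcases le_total h A.card with hc | hc
    · obtain ⟨A', hsub, hcard⟩ := exists_subset_card_eq hc
      refine ⟨A', hcard, ?_, ?_⟩
      · rw [sdiff_eq_empty_iff_subset.2 hsub]; simp; positivity
      · rw [card_sdiff_of_subset hsub, Nat.cast_sub (card_le_card hsub), hcard]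
        linarith
    · obtain ⟨A', hsub, -, hcard⟩ := exists_subsuperset_card_eq (subset_univ A) hc
        (by rw [card_univ, hh]; omega)
      refine ⟨A', hcard, ?_, ?_⟩
      · rw [card_sdiff_of_subset hsub, Nat.cast_sub (card_le_card hsub), hcard]
        linarith
      · rw [sdiff_eq_empty_iff_subset.2 hsub]; simp; positivity
  obtain ⟨A', hA'c, hA'1, hA'2⟩ := hA'
  apply hdisc
  refine ⟨A', by rw [hA'c, hh]; omega, ?_⟩
  have hA'n : (A'.card : ℝ) = n / 2 := by rw [hA'c, hnh]; ring
  have hA'cn : ((A'ᶜ : Finset V).card : ℝ) = n / 2 := by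
    rw [card_compl, Nat.cast_sub (card_le_univ _), hA'n]; ring
  have hB' : ((A'ᶜ \ B).card : ℝ) ≤ (3 * θ + α / 8) * n := by
    have h1 : A'ᶜ \ B ⊆ (A ∪ B)ᶜ ∪ (A \ A') := by
      intro x
      simp only [mem_sdiff, mem_compl, mem_union]
      tauto
    have h2 : ((A'ᶜ \ B).card : ℝ) ≤ (((A ∪ B)ᶜ : Finset V).card : ℝ) + (A \ A').card := by
      exact_mod_cast (card_le_card h1).trans (card_union_le _ _)
    linarith
  have hfin : (edgesBetween G A' A'ᶜ : ℝ) ≤ edgesBetween G A B + (A' \ A).card * n +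
      (A'ᶜ \ B).card * n := by
    rw [hn]
    exact_mod_cast edgesBetween_le_of_almost_subset G A A' B A'ᶜ
  rw [hA'n, hA'cn]
  nlinarith

end EdgeCounts

/-! ### Containers for independent sets -/

section Containers

variable {V : Type*} [Fintype V] [DecidableEq V] (G : SimpleGraph V) [DecidableRel G.Adj]

/-- The vertices adjacent to none of the vertices `s i`. -/
def commonNonNbrs {k : ℕ} (s : Fin k → V) : Finset V :=
  univ.filter (fun u => ∀ i, ¬ G.Adj (s i) u)

/-- The container with fingerprint `s`: the vertices of small degree into `commonNonNbrs G s`. -/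
noncomputable def indepContainer (c : ℝ) {k : ℕ} (s : Fin k → V) : Finset V :=
  (commonNonNbrs G s).filter (fun u =>
    (((commonNonNbrs G s).filter (fun w => G.Adj u w)).card : ℝ) < c * Fintype.card V)

variable {G}

lemma card_indepContainer_lt {c b : ℝ} (hV : 0 < Fintype.card V) (hc : 0 < c)
    (hN : ∀ X : Finset V, b ≤ X.card → c * (Fintype.card V : ℝ) ^ 2 ≤ edgesBetween G X X)
    {k : ℕ} (s : Fin k → V) : ((indepContainer G c s).card : ℝ) < b := by
  by_contra hcon
  push Not at hcon
  have h1 := hN _ hcon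
  have hn : (0 : ℝ) < Fintype.card V := by exact_mod_cast hV
  set C := indepContainer G c s with hC
  have h2 : C.Nonempty := by
    rw [nonempty_iff_ne_empty]
    intro h0
    rw [h0] at h1
    have : edgesBetween G (∅ : Finset V) ∅ = 0 := by simp [edgesBetween]
    rw [this, Nat.cast_zero] at h1
    have : 0 < c * (Fintype.card V : ℝ) ^ 2 := by positivity
    linarith
  have h3 : (edgesBetween G C C : ℝ) < ∑ _u ∈ C, c * Fintype.card V := by
    rw [edgesBetween_eq_sum]
    push_cast
    apply sum_lt_sum_of_nonempty h2
    intro u hu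
    have h4 := (mem_filter.1 hu).2
    refine lt_of_le_of_lt ?_ h4
    exact_mod_cast card_le_card (filter_subset_filter _ (filter_subset _ _))
  rw [sum_const, nsmul_eq_mul] at h3
  have h5 : (C.card : ℝ) ≤ Fintype.card V := by exact_mod_cast card_le_univ C
  have h6 : (C.card : ℝ) * (c * Fintype.card V) ≤ Fintype.card V * (c * Fintype.card V) :=
    mul_le_mul_of_nonneg_right h5 (by positivity)
  nlinarith

lemma exists_fingerprint {c : ℝ} {I : Finset V} (hI : I.Nonempty)
    (hind : ∀ x ∈ I, ∀ y ∈ I, ¬ G.Adj x y) (k : ℕ) :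
    ∃ s : Fin k → V, (∀ i, s i ∈ I) ∧ (I ⊆ indepContainer G c s ∨
      ((commonNonNbrs G s).card : ℝ) ≤ Fintype.card V * (1 - k * c)) := by
  induction k with
  | zero =>
    refine ⟨Fin.elim0, fun i => i.elim0, Or.inr ?_⟩
    simp only [Nat.cast_zero, zero_mul, sub_zero, mul_one]
    exact_mod_cast card_le_univ _
  | succ k ih =>
    obtain ⟨s, hs, h⟩ := ih
    have hsub : ∀ u, commonNonNbrs G (Fin.cons u s : Fin (k + 1) → V) =
        (commonNonNbrs G s).filter (fun w => ¬ G.Adj u w) := by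
      intro u
      ext w
      simp only [commonNonNbrs, mem_filter, mem_univ, true_and, Fin.forall_fin_succ,
        Fin.cons_zero, Fin.cons_succ]
      tauto
    have hmem : ∀ u ∈ I, ∀ i, (Fin.cons u s : Fin (k + 1) → V) i ∈ I := by
      intro u hu i
      refine Fin.cases ?_ ?_ i
      · simpa using hu
      · intro j; simpa using hs j
    by_cases hIC : I ⊆ indepContainer G c s
    · obtain ⟨u, hu⟩ := hI
      refine ⟨Fin.cons u s, hmem u hu, Or.inl ?_⟩
      intro w hw
      have h1 := hIC hw
      rw [indepContainer, mem_filter] at h1 ⊢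
      rw [hsub]
      refine ⟨mem_filter.2 ⟨h1.1, hind u hu w hw⟩, lt_of_le_of_lt ?_ h1.2⟩
      exact_mod_cast card_le_card (filter_subset_filter _ (filter_subset _ _))
    · rcases h with h | h
      · exact absurd h hIC
      obtain ⟨u, hu, huC⟩ := not_subset.1 hIC
      refine ⟨Fin.cons u s, hmem u hu, Or.inr ?_⟩
      have huA : u ∈ commonNonNbrs G s := by
        rw [commonNonNbrs, mem_filter]
        exact ⟨mem_univ _, fun i => hind _ (hs i) u hu⟩
      have h1 : c * Fintype.card V ≤
          (((commonNonNbrs G s).filter (fun w => G.Adj u w)).card : ℝ) := by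
        by_contra hcon
        push Not at hcon
        exact huC (mem_filter.2 ⟨huA, hcon⟩)
      have h2 := card_filter_add_card_filter_not (s := commonNonNbrs G s) (fun w => G.Adj u w)
      have h3 : (((commonNonNbrs G s).filter (fun w => G.Adj u w)).card : ℝ) +
          ((commonNonNbrs G s).filter (fun w => ¬ G.Adj u w)).card =
          (commonNonNbrs G s).card := by exact_mod_cast h2
      rw [hsub]
      push_cast
      linarith

lemma exists_subset_indepContainer {c : ℝ} (hV : 0 < Fintype.card V) {I : Finset V}
    (hI : I.Nonempty) (hind : ∀ x ∈ I, ∀ y ∈ I, ¬ G.Adj x y) {k : ℕ} (hk : 1 < k * c) :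
    ∃ s : Fin k → V, (∀ i, s i ∈ I) ∧ I ⊆ indepContainer G c s := by
  obtain ⟨s, hs, h | h⟩ := exists_fingerprint (c := c) hI hind k
  · exact ⟨s, hs, h⟩
  · exfalso
    have hn : (0 : ℝ) < Fintype.card V := by exact_mod_cast hV
    have : (0 : ℝ) ≤ (commonNonNbrs G s).card := Nat.cast_nonneg _
    nlinarith

end Containers

/-! ### Counting absorbers -/

/-- `g` can be tiled by `r`-cliques both on its own and together with the vertices `x`. -/
def CliqueAbsorbs {V κ : Type*} [DecidableEq κ] [Fintype κ] (G : SimpleGraph V) (r : ℕ)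
    (x : Fin r → V) (g : κ → V) : Prop :=
  Tileable (G.comap (Sum.elim g x)) r (univ.image Sum.inl) ∧
    Tileable (G.comap (Sum.elim g x)) r univ

lemma tileable_image_of_rows {U : Type*} [DecidableEq U] {H : SimpleGraph U} {β : Type*}
    [Fintype β] {r : ℕ} (φ : β × Fin r → U) (hφ : Function.Injective φ)
    (h : ∀ b i j, i ≠ j → H.Adj (φ (b, i)) (φ (b, j))) : Tileable H r (univ.image φ) := by
  classical
  refine ⟨univ.image (fun b => univ.image (fun i => φ (b, i))), ?_, ?_, ?_⟩
  · intro K hK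
    obtain ⟨b, -, rfl⟩ := mem_image.1 hK
    rw [SimpleGraph.isNClique_iff]
    constructor
    · intro x hx y hy hxy
      simp only [coe_image, coe_univ, Set.image_univ, Set.mem_range] at hx hy
      obtain ⟨i, rfl⟩ := hx
      obtain ⟨j, rfl⟩ := hy
      exact h b i j (fun hij => hxy (by rw [hij]))
    · rw [card_image_of_injective, card_univ, Fintype.card_fin]
      intro i j hij
      exact (Prod.mk.inj (hφ hij)).2
  · intro x hx y hy hxy
    simp only [coe_image, coe_univ, Set.image_univ, Set.mem_range] at hx hy
    obtain ⟨b, rfl⟩ := hx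
    obtain ⟨b', rfl⟩ := hy
    simp only [Function.onFun, id]
    rw [disjoint_left]
    intro z hz hz'
    obtain ⟨i, -, rfl⟩ := mem_image.1 hz
    obtain ⟨j, -, hj⟩ := mem_image.1 hz'
    exact hxy (by rw [(Prod.mk.inj (hφ hj)).1])
  · ext z
    simp only [mem_biUnion, mem_image, mem_univ, true_and, id, Prod.exists]
    constructor
    · rintro ⟨_, ⟨b, rfl⟩, hz⟩
      obtain ⟨i, -, rfl⟩ := mem_image.1 hz
      exact ⟨b, i, rfl⟩
    · rintro ⟨b, i, rfl⟩
      exact ⟨_, ⟨b, rfl⟩, mem_image.2 ⟨i, mem_univ _, rfl⟩⟩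

lemma absorbs_of_grid {V : Type*} {G : SimpleGraph V} {q : ℕ} {x : Fin (q + 1) → V}
    {g : Fin (q + 1) × Fin (q + 1) → V}
    (hrow : ∀ i s t, s ≠ t → G.Adj (g (i, s)) (g (i, t)))
    (hcol : ∀ i j, i ≠ j → G.Adj (g (i, 0)) (g (j, 0)))
    (hx : ∀ i t, t ≠ 0 → G.Adj (x i) (g (i, t))) : CliqueAbsorbs G (q + 1) x g := by
  classical
  refine ⟨tileable_image_of_rows _ Sum.inl_injective fun b i j hij => hrow b i j hij, ?_⟩
  let φ : Option (Fin (q + 1)) × Fin (q + 1) → (Fin (q + 1) × Fin (q + 1)) ⊕ Fin (q + 1) :=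
    fun p => match p.1 with
      | none => Sum.inl (p.2, 0)
      | some i => if p.2 = 0 then Sum.inr i else Sum.inl (i, p.2)
  have hsurj : Function.Surjective φ := by
    rintro (⟨i, t⟩ | i)
    · by_cases ht : t = 0
      · exact ⟨(none, i), by simp [φ, ht]⟩
      · exact ⟨(some i, t), by simp [φ, ht]⟩
    · exact ⟨(some i, 0), by simp [φ]⟩
  have hbij : Function.Bijective φ := by
    rw [Fintype.bijective_iff_surjective_and_card]
    refine ⟨hsurj, ?_⟩
    simp only [Fintype.card_prod, Fintype.card_option, Fintype.card_fin, Fintype.card_sum]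
    ring
  have h := tileable_image_of_rows (H := G.comap (Sum.elim g x)) φ hbij.1 (by
    rintro (_ | b) i j hij
    · simpa [φ] using hcol i j hij
    · by_cases hi : i = 0
      · have hj : j ≠ 0 := fun h => hij (by rw [hi, h])
        simpa [φ, hi, hj] using hx b j hj
      · by_cases hj : j = 0
        · simpa [φ, hi, hj] using (hx b i hi).symm
        · simpa [φ, hi, hj] using hrow b i j hij)
  rwa [image_univ_of_surjective hsurj] at h

section AbsorberCount

variable {V : Type*} [Fintype V] [DecidableEq V] (G : SimpleGraph V) [DecidableRel G.Adj]

/-- Ordered `s`-cliques with all vertices in `U`. -/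
def cliqueTuples (U : Finset V) (s : ℕ) : Finset (Fin s → V) :=
  univ.filter (fun z => (∀ i, z i ∈ U) ∧ ∀ i j, i ≠ j → G.Adj (z i) (z j))

variable {G}

lemma mem_cliqueTuples {U : Finset V} {s : ℕ} {z : Fin s → V} :
    z ∈ cliqueTuples G U s ↔ (∀ i, z i ∈ U) ∧ ∀ i j, i ≠ j → G.Adj (z i) (z j) := by
  simp [cliqueTuples]

lemma card_sdiff_neighborFinset (U : Finset V) (v : V) {b : ℝ}
    (hdeg : (Fintype.card V : ℝ) - b ≤ G.degree v) :
    (U.card : ℝ) - b ≤ (U ∩ G.neighborFinset v).card := by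
  have h1 := card_inter_add_card_sdiff U (G.neighborFinset v)
  have h2 : (U \ G.neighborFinset v).card ≤ Fintype.card V - G.degree v := by
    rw [← SimpleGraph.card_neighborFinset_eq_degree, ← card_compl]
    exact card_le_card fun x hx => mem_compl.2 (mem_sdiff.1 hx).2
  have h3 : ((U \ G.neighborFinset v).card : ℝ) ≤ Fintype.card V - G.degree v := by
    rw [← Nat.cast_sub (G.degree_lt_card_verts v).le]; exact_mod_cast h2
  have h4 : ((U ∩ G.neighborFinset v).card : ℝ) + (U \ G.neighborFinset v).card = U.card := by
    exact_mod_cast h1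
  linarith

lemma card_cliqueTuples_ge {r : ℕ} (hr : 0 < r) {θ δ c : ℝ} (hθ : 0 ≤ θ)
    (hδ : δ ≤ 1 / (2 * r)) (hc : 0 ≤ c)
    (hdeg : ∀ v, (Fintype.card V : ℝ) - (1 / r + θ) * Fintype.card V ≤ G.degree v)
    (hN : ∀ X : Finset V, (1 / r - δ) * Fintype.card V ≤ X.card →
      c * (Fintype.card V : ℝ) ^ 2 ≤ edgesBetween G X X) (k : ℕ) :
    ∀ U : Finset V, ((k + 1 : ℝ) / r - δ + k * θ) * Fintype.card V ≤ U.card →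
      (1 / (2 * r)) ^ k * c * (Fintype.card V : ℝ) ^ (k + 2) ≤ (cliqueTuples G U (k + 2)).card := by
  have hr0 : (0 : ℝ) < r := by exact_mod_cast hr
  have hn0 : (0 : ℝ) ≤ Fintype.card V := Nat.cast_nonneg _
  induction k with
  | zero =>
    intro U hU
    have h1 := hN U (by simpa using hU)
    rw [pow_zero, one_mul]
    refine h1.trans ?_
    have : edgesBetween G U U ≤ (cliqueTuples G U 2).card := by
      unfold edgesBetween
      apply card_le_card_of_injOn (fun p : V × V => (![p.1, p.2] : Fin 2 → V))
      · rintro ⟨a, b⟩ h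
        simp only [coe_filter, mem_product, Set.mem_ofPred_eq] at h
        rw [mem_coe, mem_cliqueTuples]
        constructor
        · intro i; fin_cases i
          · exact h.1.1
          · exact h.1.2
        · intro i j hij
          fin_cases i <;> fin_cases j
          · exact absurd rfl hij
          · exact h.2
          · exact h.2.symm
          · exact absurd rfl hij
      · rintro ⟨a, b⟩ _ ⟨c, d⟩ _ h
        have h0 := congrFun h 0
        have h1 := congrFun h 1
        simp only [Matrix.cons_val_zero, Matrix.cons_val_one] at h0 h1
        rw [h0, h1]
    exact_mod_cast this
  | succ k ih =>
    intro U hU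
    have hsig : ((U.sigma fun u => cliqueTuples G (U ∩ G.neighborFinset u) (k + 2)).card) ≤
        (cliqueTuples G U (k + 1 + 2)).card := by
      apply card_le_card_of_injOn
        (fun p : (_ : V) × (Fin (k + 2) → V) => (Fin.cons p.1 p.2 : Fin (k + 2 + 1) → V))
      · rintro ⟨u, z⟩ h
        simp only [coe_sigma, Set.mem_sigma_iff, mem_coe, mem_cliqueTuples, mem_inter,
          SimpleGraph.mem_neighborFinset] at h
        obtain ⟨hu, hz, hadj⟩ := h
        rw [mem_coe, mem_cliqueTuples]
        constructor
        · intro i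
          refine Fin.cases ?_ ?_ i
          · simpa using hu
          · intro j; simpa using (hz j).1
        · intro i j
          refine Fin.cases ?_ ?_ i
          · refine Fin.cases ?_ ?_ j
            · intro h; exact absurd rfl h
            · intro j' _; simpa using (hz j').2
          · intro i'
            refine Fin.cases ?_ ?_ j
            · intro _; simpa using (hz i').2.symm
            · intro j' h
              simpa using hadj i' j' (fun h' => h (by rw [h']))
      · rintro ⟨u, z⟩ _ ⟨u', z'⟩ _ h
        have := Fin.cons_inj.1 h
        simp only at this
        rw [this.1, this.2]
    rw [card_sigma] at hsig
    have hterm : ∀ u ∈ U, (1 / (2 * r)) ^ k * c * (Fintype.card V : ℝ) ^ (k + 2) ≤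
        ((cliqueTuples G (U ∩ G.neighborFinset u) (k + 2)).card : ℝ) := by
      intro u _
      apply ih
      have h1 := card_sdiff_neighborFinset U u (hdeg u)
      push_cast at hU
      have h2 : ((k : ℝ) + 1 + 1) / r = (k + 1) / r + 1 / r := by ring
      rw [h2] at hU
      nlinarith
    have h3 := card_nsmul_le_sum U _ _ hterm
    rw [nsmul_eq_mul] at h3
    have h4 : (1 / (2 * r)) * (Fintype.card V : ℝ) ≤ U.card := by
      refine le_trans (mul_le_mul_of_nonneg_right ?_ hn0) hU
      push_cast
      have h5 : 1 / (r : ℝ) ≤ (k + 1 + 1) / r := by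
        apply div_le_div_of_nonneg_right _ hr0.le
        have : (0 : ℝ) ≤ k := Nat.cast_nonneg k
        linarith
      have h6 : 1 / (r : ℝ) = 1 / (2 * r) + 1 / (2 * r) := by field_simp; norm_num
      have h7 : 0 ≤ ((k : ℝ) + 1) * θ := by positivity
      linarith
    have h5 : (∑ u ∈ U, ((cliqueTuples G (U ∩ G.neighborFinset u) (k + 2)).card : ℝ)) ≤
        (cliqueTuples G U (k + 1 + 2)).card := by exact_mod_cast hsig
    refine le_trans ?_ (h3.trans h5)
    calc _ = (1 / (2 * r)) * (Fintype.card V : ℝ) *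
          ((1 / (2 * r)) ^ k * c * (Fintype.card V : ℝ) ^ (k + 2)) := by ring
      _ ≤ _ := mul_le_mul_of_nonneg_right h4 (by positivity)

/-- Lower bound for the proportion of absorbers. -/
noncomputable def absorbConst (r : ℕ) (α : ℝ) : ℝ :=
  min ((1 / (2 * r)) ^ (r - 2) * (α / (4 * r ^ 2)) *
    ((1 / (2 * r)) ^ (r - 3) * (α / (4 * r ^ 2))) ^ r) (1 / 16 * (α ^ 2 / 1024))

lemma absorbConst_pos {r : ℕ} (hr : 0 < r) {α : ℝ} (hα : 0 < α) : 0 < absorbConst r α := by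
  unfold absorbConst
  have : (0 : ℝ) < r := by exact_mod_cast hr
  apply lt_min <;> positivity

open Classical in
lemma card_absorbs_ge {r : ℕ} (hr : 2 ≤ r) {α θ : ℝ} (hα : 0 < α) (hα1 : α < 1) (hθ : 0 ≤ θ)
    (hθα : 100 * r * θ ≤ α / r) (hdvd : r ∣ Fintype.card V) (hV : 0 < Fintype.card V)
    (hdeg : ∀ v, (Fintype.card V : ℝ) - (1 / r + θ) * Fintype.card V ≤ G.degree v)
    (hN : ∀ X : Finset V, (1 / r - α / (8 * r)) * Fintype.card V ≤ X.card →
      α / (4 * r ^ 2) * (Fintype.card V : ℝ) ^ 2 ≤ edgesBetween G X X)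
    (hdisc : r = 2 → ¬ IsDisconnectedGraph G α) (x : Fin r → V) :
    absorbConst r α * (Fintype.card V : ℝ) ^ (r * r) ≤
      ((univ.filter (fun g : Fin r × Fin r → V => CliqueAbsorbs G r x g)).card : ℝ) := by
  obtain ⟨q, rfl⟩ : ∃ q, r = q + 1 := ⟨r - 1, by omega⟩
  have hq : 1 ≤ q := by omega
  have hn0 : (0 : ℝ) ≤ Fintype.card V := Nat.cast_nonneg _
  have hr0 : (0 : ℝ) < ((q + 1 : ℕ) : ℝ) := by positivity
  rcases Nat.eq_or_lt_of_le hq with rfl | hq2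
  · have hE : ∀ a b, α ^ 2 / 1024 * (Fintype.card V : ℝ) ^ 2 ≤
        edgesBetween G (G.neighborFinset a) (G.neighborFinset b) := by
      intro a b
      push_cast at hθα hdeg hN
      refine edgesBetween_neighborFinset_ge hα hα1 (by simpa using hdvd) hV hθ (by linarith) ?_ ?_
        (hdisc rfl) a b
      · intro v; have := hdeg v; norm_num at this ⊢; linarith
      · intro X hX
        have := hN X (by norm_num at hX ⊢; linarith)
        norm_num at this ⊢; linarith
    set T : Finset ((_ : V × V) × (V × V)) :=
      (G.neighborFinset (x 0) ×ˢ G.neighborFinset (x 1)).sigma (fun z =>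
        ((G.neighborFinset z.1 ×ˢ G.neighborFinset z.2).filter
          (fun p : V × V => G.Adj p.1 p.2))) with hT
    have hle : T.card ≤ (univ.filter (fun g : Fin (1 + 1) × Fin (1 + 1) → V =>
        CliqueAbsorbs G (1 + 1) x g)).card := by
      apply card_le_card_of_injOn (fun p : (_ : V × V) × (V × V) =>
        (fun it : Fin 2 × Fin 2 => if it.2 = 0 then (if it.1 = 0 then p.2.1 else p.2.2)
          else (if it.1 = 0 then p.1.1 else p.1.2)))
      · rintro ⟨⟨z0, z1⟩, ⟨y0, y1⟩⟩ h
        simp only [hT, coe_sigma, Set.mem_sigma_iff, mem_coe, mem_product, mem_filter,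
          SimpleGraph.mem_neighborFinset] at h
        obtain ⟨⟨h1, h2⟩, ⟨h3, h4⟩, h5⟩ := h
        rw [mem_coe, mem_filter]
        refine ⟨mem_univ _, absorbs_of_grid ?_ ?_ ?_⟩
        · intro i s t hst
          fin_cases i <;> fin_cases s <;> fin_cases t <;>
            first
              | exact absurd rfl hst
              | exact h3.symm
              | exact h3
              | exact h4.symm
              | exact h4
        · intro i j hij
          fin_cases i <;> fin_cases j <;>
            first
              | exact absurd rfl hij
              | exact h5
              | exact h5.symm
        · intro i t ht
          fin_cases i <;> fin_cases t <;>
            first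
              | exact absurd rfl ht
              | exact h1
              | exact h2
      · rintro ⟨⟨z0, z1⟩, ⟨y0, y1⟩⟩ _ ⟨⟨z0', z1'⟩, ⟨y0', y1'⟩⟩ _ h
        have e1 : y0 = y0' := by simpa using congrFun h (0, 0)
        have e2 : z0 = z0' := by simpa using congrFun h (0, 1)
        have e3 : y1 = y1' := by simpa using congrFun h (1, 0)
        have e4 : z1 = z1' := by simpa using congrFun h (1, 1)
        rw [e1, e2, e3, e4]
    have hdeg4 : ∀ v, 1 / 4 * (Fintype.card V : ℝ) ≤ (G.neighborFinset v).card := by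
      intro v
      have := hdeg v
      rw [SimpleGraph.card_neighborFinset_eq_degree]
      push_cast at this hθα
      have h4 : θ ≤ 1 / 4 := by linarith
      norm_num at this
      nlinarith
    have hTc : 1 / 16 * (α ^ 2 / 1024) * (Fintype.card V : ℝ) ^ 4 ≤ T.card := by
      rw [hT, card_sigma]
      push_cast
      have h1 := card_nsmul_le_sum (G.neighborFinset (x 0) ×ˢ G.neighborFinset (x 1)) _ _
        (fun z _ => hE z.1 z.2)
      rw [nsmul_eq_mul, card_product] at h1
      refine le_trans ?_ h1
      push_cast
      have h2 := mul_le_mul (hdeg4 (x 0)) (hdeg4 (x 1)) (by positivity) (Nat.cast_nonneg _)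
      calc _ = (1 / 4 * (Fintype.card V : ℝ)) * (1 / 4 * (Fintype.card V : ℝ)) *
            (α ^ 2 / 1024 * (Fintype.card V : ℝ) ^ 2) := by ring
        _ ≤ _ := mul_le_mul_of_nonneg_right h2 (by positivity)
    calc _ ≤ 1 / 16 * (α ^ 2 / 1024) * (Fintype.card V : ℝ) ^ 4 :=
          mul_le_mul_of_nonneg_right (min_le_right _ _) (by positivity)
      _ ≤ _ := hTc
      _ ≤ _ := by exact_mod_cast hle
  · obtain ⟨k, rfl⟩ : ∃ k, q = k + 2 := ⟨q - 2, by omega⟩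
    have hαr : α / (8 * ((k + 2 + 1 : ℕ) : ℝ)) ≤ 1 / (2 * ((k + 2 + 1 : ℕ) : ℝ)) := by
      rw [div_le_div_iff₀ (by positivity) (by positivity)]
      nlinarith
    set c : ℝ := α / (4 * ((k + 2 + 1 : ℕ) : ℝ) ^ 2) with hc
    have hc0 : 0 ≤ c := by positivity
    have hcount := fun k' => card_cliqueTuples_ge (G := G) (Nat.succ_pos (k + 2)) hθ hαr hc0 hdeg hN k'
    have hkr : ((k : ℝ) + 2 + 1) * θ * 100 ≤ α / ((k : ℝ) + 2 + 1) := by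
      push_cast at hθα; linarith
    have hθ8 : ((k : ℝ) + 3) * θ ≤ α / (8 * ((k + 2 + 1 : ℕ) : ℝ)) := by
      have : α / (8 * ((k + 2 + 1 : ℕ) : ℝ)) = (α / ((k : ℝ) + 2 + 1)) / 8 := by
        push_cast; field_simp
      rw [this]
      have : 0 ≤ ((k : ℝ) + 2 + 1) * θ := by positivity
      linarith
    have hk0 : (0 : ℝ) ≤ k := Nat.cast_nonneg k
    set T : Finset ((_ : Fin (k + 2 + 1) → V) × (Fin (k + 2 + 1) → (Fin (k + 2) → V))) :=
      (cliqueTuples G univ (k + 2 + 1)).sigma (fun y =>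
        Fintype.piFinset fun i =>
          cliqueTuples G (G.neighborFinset (x i) ∩ G.neighborFinset (y i)) (k + 2)) with hT
    have hle : T.card ≤ (univ.filter (fun g : Fin (k + 2 + 1) × Fin (k + 2 + 1) → V =>
        CliqueAbsorbs G (k + 2 + 1) x g)).card := by
      apply card_le_card_of_injOn
        (fun p : (_ : Fin (k + 2 + 1) → V) × (Fin (k + 2 + 1) → (Fin (k + 2) → V)) =>
          (fun it : Fin (k + 2 + 1) × Fin (k + 2 + 1) =>
            (Fin.cons (p.1 it.1) (p.2 it.1) : Fin (k + 2 + 1) → V) it.2))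
      · rintro ⟨y, z⟩ h
        simp only [hT, coe_sigma, Set.mem_sigma_iff, mem_coe, Fintype.mem_piFinset,
          mem_cliqueTuples, mem_univ, true_and, mem_inter, SimpleGraph.mem_neighborFinset,
          implies_true] at h
        obtain ⟨hy, hz⟩ := h
        rw [mem_coe, mem_filter]
        refine ⟨mem_univ _, absorbs_of_grid ?_ ?_ ?_⟩
        · intro i s t
          refine Fin.cases ?_ ?_ s
          · refine Fin.cases ?_ ?_ t
            · intro h; exact absurd rfl h
            · intro t' _; simpa using ((hz i).1 t').2
          · intro s'
            refine Fin.cases ?_ ?_ t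
            · intro _; simpa using ((hz i).1 s').2.symm
            · intro t' h
              simpa using (hz i).2 s' t' (fun h' => h (by rw [h']))
        · intro i j hij
          simpa using hy i j hij
        · intro i t
          refine Fin.cases ?_ ?_ t
          · intro h; exact absurd rfl h
          · intro t' _; simpa using ((hz i).1 t').1
      · rintro ⟨y, z⟩ _ ⟨y', z'⟩ _ h
        have h1 : y = y' := by
          funext i
          simpa using congrFun h (i, 0)
        have h2 : z = z' := by
          funext i t
          simpa using congrFun h (i, Fin.succ t)
        rw [h1, h2]
    have hY : (1 / (2 * ((k + 2 + 1 : ℕ) : ℝ))) ^ (k + 1) * c *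
        (Fintype.card V : ℝ) ^ (k + 2 + 1) ≤ (cliqueTuples G univ (k + 2 + 1)).card := by
      refine hcount (k + 1) univ ?_
      rw [card_univ]
      have h1 : (((k + 1 : ℕ) : ℝ) + 1) / ((k + 2 + 1 : ℕ) : ℝ) =
          1 - 1 / ((k + 2 + 1 : ℕ) : ℝ) := by push_cast; field_simp; ring
      rw [h1]
      have h2 : 1 - 1 / ((k + 2 + 1 : ℕ) : ℝ) - α / (8 * ((k + 2 + 1 : ℕ) : ℝ)) +
          ((k + 1 : ℕ) : ℝ) * θ ≤ 1 := by
        have : 0 < 1 / ((k + 2 + 1 : ℕ) : ℝ) := by positivity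
        push_cast at hθ8 this ⊢
        nlinarith
      nlinarith
    have hZ : ∀ y : Fin (k + 2 + 1) → V, ∀ i, (1 / (2 * ((k + 2 + 1 : ℕ) : ℝ))) ^ k * c *
        (Fintype.card V : ℝ) ^ (k + 2) ≤
        (cliqueTuples G (G.neighborFinset (x i) ∩ G.neighborFinset (y i)) (k + 2)).card := by
      intro y i
      refine hcount k _ ?_
      have h1 := card_sdiff_neighborFinset (G.neighborFinset (x i)) (y i) (hdeg (y i))
      have h2 := hdeg (x i)
      rw [SimpleGraph.card_neighborFinset_eq_degree] at h1
      have h3 : ((k : ℝ) + 1) / ((k + 2 + 1 : ℕ) : ℝ) =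
          1 - 2 * (1 / ((k + 2 + 1 : ℕ) : ℝ)) := by push_cast; field_simp; ring
      rw [h3]
      have h4 : (1 - 2 * (1 / ((k + 2 + 1 : ℕ) : ℝ)) - α / (8 * ((k + 2 + 1 : ℕ) : ℝ)) +
          (k : ℝ) * θ) * (Fintype.card V : ℝ) ≤
          (1 - 2 * (1 / ((k + 2 + 1 : ℕ) : ℝ)) - 2 * θ) * (Fintype.card V : ℝ) :=
        mul_le_mul_of_nonneg_right (by nlinarith) hn0
      linarith
    have hTc : (1 / (2 * ((k + 2 + 1 : ℕ) : ℝ))) ^ (k + 1) * c *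
        (Fintype.card V : ℝ) ^ (k + 2 + 1) * ((1 / (2 * ((k + 2 + 1 : ℕ) : ℝ))) ^ k * c *
        (Fintype.card V : ℝ) ^ (k + 2)) ^ (k + 2 + 1) ≤ T.card := by
      rw [hT, card_sigma]
      push_cast
      have h1 := card_nsmul_le_sum (cliqueTuples G univ (k + 2 + 1))
        (fun y => ((Fintype.piFinset fun i => cliqueTuples G
          (G.neighborFinset (x i) ∩ G.neighborFinset (y i)) (k + 2)).card : ℝ))
        (((1 / (2 * ((k + 2 + 1 : ℕ) : ℝ))) ^ k * c *
          (Fintype.card V : ℝ) ^ (k + 2)) ^ (k + 2 + 1)) (by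
        intro y _
        rw [Fintype.card_piFinset]
        push_cast
        have := prod_le_prod (s := (univ : Finset (Fin (k + 2 + 1))))
          (fun _ _ => by positivity) (fun i _ => hZ y i)
        rw [prod_const, card_univ, Fintype.card_fin] at this
        exact_mod_cast this)
      rw [nsmul_eq_mul] at h1
      refine le_trans ?_ (by exact_mod_cast h1)
      have := mul_le_mul_of_nonneg_right hY (show 0 ≤ ((1 / (2 * ((k + 2 + 1 : ℕ) : ℝ))) ^ k * c *
          (Fintype.card V : ℝ) ^ (k + 2)) ^ (k + 2 + 1) by positivity)
      exact_mod_cast this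
    have hcast : (T.card : ℝ) ≤ ((univ.filter (fun g : Fin (k + 2 + 1) × Fin (k + 2 + 1) → V =>
        CliqueAbsorbs G (k + 2 + 1) x g)).card : ℝ) := by exact_mod_cast hle
    refine le_trans ?_ (hTc.trans hcast)
    have h1 : absorbConst (k + 2 + 1) α ≤ (1 / (2 * ((k + 2 + 1 : ℕ) : ℝ))) ^ (k + 1) * c *
        ((1 / (2 * ((k + 2 + 1 : ℕ) : ℝ))) ^ k * c) ^ (k + 2 + 1) := min_le_left _ _
    refine le_trans (mul_le_mul_of_nonneg_right h1 (by positivity)) (le_of_eq ?_)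
    rw [mul_pow _ ((Fintype.card V : ℝ) ^ (k + 2)) (k + 2 + 1), ← pow_mul]
    have h2 : (k + 2 + 1) * (k + 2 + 1) = (k + 2 + 1) + (k + 2) * (k + 2 + 1) := by ring
    rw [h2, pow_add]
    ring

end AbsorberCount

/-! ### Concentration for random maps -/

section Sampling

variable {V ι κ β : Type*} [Fintype V] [DecidableEq V] [Fintype ι] [DecidableEq ι] [Fintype κ]
  [DecidableEq κ] [Fintype β] [DecidableEq β]

/-- Functions agreeing with `w` on `T`. -/
def pinnedMaps (T : Finset ι) (w : ι → V) : Finset (ι → V) :=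
  univ.filter (fun f => ∀ i ∈ T, f i = w i)

omit [Fintype κ] [DecidableEq κ] in
lemma extend_mem_pinnedMaps {T : Finset ι} {w : ι → V} {e : κ → ι} (he : ∀ k, e k ∉ T)
    {f : ι → V} (hf : f ∈ pinnedMaps T w) (b : κ → V) :
    Function.extend e b f ∈ pinnedMaps T w := by
  simp only [pinnedMaps, mem_filter, mem_univ, true_and] at hf ⊢
  intro i hi
  rw [Function.extend_apply' _ _ _ (fun ⟨k, hk⟩ => he k (hk ▸ hi))]
  exact hf i hi

lemma sum_pinnedMaps_mul {T : Finset ι} {w : ι → V} {e : κ → ι} (hinj : Function.Injective e)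
    (he : ∀ k, e k ∉ T) (Φ : (ι → V) → ℝ)
    (hΦ : ∀ f b, Φ (Function.extend e b f) = Φ f) (g : (κ → V) → ℝ) :
    (Fintype.card V : ℝ) ^ Fintype.card κ * ∑ f ∈ pinnedMaps T w, Φ f * g (f ∘ e) =
      (∑ b, g b) * ∑ f ∈ pinnedMaps T w, Φ f := by
  have h1 : ∑ x ∈ pinnedMaps T w ×ˢ (univ : Finset (κ → V)), Φ x.1 * g (x.1 ∘ e) =
      ∑ x ∈ pinnedMaps T w ×ˢ (univ : Finset (κ → V)), Φ x.1 * g x.2 := by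
    have hinv : ∀ x : (ι → V) × (κ → V),
        Function.extend e (x.1 ∘ e) (Function.extend e x.2 x.1) = x.1 := by
      rintro ⟨f, b⟩
      funext i
      by_cases hi : ∃ k, e k = i
      · obtain ⟨k, rfl⟩ := hi
        rw [hinj.extend_apply]; rfl
      · rw [Function.extend_apply' _ _ _ hi, Function.extend_apply' _ _ _ hi]
    have hcomp : ∀ (b : κ → V) (f : ι → V), Function.extend e b f ∘ e = b := by
      intro b f
      funext k
      exact hinj.extend_apply b f k
    refine sum_nbij' (fun x => (Function.extend e x.2 x.1, x.1 ∘ e))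
      (fun x => (Function.extend e x.2 x.1, x.1 ∘ e)) ?_ ?_ ?_ ?_ ?_
    · rintro ⟨f, b⟩ h
      rw [mem_product] at h ⊢
      exact ⟨extend_mem_pinnedMaps he h.1 b, mem_univ _⟩
    · rintro ⟨f, b⟩ h
      rw [mem_product] at h ⊢
      exact ⟨extend_mem_pinnedMaps he h.1 b, mem_univ _⟩
    · rintro ⟨f, b⟩ _
      exact Prod.ext (hinv (f, b)) (hcomp _ _)
    · rintro ⟨f, b⟩ _
      exact Prod.ext (hinv (f, b)) (hcomp _ _)
    · rintro ⟨f, b⟩ _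
      simp only [hΦ]
  rw [sum_product, sum_product] at h1
  simp only [sum_const, card_univ, Fintype.card_fun, nsmul_eq_mul, ← mul_sum, ← sum_mul] at h1
  push_cast at h1
  rw [h1, mul_comm]

omit [Fintype β] in
lemma sum_prod_pinnedMaps {T : Finset ι} {w : ι → V} {e : β × κ → ι}
    (hinj : Function.Injective e) (g : (κ → V) → ℝ) (J : Finset β)
    (hJ : ∀ j ∈ J, ∀ k, e (j, k) ∉ T) :
    ((Fintype.card V : ℝ) ^ Fintype.card κ) ^ J.card *
      ∑ f ∈ pinnedMaps T w, ∏ j ∈ J, g (fun k => f (e (j, k))) =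
      (∑ b, g b) ^ J.card * (pinnedMaps T w).card := by
  induction J using Finset.induction_on with
  | empty => simp
  | insert j J hj ih =>
    have h1 := ih (fun i hi => hJ i (mem_insert_of_mem hi))
    have h2 := sum_pinnedMaps_mul (w := w) (e := fun k => e (j, k))
      (fun a b h => (Prod.mk.inj (hinj h)).2) (hJ j (mem_insert_self j J))
      (fun f => ∏ i ∈ J, g (fun k => f (e (i, k)))) (by
        intro f b
        refine prod_congr rfl fun i hi => ?_
        congr 1
        funext k
        apply Function.extend_apply'
        rintro ⟨k', hk'⟩
        have := (Prod.mk.inj (hinj hk')).1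
        exact hj (this ▸ hi)) g
    rw [card_insert_of_notMem hj, pow_succ, pow_succ]
    simp only [prod_insert hj]
    have h3 : ∀ f : ι → V, g (fun k => f (e (j, k))) * ∏ i ∈ J, g (fun k => f (e (i, k))) =
        (∏ i ∈ J, g (fun k => f (e (i, k)))) * g (f ∘ fun k => e (j, k)) := by
      intro f; rw [mul_comm]; rfl
    simp only [h3]
    rw [mul_assoc, h2]
    linear_combination (∑ b, g b) * h1

omit [Fintype ι] [DecidableEq κ] [DecidableEq β] in
lemma card_touched_le {T : Finset ι} {e : β × κ → ι} (hinj : Function.Injective e) :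
    (univ.filter (fun j => ∃ k, e (j, k) ∈ T)).card ≤ T.card := by
  rcases isEmpty_or_nonempty ι with hι | hι
  · rw [filter_false_of_mem fun j _ ⟨k, _⟩ => hι.elim (e (j, k)), card_empty]
    exact Nat.zero_le _
  have h : ∀ j ∈ univ.filter (fun j => ∃ k, e (j, k) ∈ T), ∃ i ∈ T, ∃ k, e (j, k) = i := by
    intro j hj
    obtain ⟨k, hk⟩ := (mem_filter.1 hj).2
    exact ⟨_, hk, k, rfl⟩
  choose! φ hφ hφ' using h
  refine card_le_card_of_injOn φ hφ ?_
  intro a ha b hb hab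
  obtain ⟨k, hk⟩ := hφ' a ha
  obtain ⟨k', hk'⟩ := hφ' b hb
  exact (Prod.mk.inj (hinj (hk.trans (hab.trans hk'.symm)))).1

lemma card_pinnedMaps_deviation {T : Finset ι} {w : ι → V} {e : β × κ → ι}
    (hinj : Function.Injective e) {ρ ε : ℝ} (hρ : 0 ≤ ρ) (hρ1 : ρ ≤ 1) (hε : 0 ≤ ε) (hε2 : ε ≤ 2)
    (hV : 0 < Fintype.card V) (𝓑 : Finset (κ → V))
    (h𝓑 : (𝓑.card : ℝ) ≤ ρ * (Fintype.card V : ℝ) ^ Fintype.card κ) :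
    (((pinnedMaps T w).filter (fun f => (ρ + ε) * Fintype.card β + T.card <
      ((univ.filter (fun j => (fun k => f (e (j, k))) ∈ 𝓑)).card : ℝ))).card : ℝ) ≤
      Real.exp (-(ε ^ 2 / 4 * Fintype.card β)) * (pinnedMaps T w).card := by
  set J : Finset β := univ.filter (fun j => ¬ ∃ k, e (j, k) ∈ T) with hJ
  set l : ℝ := ε / 2 with hl
  have hl0 : 0 ≤ l := by positivity
  have hl1 : l ≤ 1 := by rw [hl]; linarith
  set N : ℝ := (Fintype.card V : ℝ) ^ Fintype.card κ with hN
  have hN0 : 0 < N := by have : (0 : ℝ) < Fintype.card V := by exact_mod_cast hV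
                         positivity
  set g : (κ → V) → ℝ := fun b => if b ∈ 𝓑 then Real.exp l else 1 with hg
  have hmain := sum_prod_pinnedMaps (w := w) hinj g J (by
    intro j hj k hk
    exact (mem_filter.1 hj).2 ⟨k, hk⟩)
  have hexp : Real.exp l - 1 ≤ l + l ^ 2 := by
    have h := Real.abs_exp_sub_one_sub_id_le (x := l) (by rw [abs_of_nonneg hl0]; exact hl1)
    have := (abs_le.1 h).2
    linarith
  have hexp0 : 0 ≤ Real.exp l - 1 := by have := Real.add_one_le_exp l; linarith
  have hgsum : ∑ b, g b ≤ N * Real.exp (ρ * l + l ^ 2) := by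
    have h1 : ∑ b, g b = N + (Real.exp l - 1) * 𝓑.card := by
      have : ∀ b, g b = 1 + (if b ∈ 𝓑 then (Real.exp l - 1) else 0) := by
        intro b; simp only [hg]; split_ifs <;> ring
      simp only [this, sum_add_distrib, sum_const, card_univ, Fintype.card_fun, nsmul_eq_mul,
        mul_one, sum_ite_mem, univ_inter]
      push_cast
      rw [hN]; ring
    have h2 : (Real.exp l - 1) * 𝓑.card ≤ (l + l ^ 2) * (ρ * N) :=
      mul_le_mul hexp h𝓑 (Nat.cast_nonneg _) (by positivity)
    have h3 := Real.add_one_le_exp (ρ * l + l ^ 2)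
    have h4 : N * (ρ * l + l ^ 2 + 1) ≤ N * Real.exp (ρ * l + l ^ 2) :=
      mul_le_mul_of_nonneg_left h3 hN0.le
    have h5 : ρ * (l ^ 2 * N) ≤ 1 * (l ^ 2 * N) := mul_le_mul_of_nonneg_right hρ1 (by positivity)
    rw [h1]
    nlinarith
  have hgsum0 : 0 ≤ ∑ b, g b := sum_nonneg fun b _ => by
    simp only [hg]; split_ifs <;> positivity
  have hprod : ∀ f : ι → V, ∏ j ∈ J, g (fun k => f (e (j, k))) =
      Real.exp (l * ((J.filter (fun j => (fun k => f (e (j, k))) ∈ 𝓑)).card : ℝ)) := by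
    intro f
    simp only [hg]
    rw [prod_ite, prod_const, prod_const_one, mul_one, ← Real.exp_nat_mul, mul_comm]
  have hupper : ∑ f ∈ pinnedMaps T w, ∏ j ∈ J, g (fun k => f (e (j, k))) ≤
      Real.exp (ρ * l + l ^ 2) ^ J.card * (pinnedMaps T w).card := by
    have h1 : N ^ J.card * ∑ f ∈ pinnedMaps T w, ∏ j ∈ J, g (fun k => f (e (j, k))) ≤
        N ^ J.card * (Real.exp (ρ * l + l ^ 2) ^ J.card * (pinnedMaps T w).card) := by
      rw [hmain, ← mul_assoc, ← mul_pow]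
      exact mul_le_mul_of_nonneg_right (pow_le_pow_left₀ hgsum0 hgsum _) (Nat.cast_nonneg _)
    exact le_of_mul_le_mul_left h1 (by positivity)
  have hlower : ∀ f ∈ (pinnedMaps T w).filter (fun f => (ρ + ε) * Fintype.card β + T.card <
      ((univ.filter (fun j => (fun k => f (e (j, k))) ∈ 𝓑)).card : ℝ)),
      Real.exp (l * ((ρ + ε) * Fintype.card β)) ≤ ∏ j ∈ J, g (fun k => f (e (j, k))) := by
    intro f hf
    have hf2 := (mem_filter.1 hf).2
    rw [hprod]
    apply Real.exp_le_exp.2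
    apply mul_le_mul_of_nonneg_left _ hl0
    have h1 : univ.filter (fun j => (fun k => f (e (j, k))) ∈ 𝓑) ⊆
        J.filter (fun j => (fun k => f (e (j, k))) ∈ 𝓑) ∪
          univ.filter (fun j => ∃ k, e (j, k) ∈ T) := by
      intro j hj
      have := (mem_filter.1 hj).2
      rw [mem_union, mem_filter, mem_filter, mem_filter]
      by_cases h : ∃ k, e (j, k) ∈ T
      · exact Or.inr ⟨mem_univ _, h⟩
      · exact Or.inl ⟨⟨mem_univ _, h⟩, this⟩
    have h2 := (card_le_card h1).trans (card_union_le _ _)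
    have h3 := card_touched_le (T := T) hinj
    have h4 : ((univ.filter (fun j => (fun k => f (e (j, k))) ∈ 𝓑)).card : ℝ) ≤
        (J.filter (fun j => (fun k => f (e (j, k))) ∈ 𝓑)).card + T.card := by
      exact_mod_cast h2.trans (Nat.add_le_add_left h3 _)
    linarith
  have h1 := card_nsmul_le_sum _ _ _ hlower
  have h2 : ∑ f ∈ (pinnedMaps T w).filter (fun f => (ρ + ε) * Fintype.card β + T.card <
      ((univ.filter (fun j => (fun k => f (e (j, k))) ∈ 𝓑)).card : ℝ)),
      ∏ j ∈ J, g (fun k => f (e (j, k))) ≤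
      ∑ f ∈ pinnedMaps T w, ∏ j ∈ J, g (fun k => f (e (j, k))) :=
    sum_le_sum_of_subset_of_nonneg (filter_subset _ _) fun f _ _ => by
      rw [hprod]; positivity
  rw [nsmul_eq_mul] at h1
  have h3 := h1.trans (h2.trans hupper)
  have h4 : Real.exp (ρ * l + l ^ 2) ^ J.card ≤
      Real.exp ((ρ * l + l ^ 2) * Fintype.card β) := by
    rw [← Real.exp_nat_mul]
    apply Real.exp_le_exp.2
    have : (J.card : ℝ) ≤ Fintype.card β := by exact_mod_cast card_le_univ J
    have h0 : 0 ≤ ρ * l + l ^ 2 := by positivity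
    rw [mul_comm]
    exact mul_le_mul_of_nonneg_left this h0
  have h5 := h3.trans (mul_le_mul_of_nonneg_right h4 (Nat.cast_nonneg _))
  have h6 : Real.exp ((ρ * l + l ^ 2) * Fintype.card β) =
      Real.exp (-(ε ^ 2 / 4 * Fintype.card β)) * Real.exp (l * ((ρ + ε) * Fintype.card β)) := by
    rw [← Real.exp_add]
    congr 1
    rw [hl]; ring
  rw [h6] at h5
  have h7 := Real.exp_pos (l * ((ρ + ε) * Fintype.card β))
  refine le_of_mul_le_mul_right (h5.trans (le_of_eq ?_)) h7
  ring

lemma card_fixed_eq (p : ι) (v : V) :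
    (univ.filter (fun f : ι → V => f p = v)).card =
      Fintype.card V ^ (Fintype.card ι - 1) := by
  classical
  have : univ.filter (fun f : ι → V => f p = v) =
      Fintype.piFinset (fun i => if i = p then {v} else univ) := by
    ext f
    simp only [mem_filter, mem_univ, true_and, Fintype.mem_piFinset]
    constructor
    · intro h i
      split_ifs with hi
      · rw [hi, h]; exact mem_singleton_self v
      · exact mem_univ _
    · intro h
      simpa using h p
  rw [this, Fintype.card_piFinset]
  rw [← mul_prod_erase univ _ (mem_univ p), if_pos rfl, card_singleton, one_mul,
    prod_congr rfl (g := fun _ => Fintype.card V) (fun i hi => by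
      rw [if_neg (mem_erase.1 hi).1, card_univ]), prod_const, card_erase_of_mem (mem_univ p),
    card_univ]

/-- Deviation bound uniformly over all tuples `t` of sampled vertices. -/
lemma card_deviation_le {e : β × κ → ι} (hinj : Function.Injective e) {ρ ε : ℝ} (hρ : 0 ≤ ρ)
    (hρ1 : ρ ≤ 1) (hε : 0 ≤ ε) (hε2 : ε ≤ 2) (hV : 0 < Fintype.card V) {l : ℕ}
    (B : (Fin l → V) → Finset (κ → V))
    (hB : ∀ a, ((B a).card : ℝ) ≤ ρ * (Fintype.card V : ℝ) ^ Fintype.card κ) (p : ι) (v : V) :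
    ((univ.filter (fun f : ι → V => f p = v ∧ ∃ t : Fin l → ι,
      (ρ + ε) * Fintype.card β + (l + 1) <
        ((univ.filter (fun j => (fun k => f (e (j, k))) ∈ B (f ∘ t))).card : ℝ))).card : ℝ) ≤
      (Fintype.card ι : ℝ) ^ l * (Real.exp (-(ε ^ 2 / 4 * Fintype.card β)) *
        (Fintype.card V : ℝ) ^ (Fintype.card ι - 1)) := by
  set D : (Fin l → ι) → Finset (ι → V) := fun t =>
    (univ.filter (fun f : ι → V => f p = v)).filter (fun f => 
      (ρ + ε) * Fintype.card β + (l + 1) <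
        ((univ.filter (fun j => (fun k => f (e (j, k))) ∈ B (f ∘ t))).card : ℝ)) with hD
  have hsub : univ.filter (fun f : ι → V => f p = v ∧ ∃ t : Fin l → ι,
      (ρ + ε) * Fintype.card β + (l + 1) <
        ((univ.filter (fun j => (fun k => f (e (j, k))) ∈ B (f ∘ t))).card : ℝ)) ⊆
      univ.biUnion D := by
    intro f hf
    obtain ⟨-, h1, t, ht⟩ := mem_filter.1 hf
    exact mem_biUnion.2 ⟨t, mem_univ _, mem_filter.2 ⟨mem_filter.2 ⟨mem_univ _, h1⟩, ht⟩⟩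
  have hDt : ∀ t, ((D t).card : ℝ) ≤ Real.exp (-(ε ^ 2 / 4 * Fintype.card β)) *
        (Fintype.card V : ℝ) ^ (Fintype.card ι - 1) := by
    intro t
    set T : Finset ι := insert p (univ.image t) with hT
    have hTcard : T.card ≤ l + 1 := by
      refine (card_insert_le _ _).trans (Nat.add_le_add_right ?_ 1)
      exact card_image_le.trans (by rw [card_univ, Fintype.card_fin])
    have hTr : (T.card : ℝ) ≤ l + 1 := by exact_mod_cast hTcard
    set F := univ.filter (fun f : ι → V => f p = v) with hF
    set R : (ι → V) → (T → V) := fun f i => f i with hR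
    have h1 : (D t).card = ∑ y ∈ F.image R, ((D t).filter (fun f => R f = y)).card :=
      card_eq_sum_card_fiberwise fun f hf => mem_image_of_mem R (mem_filter.1 hf).1
    have h2 : F.card = ∑ y ∈ F.image R, (F.filter (fun f => R f = y)).card :=
      card_eq_sum_card_fiberwise fun f hf => mem_image_of_mem R hf
    have h3 : (F.card : ℝ) = (Fintype.card V : ℝ) ^ (Fintype.card ι - 1) := by
      rw [hF, card_fixed_eq]; push_cast; rfl
    rw [← h3, h1, h2]
    push_cast
    rw [mul_sum]
    refine sum_le_sum fun y hy => ?_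
    obtain ⟨w, hw, rfl⟩ := mem_image.1 hy
    have hwp : w p = v := (mem_filter.1 hw).2
    have hRw : ∀ f : ι → V, R f = R w ↔ ∀ i ∈ T, f i = w i := by
      intro f
      constructor
      · intro h i hi; exact congrFun h ⟨i, hi⟩
      · intro h; funext i; exact h i i.2
    have h4 : F.filter (fun f => R f = R w) = pinnedMaps T w := by
      ext f
      simp only [hF, mem_filter, mem_univ, true_and, pinnedMaps, hRw]
      constructor
      · exact fun h => h.2
      · exact fun h => ⟨(h p (mem_insert_self _ _)).trans hwp, h⟩
    rw [h4]
    refine le_trans ?_ (card_pinnedMaps_deviation (T := T) (w := w) hinj hρ hρ1 hε hε2 hV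
      (B (w ∘ t)) (hB _))
    have h5 : (D t).filter (fun f => R f = R w) ⊆ (pinnedMaps T w).filter (fun f =>
        (ρ + ε) * Fintype.card β + T.card <
          ((univ.filter (fun j => (fun k => f (e (j, k))) ∈ B (w ∘ t))).card : ℝ)) := by
      intro f hf
      obtain ⟨hf1, hf2⟩ := mem_filter.1 hf
      obtain ⟨hf3, hf4⟩ := mem_filter.1 hf1
      have h6 : f ∘ t = w ∘ t := by
        funext i
        exact (hRw f).1 hf2 _ (mem_insert_of_mem (mem_image_of_mem t (mem_univ i)))
      rw [h6] at hf4
      refine mem_filter.2 ⟨?_, by linarith⟩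
      rw [← h4]
      exact mem_filter.2 ⟨hf3, hf2⟩
    exact_mod_cast card_le_card h5
  have h1 : ((univ.biUnion D).card : ℝ) ≤ ∑ t, ((D t).card : ℝ) := by
    exact_mod_cast card_biUnion_le
  have h2 := sum_le_card_nsmul univ (fun t => ((D t).card : ℝ)) _ (fun t _ => hDt t)
  rw [nsmul_eq_mul, card_univ, Fintype.card_fun, Fintype.card_fin] at h2
  push_cast at h2
  have h0 : ((univ.filter (fun f : ι → V => f p = v ∧ ∃ t : Fin l → ι,
      (ρ + ε) * Fintype.card β + (l + 1) <
        ((univ.filter (fun j => (fun k => f (e (j, k))) ∈ B (f ∘ t))).card : ℝ))).card : ℝ) ≤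
      ((univ.biUnion D).card : ℝ) := by exact_mod_cast card_le_card hsub
  exact h0.trans (h1.trans h2)

end Sampling

/-! ### Samples without atypical behaviour have factors -/

section Typical

variable {V : Type*} [Fintype V] [DecidableEq V] {G : SimpleGraph V} [DecidableRel G.Adj]

open Classical in
lemma tileable_comap_of_typical (hV : 0 < Fintype.card V) {U : Type*} [Fintype U] [DecidableEq U]
    (f : U → V) {r : ℕ} (hr : 2 ≤ r) (hdvd : r ∣ Fintype.card U) {β : Type*} [Fintype β]
    {e : β × (Fin r × Fin r) → U} (he : Function.Injective e) {γ δ η c : ℝ} {l k : ℕ}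
    (hγ : 0 < γ) (hδ1 : δ ≤ 1) (hγδ : 64 * r ^ 3 * γ ≤ δ) (hη : 0 < η) (hη1 : η ≤ 1)
    (hβ : (r : ℝ) ^ 2 * Fintype.card β ≤ γ * Fintype.card U)
    (hl : η * Fintype.card U ≤ r * l) (hk : 1 < k * c)
    (habs : ∀ t : Fin r → U, l ≤
      (univ.filter (fun j => CliqueAbsorbs G r (f ∘ t) (fun k => f (e (j, k))))).card)
    (hdeg : ∀ u, ((univ.filter (fun w => ¬ G.Adj (f u) (f w))).card : ℝ) ≤
      (1 / r + γ) * Fintype.card U)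
    (hcont : ∀ t : Fin k → U,
      ((univ.filter (fun w => f w ∈ indepContainer G c (f ∘ t))).card : ℝ) ≤
        (1 / r - δ) * Fintype.card U)
    (hι : (Fintype.card U + (Fintype.card U : ℝ) ^ k) ≤
      Real.exp (γ ^ 2 * η ^ 2 / (32 * r) * Fintype.card U))
    (hbig : 32 * r ^ 3 ≤ δ * η * Fintype.card U) : Tileable (G.comap f) r univ := by
  have hcardA : ∀ j, (univ.image (fun k => e (j, k))).card = r ^ 2 := by
    intro j
    rw [card_image_of_injective _ fun a b h => (Prod.mk.inj (he h)).2, card_univ,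
      Fintype.card_prod, Fintype.card_fin, sq]
  refine tileable_univ_of_absorb (G.comap f) hr hdvd (fun j => univ.image (fun k => e (j, k)))
    ?_ hγ hδ1 hγδ hη hη1 ?_ hl ?_ hdeg
    (fun t : Fin k → U => univ.filter (fun w => f w ∈ indepContainer G c (f ∘ t)))
    hcont ?_ ?_ hbig
  · intro i j hij
    rw [disjoint_left]
    intro x hx hx'
    obtain ⟨a, -, rfl⟩ := mem_image.1 hx
    obtain ⟨b, -, hb⟩ := mem_image.1 hx'
    exact hij (Prod.mk.inj (he hb)).1.symm
  · simp only [hcardA, sum_const, card_univ, nsmul_eq_mul]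
    push_cast
    linarith
  · intro S hS hdisj
    set t : Fin r → U := fun i => (S.equivFinOfCardEq hS).symm i with ht
    have htinj : Function.Injective t :=
      Subtype.val_injective.comp (S.equivFinOfCardEq hS).symm.injective
    have htS : univ.image t = S := by
      ext x
      simp only [mem_image, mem_univ, true_and, ht]
      constructor
      · rintro ⟨i, rfl⟩; exact ((S.equivFinOfCardEq hS).symm i).2
      · intro hx; exact ⟨S.equivFinOfCardEq hS ⟨x, hx⟩, by simp⟩
    refine ⟨_, habs t, fun j hj => ?_⟩
    obtain ⟨h1, h2⟩ := (mem_filter.1 hj).2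
    set φ : (Fin r × Fin r) ⊕ Fin r → U := Sum.elim (fun k => e (j, k)) t with hφ
    have hcomp : G.comap (Sum.elim (fun k => f (e (j, k))) (f ∘ t)) = (G.comap f).comap φ := by
      rw [SimpleGraph.comap_comap]
      congr 1
      rw [hφ, Sum.comp_elim]
      rfl
    rw [hcomp] at h1 h2
    have himg : (univ.image Sum.inl).image φ = univ.image (fun k => e (j, k)) := by
      rw [image_image]; rfl
    have hA : Tileable (G.comap f) r (univ.image (fun k => e (j, k))) := by
      rw [← himg]
      refine h1.image ?_
      intro x hx y hy hxy
      simp only [coe_image, coe_univ, Set.image_univ, Set.mem_range] at hx hy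
      obtain ⟨a, rfl⟩ := hx
      obtain ⟨b, rfl⟩ := hy
      rw [(Prod.mk.inj (he hxy)).2]
    have hd := hdisj j hA
    refine ⟨hA, ?_⟩
    have himg2 : univ.image φ = univ.image (fun k => e (j, k)) ∪ S := by
      rw [← htS]
      ext x
      simp only [mem_image, mem_univ, true_and, mem_union, Sum.exists, hφ, Sum.elim_inl,
        Sum.elim_inr]
    rw [← himg2]
    refine h2.image (Function.Injective.injOn ?_)
    refine Function.Injective.sumElim (fun a b h => (Prod.mk.inj (he h)).2) htinj ?_
    intro a b hab
    refine disjoint_left.1 hd (mem_image_of_mem _ (mem_univ a)) ?_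
    rw [hab, ← htS]
    exact mem_image_of_mem _ (mem_univ b)
  · intro X hX hind
    obtain ⟨s, hs, hsub⟩ := exists_subset_indepContainer (G := G) (c := c) hV
      (I := X.image f) (hX.image f) (by
        intro x hx y hy
        obtain ⟨a, ha, rfl⟩ := mem_image.1 hx
        obtain ⟨b, hb, rfl⟩ := mem_image.1 hy
        exact hind a ha b hb) hk
    choose t ht using fun i => mem_image.1 (hs i)
    refine ⟨t, fun x hx => mem_filter.2 ⟨mem_univ _, ?_⟩⟩
    have : f ∘ t = s := funext fun i => (ht i).2
    rw [this]
    exact hsub (mem_image_of_mem f hx)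
  · rw [Fintype.card_fun, Fintype.card_fin]
    push_cast
    exact hι

end Typical

/-! ### Random samples have factors with high probability -/

lemma eventually_mul_pow_le_exp (A : ℝ) (l : ℕ) {κ : ℝ} (hκ : 0 < κ) :
    ∀ᶠ m : ℕ in Filter.atTop, A * (m : ℝ) ^ l ≤ Real.exp (κ * m) := by
  have h := ((isLittleO_pow_exp_pos_mul_atTop l hκ).comp_tendsto
    tendsto_natCast_atTop_atTop).const_mul_left A
  filter_upwards [h.bound zero_lt_one] with m hm
  simp only [Function.comp, one_mul, Real.norm_eq_abs, Real.abs_exp] at hm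
  exact (le_abs_self _).trans hm

lemma exists_exceptional {V ι κ β : Type*} [Fintype V] [DecidableEq V] [Fintype ι]
    [DecidableEq ι] [Fintype κ] [DecidableEq κ] [Fintype β] [DecidableEq β]
    {e : β × κ → ι} (hinj : Function.Injective e) {ρ ε : ℝ} (hρ : 0 ≤ ρ)
    (hρ1 : ρ ≤ 1) (hε : 0 ≤ ε) (hε2 : ε ≤ 2) (hV : 0 < Fintype.card V) {l : ℕ}
    (B : (Fin l → V) → Finset (κ → V))
    (hB : ∀ a, ((B a).card : ℝ) ≤ ρ * (Fintype.card V : ℝ) ^ Fintype.card κ) (p : ι) (v : V)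
    {A x : ℝ} (hx : x ≤ ε ^ 2 / 4 * Fintype.card β)
    (hA : A * (Fintype.card ι : ℝ) ^ l ≤ Real.exp x) (hA0 : 0 ≤ A) :
    ∃ E : Finset (ι → V), A * (E.card : ℝ) ≤ (Fintype.card V : ℝ) ^ (Fintype.card ι - 1) ∧
      ∀ f : ι → V, f p = v → f ∉ E → ∀ t : Fin l → ι,
        ((univ.filter (fun j => (fun k => f (e (j, k))) ∈ B (f ∘ t))).card : ℝ) ≤
          (ρ + ε) * Fintype.card β + (l + 1) := by
  refine ⟨univ.filter (fun f : ι → V => f p = v ∧ ∃ t : Fin l → ι,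
      (ρ + ε) * Fintype.card β + (l + 1) <
        ((univ.filter (fun j => (fun k => f (e (j, k))) ∈ B (f ∘ t))).card : ℝ)), ?_, ?_⟩
  rotate_left
  · intro f hf hE t
    by_contra hcon
    push Not at hcon
    exact hE (mem_filter.2 ⟨mem_univ _, hf, t, hcon⟩)
  · have h := card_deviation_le hinj hρ hρ1 hε hε2 hV B hB p v
    refine (mul_le_mul_of_nonneg_left h hA0).trans ?_
    have h1 : Real.exp (-(ε ^ 2 / 4 * Fintype.card β)) ≤ Real.exp (-x) :=
      Real.exp_le_exp.2 (by linarith)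
    have h2 : A * (Fintype.card ι : ℝ) ^ l * Real.exp (-(ε ^ 2 / 4 * Fintype.card β)) ≤ 1 := by
      calc _ ≤ Real.exp x * Real.exp (-x) := mul_le_mul hA h1 (by positivity) (by positivity)
        _ = 1 := by rw [← Real.exp_add]; simp
    calc _ = A * (Fintype.card ι : ℝ) ^ l * Real.exp (-(ε ^ 2 / 4 * Fintype.card β)) *
          (Fintype.card V : ℝ) ^ (Fintype.card ι - 1) := by ring
      _ ≤ _ := mul_le_of_le_one_left (by positivity) h2

lemma card_unit_maps_le {V : Type*} [Fintype V] [DecidableEq V] (S : Finset V) :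
    (univ.filter (fun b : Unit → V => b () ∈ S)).card ≤ S.card := by
  refine card_le_card_of_injOn (fun b => b ()) (fun b hb => (mem_filter.1 hb).2) ?_
  intro a _ b _ h
  funext i
  exact h

set_option maxHeartbeats 1600000 in
open Classical in
/-- A random map into a suitable graph, with one value prescribed, is unlikely to induce a graph
without a `K_r`-factor. -/
lemma exists_sample_bound {r : ℕ} (hr : 2 ≤ r) {α : ℝ} (hα : 0 < α) (hα1 : α < 1) :
    ∃ θ : ℝ, 0 < θ ∧ ∃ M : ℕ, ∀ m, M ≤ m → r ∣ m → ∀ (V : Type) [Fintype V] [DecidableEq V]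
      (G : SimpleGraph V) [DecidableRel G.Adj], 0 < Fintype.card V → r ∣ Fintype.card V →
      (∀ v, (Fintype.card V : ℝ) - (1 / r + θ) * Fintype.card V ≤ G.degree v) →
      (∀ X : Finset V, (1 / r - α / (8 * r)) * Fintype.card V ≤ X.card →
        α / (4 * r ^ 2) * (Fintype.card V : ℝ) ^ 2 ≤ edgesBetween G X X) →
      (r = 2 → ¬ IsDisconnectedGraph G α) → ∀ (p : Fin m) (v : V),
      32 * (m : ℝ) * ((univ.filter (fun f : Fin m → V => f p = v ∧
        ¬ Tileable (G.comap f) r univ)).card : ℝ) ≤ (Fintype.card V : ℝ) ^ (m - 1) := by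
  have hr2 : (2 : ℝ) ≤ r := by exact_mod_cast hr
  have hr0 : (0 : ℝ) < r := by linarith
  set d : ℝ := α / (8 * r) with hd
  have hd0 : 0 < d := by positivity
  have hdr : d ≤ 1 / r := by
    rw [hd, div_le_div_iff₀ (by positivity) hr0]; nlinarith
  have hrinv : 1 / (r : ℝ) ≤ 1 / 2 := one_div_le_one_div_of_le (by norm_num) hr2
  set c : ℝ := α / (4 * r ^ 2) with hc
  have hc0 : 0 < c := by positivity
  set a : ℝ := absorbConst r α with ha
  have ha0 : 0 < a := absorbConst_pos (by omega) hα
  have ha1 : a ≤ 1 := by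
    refine (min_le_right _ _).trans ?_
    nlinarith
  set δ : ℝ := d / 2 with hδ
  have hδ0 : 0 < δ := by positivity
  have hδ1 : δ ≤ 1 := by rw [hδ]; linarith
  set γ : ℝ := δ / (64 * r ^ 3) with hγ
  have hγ0 : 0 < γ := by positivity
  have hγδ : 64 * r ^ 3 * γ = δ := by rw [hγ]; field_simp
  have hγ1 : γ ≤ 1 := by
    have : (8 : ℝ) ≤ r ^ 3 := by nlinarith [sq_nonneg (r : ℝ)]
    nlinarith
  set η : ℝ := a * γ / (4 * r) with hη
  have hη0 : 0 < η := by positivity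
  have hη1 : η ≤ 1 := by
    rw [hη, div_le_one (by positivity)]
    nlinarith [mul_le_mul ha1 hγ1 hγ0.le zero_le_one]
  set θ : ℝ := min (γ / 4) (α / (100 * r ^ 2)) with hθ
  have hθ0 : 0 < θ := lt_min (by positivity) (by positivity)
  have hθγ : θ ≤ γ / 4 := min_le_left _ _
  have hθα : 100 * r * θ ≤ α / r := by
    have h1 : θ ≤ α / (100 * r ^ 2) := min_le_right _ _
    calc 100 * r * θ ≤ 100 * r * (α / (100 * r ^ 2)) :=
          mul_le_mul_of_nonneg_left h1 (by positivity)
      _ = α / r := by field_simp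
  obtain ⟨k, hk⟩ := exists_nat_gt (1 / c)
  have hkc : 1 < k * c := (div_lt_iff₀ hc0).1 hk
  have hκ3 : 0 < (a / 4) ^ 2 / 4 * (γ / (2 * r ^ 2)) := by positivity
  have hκι : 0 < γ ^ 2 * η ^ 2 / (32 * r) := by positivity
  have hcast := tendsto_natCast_atTop_atTop (R := ℝ)
  have hev : ∀ᶠ m : ℕ in Filter.atTop, (1 ≤ (m : ℝ) ∧ 4 / γ ≤ (m : ℝ) ∧
      (k + 1) / (d / 4) ≤ (m : ℝ) ∧ 2 * r ^ 2 / γ ≤ (m : ℝ) ∧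
      (r + 1) / (a / 4 * (γ / (2 * r ^ 2))) ≤ (m : ℝ) ∧ 32 * r ^ 3 / (δ * η) ≤ (m : ℝ)) ∧
      2 * (m : ℝ) ^ 1 ≤ Real.exp (γ ^ 2 * η ^ 2 / (32 * r) * m) ∧
      2 * (m : ℝ) ^ k ≤ Real.exp (γ ^ 2 * η ^ 2 / (32 * r) * m) ∧
      96 * (m : ℝ) ^ 2 ≤ Real.exp ((γ / 4) ^ 2 / 4 * m) ∧
      96 * (m : ℝ) ^ (k + 1) ≤ Real.exp ((d / 4) ^ 2 / 4 * m) ∧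
      96 * (m : ℝ) ^ (r + 1) ≤ Real.exp ((a / 4) ^ 2 / 4 * (γ / (2 * r ^ 2)) * m) := by
    filter_upwards [hcast.eventually_ge_atTop 1, hcast.eventually_ge_atTop (4 / γ),
      hcast.eventually_ge_atTop ((k + 1) / (d / 4)), hcast.eventually_ge_atTop (2 * r ^ 2 / γ),
      hcast.eventually_ge_atTop ((r + 1) / (a / 4 * (γ / (2 * r ^ 2)))),
      hcast.eventually_ge_atTop (32 * r ^ 3 / (δ * η)),
      eventually_mul_pow_le_exp 2 1 hκι, eventually_mul_pow_le_exp 2 k hκι,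
      eventually_mul_pow_le_exp 96 2 (κ := (γ / 4) ^ 2 / 4) (by positivity),
      eventually_mul_pow_le_exp 96 (k + 1) (κ := (d / 4) ^ 2 / 4) (by positivity),
      eventually_mul_pow_le_exp 96 (r + 1) hκ3] with m h1 h2 h3 h4 h5 h6 h7 h8 h9 h10 h11
    exact ⟨⟨h1, h2, h3, h4, h5, h6⟩, h7, h8, h9, h10, h11⟩
  obtain ⟨M, hM⟩ := Filter.eventually_atTop.1 hev
  refine ⟨θ, hθ0, M, ?_⟩
  intro m hm hrm V _ _ G _ hV hrV hdeg hN hdisc p v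
  obtain ⟨⟨hm1, hm2, hm3, hm4, hm5, hm6⟩, hι1, hι2, hx1, hx2, hx3⟩ := hM m hm
  have hm0 : (0 : ℝ) < m := by linarith
  rw [div_le_iff₀ (by positivity)] at hm2 hm3 hm4 hm5 hm6
  have hn0 : (0 : ℝ) < Fintype.card V := by exact_mod_cast hV
  set J : ℕ := ⌊γ * m / r ^ 2⌋₊ with hJ
  have hJle : (r : ℝ) ^ 2 * J ≤ γ * m := by
    have := Nat.floor_le (show 0 ≤ γ * m / r ^ 2 by positivity)
    rw [le_div_iff₀ (by positivity)] at this
    linarith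
  have hJge : γ / (2 * r ^ 2) * m ≤ J := by
    have h1 := Nat.lt_floor_add_one (γ * m / (r : ℝ) ^ 2)
    have h2 : 1 ≤ γ / (2 * r ^ 2) * (m : ℝ) := by
      rw [div_mul_eq_mul_div, le_div_iff₀ (by positivity)]; linarith
    have h3 : γ * m / (r : ℝ) ^ 2 = γ / (2 * r ^ 2) * m + γ / (2 * r ^ 2) * m := by
      field_simp; ring
    rw [← hJ] at h1
    linarith
  obtain ⟨e⟩ : Nonempty (Fin J × (Fin r × Fin r) ↪ Fin m) := by
    apply Function.Embedding.nonempty_of_card_le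
    simp only [Fintype.card_prod, Fintype.card_fin]
    have : (r : ℝ) ^ 2 * J ≤ m := hJle.trans (by nlinarith)
    have h2 : r ^ 2 * J ≤ m := by exact_mod_cast this
    linarith
  have hfst : Function.Injective (Prod.fst : Fin m × Unit → Fin m) := by
    rintro ⟨x, ⟨⟩⟩ ⟨y, ⟨⟩⟩ h
    exact Prod.ext h rfl
  obtain ⟨E₁, hE₁, hf₁⟩ := exists_exceptional (V := V) (l := 1) hfst (ρ := 1 / r + θ) (ε := γ / 4)
    (by positivity) (by linarith) (by positivity) (by linarith) hV
    (fun x => univ.filter (fun b : Unit → V => b () ∈ univ.filter (fun u => ¬ G.Adj (x 0) u)))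
    (by
      intro x
      have h1 := card_unit_maps_le (univ.filter (fun u => ¬ G.Adj (x 0) u))
      have h2 := hdeg (x 0)
      have h3 := card_filter_add_card_filter_not (s := (univ : Finset V)) (fun u => G.Adj (x 0) u)
      have h4 : (univ.filter (fun u => G.Adj (x 0) u)).card = G.degree (x 0) := by
        rw [← SimpleGraph.card_neighborFinset_eq_degree, SimpleGraph.neighborFinset_eq_filter]
      rw [h4, card_univ] at h3
      have h5 : (G.degree (x 0) : ℝ) + (univ.filter (fun u => ¬ G.Adj (x 0) u)).card =
          Fintype.card V := by exact_mod_cast h3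
      have h6 : ((univ.filter (fun b : Unit → V => b () ∈
          univ.filter (fun u => ¬ G.Adj (x 0) u))).card : ℝ) ≤
          (univ.filter (fun u => ¬ G.Adj (x 0) u)).card := by exact_mod_cast h1
      rw [Fintype.card_unit, pow_one]
      linarith) p v
    (A := 96 * m) (x := (γ / 4) ^ 2 / 4 * m) (by rw [Fintype.card_fin])
    (by rw [Fintype.card_fin]; exact le_trans (le_of_eq (by ring)) hx1) (by positivity)
  obtain ⟨E₂, hE₂, hf₂⟩ := exists_exceptional (V := V) (l := k) hfst (ρ := 1 / r - d) (ε := d / 4)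
    (by linarith) (by linarith) (by positivity) (by linarith) hV
    (fun x => univ.filter (fun b : Unit → V => b () ∈ indepContainer G c x))
    (by
      intro x
      have h1 := card_unit_maps_le (indepContainer G c x)
      have h2 := card_indepContainer_lt hV hc0 hN x
      have h6 : ((univ.filter (fun b : Unit → V => b () ∈ indepContainer G c x)).card : ℝ) ≤
          (indepContainer G c x).card := by exact_mod_cast h1
      rw [Fintype.card_unit, pow_one]
      linarith) p v
    (A := 96 * m) (x := (d / 4) ^ 2 / 4 * m) (by rw [Fintype.card_fin])
    (by rw [Fintype.card_fin]; exact le_trans (le_of_eq (by ring)) hx2) (by positivity)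
  obtain ⟨E₃, hE₃, hf₃⟩ := exists_exceptional (V := V) (l := r) e.injective (ρ := 1 - a)
    (ε := a / 4) (by linarith) (by linarith) (by positivity) (by linarith) hV
    (fun x => univ.filter (fun b : Fin r × Fin r → V => ¬ CliqueAbsorbs G r x b))
    (by
      intro x
      have h1 := card_absorbs_ge hr hα hα1 hθ0.le hθα hrV hV hdeg hN hdisc x
      have h3 := card_filter_add_card_filter_not (s := (univ : Finset (Fin r × Fin r → V)))
        (fun b : Fin r × Fin r → V => CliqueAbsorbs G r x b)
      rw [card_univ, Fintype.card_fun, Fintype.card_prod, Fintype.card_fin] at h3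
      have h5 : ((univ.filter (fun b : Fin r × Fin r → V => CliqueAbsorbs G r x b)).card : ℝ) +
          (univ.filter (fun b : Fin r × Fin r → V => ¬ CliqueAbsorbs G r x b)).card =
          (Fintype.card V : ℝ) ^ (r * r) := by exact_mod_cast h3
      rw [Fintype.card_prod, Fintype.card_fin]
      linarith) p v
    (A := 96 * m) (x := (a / 4) ^ 2 / 4 * (γ / (2 * r ^ 2)) * m)
    (by
      rw [Fintype.card_fin, mul_assoc]
      exact mul_le_mul_of_nonneg_left hJge (by positivity))
    (by rw [Fintype.card_fin]; exact le_trans (le_of_eq (by ring)) hx3) (by positivity)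
  rw [Fintype.card_fin] at hE₁ hE₂ hE₃
  have hsub : univ.filter (fun f : Fin m → V => f p = v ∧ ¬ Tileable (G.comap f) r univ) ⊆
      E₁ ∪ (E₂ ∪ E₃) := by
    intro f hf
    obtain ⟨-, hfp, hnt⟩ := mem_filter.1 hf
    by_contra hcon
    simp only [mem_union, not_or] at hcon
    obtain ⟨hn1, hn2, hn3⟩ := hcon
    apply hnt
    have hl : ∀ t : Fin r → Fin m, ⌈a / 2 * J⌉₊ ≤
        (univ.filter (fun j => CliqueAbsorbs G r (f ∘ t) (fun k => f (e (j, k))))).card := by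
      intro t
      apply Nat.ceil_le.2
      have h1 := hf₃ f hfp hn3 t
      simp only [mem_filter, mem_univ, true_and, Fintype.card_fin] at h1
      have h2 := card_filter_add_card_filter_not (s := (univ : Finset (Fin J)))
        (fun j => CliqueAbsorbs G r (f ∘ t) (fun k => f (e (j, k))))
      rw [card_univ, Fintype.card_fin] at h2
      have h3 : ((univ.filter (fun j =>
          CliqueAbsorbs G r (f ∘ t) (fun k => f (e (j, k))))).card : ℝ) +
          (univ.filter (fun j => ¬ CliqueAbsorbs G r (f ∘ t) (fun k => f (e (j, k))))).card =
          J := by exact_mod_cast h2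
      have h4 : a / 4 * (γ / (2 * r ^ 2) * m) ≤ a / 4 * J :=
        mul_le_mul_of_nonneg_left hJge (by positivity)
      have h5 : (r : ℝ) + 1 ≤ a / 4 * J := by linarith
      linarith
    refine tileable_comap_of_typical hV f hr (by rwa [Fintype.card_fin]) e.injective hγ0 hδ1
      hγδ.le hη0 hη1 ?_ ?_ hkc hl ?_ ?_ ?_ ?_
    · rw [Fintype.card_fin, Fintype.card_fin]; exact hJle
    · rw [Fintype.card_fin]
      have h1 := Nat.le_ceil (a / 2 * (J : ℝ))
      calc η * m = r * (a / 2 * (γ / (2 * r ^ 2) * m)) := by rw [hη]; field_simp; ring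
        _ ≤ r * (a / 2 * J) := by gcongr
        _ ≤ _ := by gcongr
    · intro u
      have h1 := hf₁ f hfp hn1 (fun _ => u)
      simp only [mem_filter, mem_univ, true_and, Function.comp, Fintype.card_fin] at h1
      refine h1.trans ?_
      rw [Fintype.card_fin]
      push_cast
      nlinarith
    · intro t
      have h1 := hf₂ f hfp hn2 t
      simp only [mem_filter, mem_univ, true_and, Fintype.card_fin] at h1
      refine h1.trans ?_
      rw [Fintype.card_fin, hδ]
      linarith
    · rw [Fintype.card_fin]
      linarith
    · rw [Fintype.card_fin]
      linarith
  have h1 := (card_le_card hsub).trans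
    ((card_union_le _ _).trans (Nat.add_le_add_left (card_union_le _ _) _))
  have h2 : ((univ.filter (fun f : Fin m → V => f p = v ∧
      ¬ Tileable (G.comap f) r univ)).card : ℝ) ≤ E₁.card + (E₂.card + E₃.card) := by
    exact_mod_cast h1
  have h3 := mul_le_mul_of_nonneg_left h2 (show (0 : ℝ) ≤ 32 * m by positivity)
  linarith

/-! ### From permutations to factors -/

lemma patWeight_le_two_div {n k : ℕ} (hn : 0 < n) (h : 2 * k ^ 2 ≤ n) :
    patWeight n k ≤ 2 / (n : ℝ) ^ k := by
  have hn0 : (0 : ℝ) < n := by exact_mod_cast hn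
  have hkn : k ≤ n := by nlinarith
  have h1 : (n : ℝ) ^ k ≤ 2 * (n.descFactorial k : ℝ) := by
    have h2 : ((n + 1 - k : ℕ) : ℝ) ^ k ≤ (n.descFactorial k : ℝ) := by
      exact_mod_cast Nat.pow_sub_le_descFactorial n k
    have h3 : (n : ℝ) - k ≤ ((n + 1 - k : ℕ) : ℝ) := by
      rw [Nat.cast_sub (by omega)]; push_cast; linarith
    have hkn' : (k : ℝ) ≤ n := by exact_mod_cast hkn
    have h4 : ((n : ℝ) - k) ^ k ≤ ((n + 1 - k : ℕ) : ℝ) ^ k :=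
      pow_le_pow_left₀ (by linarith) h3 k
    have h5 : 1 / 2 ≤ (1 + -((k : ℝ) / n)) ^ k := by
      have h6 := one_add_mul_le_pow (a := -((k : ℝ) / n)) (by
        have : (k : ℝ) / n ≤ 1 := (div_le_one hn0).2 hkn'
        linarith) k
      have h7 : (k : ℝ) * (k / n) ≤ 1 / 2 := by
        rw [← mul_div_assoc, div_le_iff₀ hn0]
        have : (2 * k ^ 2 : ℝ) ≤ n := by exact_mod_cast h
        linarith
      linarith
    have h8 : ((n : ℝ) - k) ^ k = n ^ k * (1 + -((k : ℝ) / n)) ^ k := by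
      rw [← mul_pow]; congr 1; field_simp; ring
    have h9 : (n : ℝ) ^ k * (1 / 2) ≤ n ^ k * (1 + -((k : ℝ) / n)) ^ k :=
      mul_le_mul_of_nonneg_left h5 (by positivity)
    linarith
  have h2 : (0 : ℝ) < n.descFactorial k := by
    exact_mod_cast Nat.descFactorial_pos.2 hkn
  rw [patWeight, div_le_div_iff₀ h2 (by positivity)]
  linarith

lemma patWeight_le_exp_div_pow {n k : ℕ} (hn : 0 < n) (hkn : k ≤ n) :
    patWeight n k ≤ (Real.exp 1 / n) ^ k := by
  have hn0 : (0 : ℝ) < n := by exact_mod_cast hn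
  have h1 : (n : ℝ) ^ k * (k.factorial : ℝ) ≤ (k : ℝ) ^ k * (n.descFactorial k : ℝ) := by
    rw [← Nat.descFactorial_self, Nat.descFactorial_eq_prod_range, Nat.descFactorial_eq_prod_range]
    have h2 : ∀ i ∈ range k, n * (k - i) ≤ k * (n - i) := by
      intro i hi
      have hik := (mem_range.1 hi).le
      zify [hik, hik.trans hkn]
      have : (i : ℤ) * k ≤ i * n := by gcongr
      nlinarith
    have h3 := prod_le_prod' h2
    rw [prod_mul_distrib, prod_mul_distrib, prod_const, prod_const, card_range] at h3
    exact_mod_cast h3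
  have h2 : (k : ℝ) ^ k ≤ Real.exp 1 ^ k * k.factorial := by
    have h3 := Real.pow_div_factorial_le_exp (x := (k : ℝ)) (Nat.cast_nonneg _) k
    rw [div_le_iff₀ (by positivity)] at h3
    rwa [← Real.exp_nat_mul, mul_one]
  have hd : (0 : ℝ) < n.descFactorial k := by
    exact_mod_cast Nat.descFactorial_pos.2 hkn
  have h3 : (n : ℝ) ^ k ≤ Real.exp 1 ^ k * n.descFactorial k := by
    have hf : (0 : ℝ) < k.factorial := by positivity
    refine le_of_mul_le_mul_right ?_ hf
    calc _ ≤ (k : ℝ) ^ k * (n.descFactorial k : ℝ) := h1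
      _ ≤ (Real.exp 1 ^ k * k.factorial) * (n.descFactorial k : ℝ) :=
          mul_le_mul_of_nonneg_right h2 hd.le
      _ = _ := by ring
  rw [patWeight, div_pow, div_le_div_iff₀ hd (by positivity), one_mul]
  exact h3

section Blocks

variable {V : Type*} [Fintype V] [DecidableEq V] (G : SimpleGraph V) (r : ℕ) {a : ℕ}
  {sz : Fin a → ℕ} (e : (Σ b, Fin (sz b)) ≃ V)

open Classical in
/-- The patterns on a single block whose image spans no `K_r`-factor. -/
noncomputable def badPatterns : Finset (Finset (V × V)) :=
  univ.biUnion fun b => (univ.filter (fun f : Fin (sz b) → V =>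
    ¬ Tileable (G.comap f) r univ)).image fun f => univ.image fun i => (e ⟨b, i⟩, f i)

variable {G r e}

lemma mem_badPatterns {Q : Finset (V × V)} : Q ∈ badPatterns G r e ↔
    ∃ b, ∃ f : Fin (sz b) → V, ¬ Tileable (G.comap f) r univ ∧
      univ.image (fun i => (e ⟨b, i⟩, f i)) = Q := by
  simp [badPatterns]

omit [Fintype V] [DecidableEq V] in
lemma block_injective (b : Fin a) : Function.Injective fun i => e ⟨b, i⟩ := fun i j h => by
  simpa using e.injective h

omit [Fintype V] in
lemma card_blockPattern (b : Fin a) (f : Fin (sz b) → V) :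
    (univ.image (fun i => (e ⟨b, i⟩, f i))).card = sz b := by
  rw [card_image_of_injective, card_univ, Fintype.card_fin]
  intro i j h
  exact block_injective b (Prod.mk.inj h).1

open Classical in
lemma cellSparse_badPatterns {M : ℕ} (hM : 0 < M) (hsz : ∀ b, M ≤ sz b)
    (hn : ∀ b, 2 * sz b ^ 2 ≤ Fintype.card V)
    (hbad : ∀ b (i : Fin (sz b)) (v : V), 32 * (sz b : ℝ) *
      ((univ.filter (fun f : Fin (sz b) → V => f i = v ∧
        ¬ Tileable (G.comap f) r univ)).card : ℝ) ≤ (Fintype.card V : ℝ) ^ (sz b - 1)) :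
    CellSparse (badPatterns G r e) (1 / (16 * M)) := by
  intro p v
  obtain ⟨⟨b, i⟩, rfl⟩ := e.surjective p
  have hn0 : 0 < Fintype.card V := Fintype.card_pos_iff.2 ⟨v⟩
  have hnr : (0 : ℝ) < Fintype.card V := by exact_mod_cast hn0
  have hm0 : 0 < sz b := lt_of_lt_of_le hM (hsz b)
  have hmr : (0 : ℝ) < sz b := by exact_mod_cast hm0
  have hMr : (0 : ℝ) < M := by exact_mod_cast hM
  set L := (badPatterns G r e).filter (fun Q => (e ⟨b, i⟩, v) ∈ Q) with hL
  set N := univ.filter (fun f : Fin (sz b) → V => f i = v ∧ ¬ Tileable (G.comap f) r univ) with hN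
  have hsub : L ⊆ N.image (fun f => univ.image fun i => (e ⟨b, i⟩, f i)) := by
    intro Q hQ
    obtain ⟨hQ1, hQ2⟩ := mem_filter.1 hQ
    obtain ⟨b', f, hf, rfl⟩ := mem_badPatterns.1 hQ1
    obtain ⟨j, -, hj⟩ := mem_image.1 hQ2
    obtain ⟨hj1, hj2⟩ := Prod.mk.inj hj
    have hbb := e.injective hj1
    obtain ⟨rfl, hji⟩ := Sigma.mk.inj hbb
    obtain rfl := eq_of_heq hji
    exact mem_image_of_mem _ (mem_filter.2 ⟨mem_univ _, hj2, hf⟩)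
  have hLN : (L.card : ℝ) ≤ N.card := by
    exact_mod_cast (card_le_card hsub).trans card_image_le
  have hterm : ∀ Q ∈ L, patWeight (Fintype.card V) Q.card ≤ 2 / (Fintype.card V : ℝ) ^ sz b := by
    intro Q hQ
    obtain ⟨f, -, rfl⟩ := mem_image.1 (hsub hQ)
    rw [card_blockPattern]
    exact patWeight_le_two_div hn0 (hn b)
  have h1 := sum_le_card_nsmul L _ _ hterm
  rw [nsmul_eq_mul] at h1
  refine h1.trans ?_
  have h2 := hbad b i v
  have h3 : (N.card : ℝ) ≤ (Fintype.card V : ℝ) ^ (sz b - 1) / (32 * sz b) := by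
    rw [le_div_iff₀ (by positivity)]; linarith
  have h4 : (Fintype.card V : ℝ) ^ sz b = (Fintype.card V : ℝ) ^ (sz b - 1) * Fintype.card V := by
    rw [← pow_succ]; congr 1; omega
  calc (L.card : ℝ) * (2 / (Fintype.card V : ℝ) ^ sz b)
      ≤ (Fintype.card V : ℝ) ^ (sz b - 1) / (32 * sz b) *
          (2 / (Fintype.card V : ℝ) ^ sz b) :=
        mul_le_mul_of_nonneg_right (hLN.trans h3) (by positivity)
    _ = 1 / (16 * sz b) / Fintype.card V := by
        rw [h4]; field_simp; norm_num
    _ ≤ 1 / (16 * M) / Fintype.card V := by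
        have : (M : ℝ) ≤ sz b := by exact_mod_cast hsz b
        gcongr

lemma exists_factor_of_mem_permAvoid {σ : Equiv.Perm V} (hσ : σ ∈ permAvoid ∅ (badPatterns G r e)) :
    ∃ F, IsKrFactor G r F ∧ ∀ K ∈ F, ∃ b, K ⊆ univ.image fun i => σ (e ⟨b, i⟩) := by
  have hinj : ∀ b, Function.Injective fun i => σ (e ⟨b, i⟩) := fun b =>
    σ.injective.comp (block_injective b)
  have hT : ∀ b, Tileable G r (univ.image fun i => σ (e ⟨b, i⟩)) := by
    intro b
    refine Tileable.image ?_ (hinj b).injOn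
    by_contra hcon
    refine (mem_permAvoid.1 hσ).2 _ (mem_badPatterns.2 ⟨b, _, hcon, rfl⟩) ?_
    intro x hx
    obtain ⟨i, -, rfl⟩ := mem_image.1 hx
    rfl
  choose F hF1 hF2 hF3 using hT
  have hsub : ∀ b, ∀ K ∈ F b, K ⊆ univ.image fun i => σ (e ⟨b, i⟩) := fun b K hK =>
    hF3 b ▸ subset_biUnion_of_mem id hK
  refine ⟨univ.biUnion F, ⟨?_, ?_, ?_⟩, ?_⟩
  · intro K hK
    obtain ⟨b, -, hb⟩ := mem_biUnion.1 hK
    exact hF1 b K hb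
  · intro K hK K' hK' hne
    obtain ⟨b, -, hb⟩ := mem_biUnion.1 (mem_coe.1 hK)
    obtain ⟨b', -, hb'⟩ := mem_biUnion.1 (mem_coe.1 hK')
    by_cases hbb : b = b'
    · subst hbb
      exact hF2 b hb hb' hne
    · refine Disjoint.mono (hsub b K hb) (hsub b' K' hb') ?_
      rw [disjoint_left]
      intro x hx hx'
      obtain ⟨i, -, rfl⟩ := mem_image.1 hx
      obtain ⟨j, -, hj⟩ := mem_image.1 hx'
      have := e.injective (σ.injective hj)
      exact hbb (Sigma.mk.inj this).1.symm
  · ext x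
    simp only [mem_univ, iff_true]
    obtain ⟨⟨b, i⟩, hbi⟩ := e.surjective (σ.symm x)
    have hx : x ∈ (F b).biUnion id := by
      rw [hF3]
      exact mem_image.2 ⟨i, mem_univ _, by rw [hbi]; simp⟩
    obtain ⟨K, hK, hxK⟩ := mem_biUnion.1 hx
    exact mem_biUnion.2 ⟨K, mem_biUnion.2 ⟨b, mem_univ _, hK⟩, hxK⟩
  · intro K hK
    obtain ⟨b, -, hb⟩ := mem_biUnion.1 hK
    exact ⟨b, hsub b K hb⟩

open Classical in
/-- Few permutations map every member of `S` into the image of a single block. -/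
lemma card_filter_blocks_le {B : ℝ} {K : ℕ} (hK : ∀ b, sz b ≤ K) (𝓟 : Finset (Equiv.Perm V))
    {S : Finset (Finset V)} (hS : ∀ A ∈ S, A.card = r)
    (hd : (S : Set (Finset V)).PairwiseDisjoint id)
    (hB : ∀ P : Finset (V × V), P.card = r * S.card →
      ((𝓟.filter (PermHolds P)).card : ℝ) ≤ B) (hB0 : 0 ≤ B) :
    ((𝓟.filter (fun σ => ∀ A ∈ S, ∃ b, A ⊆ univ.image fun i => σ (e ⟨b, i⟩))).card : ℝ) ≤
      (a : ℝ) ^ S.card * (K : ℝ) ^ (r * S.card) * B := by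
  set W := S.biUnion id with hW
  have hWcard : W.card = r * S.card := by
    rw [hW, (card_biUnion hd).trans (sum_const_nat (m := r) hS), mul_comm]
  have hk : ∀ x : W, ∃ A : S, x.1 ∈ A.1 := by
    rintro ⟨x, hx⟩
    obtain ⟨A, hA, hxA⟩ := mem_biUnion.1 hx
    exact ⟨⟨A, hA⟩, hxA⟩
  choose κ hκ using hk
  set blk : Fin a → Finset V := fun b => univ.image fun i => e ⟨b, i⟩ with hblk
  set pat : (W → V) → Finset (V × V) := fun π => univ.image fun x => (π x, x.1) with hpat
  have hpatcard : ∀ π, (pat π).card = r * S.card := by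
    intro π
    rw [hpat, card_image_of_injective, card_univ, Fintype.card_coe, hWcard]
    intro x y h
    exact Subtype.ext (Prod.mk.inj h).2
  set D : Finset (Equiv.Perm V) := (univ : Finset (S → Fin a)).biUnion fun c =>
    (Fintype.piFinset fun x => blk (c (κ x))).biUnion fun π => 𝓟.filter (PermHolds (pat π)) with hD
  have hsub : 𝓟.filter (fun σ => ∀ A ∈ S, ∃ b, A ⊆ univ.image fun i => σ (e ⟨b, i⟩)) ⊆ D := by
    intro σ hσ
    obtain ⟨h1, h2⟩ := mem_filter.1 hσ
    choose c hc using h2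
    refine mem_biUnion.2 ⟨fun A => c A.1 A.2, mem_univ _, mem_biUnion.2 ⟨fun x => σ.symm x.1, ?_, ?_⟩⟩
    · rw [Fintype.mem_piFinset]
      intro x
      obtain ⟨i, -, hi⟩ := mem_image.1 (hc _ (κ x).2 (hκ x))
      refine mem_image.2 ⟨i, mem_univ _, ?_⟩
      rw [← hi]; simp
    · refine mem_filter.2 ⟨h1, ?_⟩
      intro y hy
      obtain ⟨x, -, rfl⟩ := mem_image.1 hy
      simp
  have hblkcard : ∀ b, (blk b).card ≤ K := by
    intro b
    refine card_image_le.trans ?_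
    rw [card_univ, Fintype.card_fin]
    exact hK b
  have hpi : ∀ c : S → Fin a,
      ((Fintype.piFinset fun x => blk (c (κ x))).card : ℝ) ≤ (K : ℝ) ^ (r * S.card) := by
    intro c
    rw [Fintype.card_piFinset]
    have := prod_le_pow_card (univ : Finset W) (fun x => (blk (c (κ x))).card) K
      (fun x _ => hblkcard _)
    rw [card_univ, Fintype.card_coe, hWcard] at this
    exact_mod_cast this
  have h1 : ∀ c : S → Fin a, ((((Fintype.piFinset fun x => blk (c (κ x))).biUnion
      fun π => 𝓟.filter (PermHolds (pat π)))).card : ℝ) ≤ (K : ℝ) ^ (r * S.card) * B := by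
    intro c
    have h2 : ((((Fintype.piFinset fun x => blk (c (κ x))).biUnion
      fun π => 𝓟.filter (PermHolds (pat π)))).card : ℝ) ≤
        ∑ π ∈ Fintype.piFinset fun x => blk (c (κ x)), ((𝓟.filter (PermHolds (pat π))).card : ℝ) := by
      exact_mod_cast card_biUnion_le
    refine h2.trans ((sum_le_card_nsmul _ _ _ fun π _ => hB _ (hpatcard π)).trans ?_)
    rw [nsmul_eq_mul]
    exact mul_le_mul_of_nonneg_right (hpi c) hB0
  have h2 : (D.card : ℝ) ≤ ∑ c : S → Fin a, ((((Fintype.piFinset fun x => blk (c (κ x))).biUnion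
      fun π => 𝓟.filter (PermHolds (pat π)))).card : ℝ) := by
    exact_mod_cast card_biUnion_le
  have h3 := sum_le_card_nsmul univ (fun c : S → Fin a =>
    ((((Fintype.piFinset fun x => blk (c (κ x))).biUnion
      fun π => 𝓟.filter (PermHolds (pat π)))).card : ℝ)) _ (fun c _ => h1 c)
  rw [nsmul_eq_mul, card_univ, Fintype.card_fun, Fintype.card_fin, Fintype.card_coe] at h3
  push_cast at h3
  have h4 : ((𝓟.filter (fun σ => ∀ A ∈ S, ∃ b,
      A ⊆ univ.image fun i => σ (e ⟨b, i⟩))).card : ℝ) ≤ D.card := by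
    exact_mod_cast card_le_card hsub
  refine h4.trans (h2.trans (h3.trans (le_of_eq ?_)))
  ring

end Blocks

open Classical in
lemma exists_spreadDist_of_family {α Ω : Type*} [Fintype α] [DecidableEq α] {q : ℝ}
    {Fam : Finset α → Prop} {𝓟 : Finset Ω} (h𝓟 : 0 < 𝓟.card) (F : Ω → Finset α)
    (hF : ∀ σ ∈ 𝓟, Fam (F σ))
    (hq : ∀ S : Finset α, ((𝓟.filter (fun σ => S ⊆ F σ)).card : ℝ) ≤ q ^ S.card * 𝓟.card) :
    ∃ μ, IsSpreadDist q Fam μ := by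
  have h0 : (0 : ℝ) < 𝓟.card := by exact_mod_cast h𝓟
  refine ⟨fun A => ((𝓟.filter (fun σ => F σ = A)).card : ℝ) / 𝓟.card, ?_, ?_, ?_, ?_⟩
  · intro A; positivity
  · rw [← sum_div, div_eq_one_iff_eq h0.ne']
    exact_mod_cast (card_eq_sum_card_fiberwise (s := 𝓟) (f := F) (t := univ)
      (fun _ _ => mem_coe.2 (mem_univ _))).symm
  · intro A hA
    have h1 : (𝓟.filter (fun σ => F σ = A)).Nonempty := by
      rw [nonempty_iff_ne_empty]
      intro h
      apply hA
      simp [h]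
    obtain ⟨σ, hσ⟩ := h1
    obtain ⟨h2, rfl⟩ := mem_filter.1 hσ
    exact hF σ h2
  · intro S
    rw [← sum_div, div_le_iff₀ h0]
    refine le_trans (le_of_eq ?_) (hq S)
    have h1 := card_eq_sum_card_fiberwise (s := 𝓟.filter (fun σ => S ⊆ F σ)) (f := F)
      (t := univ.filter (fun A => S ⊆ A)) (fun σ hσ => by
        have := (mem_filter.1 (mem_coe.1 hσ)).2
        simpa using this)
    rw [h1]
    push_cast
    refine sum_congr (by congr) fun A hA => ?_
    congr 2
    ext σ
    simp only [mem_filter]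
    constructor
    · rintro ⟨h2, rfl⟩
      exact ⟨⟨h2, (mem_filter.1 hA).2⟩, rfl⟩
    · rintro ⟨⟨h2, -⟩, h3⟩
      exact ⟨h2, h3⟩

open Classical in
lemma exists_spreadDist_of_blocks {V : Type*} [Fintype V] [DecidableEq V] {G : SimpleGraph V}
    {r a M : ℕ} {sz : Fin a → ℕ} (hr : 1 ≤ r) (e : (Σ b, Fin (sz b)) ≃ V) (hM : 0 < M)
    (hV : 0 < Fintype.card V)
    (hsz : ∀ b, M ≤ sz b) (hsz2 : ∀ b, sz b ≤ 2 * M) (hn : ∀ b, 2 * sz b ^ 2 ≤ Fintype.card V)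
    (hbad : ∀ b (i : Fin (sz b)) (v : V), 32 * (sz b : ℝ) *
      ((univ.filter (fun f : Fin (sz b) → V => f i = v ∧
        ¬ Tileable (G.comap f) r univ)).card : ℝ) ≤ (Fintype.card V : ℝ) ^ (sz b - 1)) :
    ∃ μ, IsSpreadDist ((4 * M * Real.exp 1) ^ r / (Fintype.card V : ℝ) ^ (r - 1))
      (IsKrFactor G r) μ := by
  have hMr : (1 : ℝ) ≤ M := by exact_mod_cast hM
  have hn0 : (0 : ℝ) < Fintype.card V := by exact_mod_cast hV
  have hsparse := cellSparse_badPatterns (e := e) hM hsz hn hbad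
  set 𝓑 := badPatterns G r e with h𝓑
  set ε : ℝ := 1 / (16 * M) with hε
  have hε0 : 0 ≤ ε := by positivity
  have hKε : 8 * ((2 * M : ℕ) : ℝ) * ε ≤ 1 := by
    rw [hε]; push_cast; apply le_of_eq; field_simp; norm_num
  have hε8 : 8 * ε ≤ 1 := by
    rw [hε, ← mul_div_assoc, div_le_one (by positivity)]; linarith
  have hK : ∀ Q ∈ 𝓑, Q.card ≤ 2 * M := by
    intro Q hQ
    obtain ⟨b, f, -, rfl⟩ := mem_badPatterns.1 hQ
    rw [card_blockPattern]
    exact hsz2 b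
  have hne : ∀ Q ∈ 𝓑, Q.Nonempty := by
    intro Q hQ
    obtain ⟨b, f, -, rfl⟩ := mem_badPatterns.1 hQ
    rw [← card_pos, card_blockPattern]
    exact lt_of_lt_of_le hM (hsz b)
  have hpos := card_permAvoid_pos hε0 hKε hε8 hsparse hK hne
  have hex : ∀ σ : Equiv.Perm V, ∃ F, σ ∈ permAvoid ∅ 𝓑 → IsKrFactor G r F ∧
      ∀ K ∈ F, ∃ b, K ⊆ univ.image fun i => σ (e ⟨b, i⟩) := by
    intro σ
    by_cases hσ : σ ∈ permAvoid ∅ 𝓑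
    · obtain ⟨F, hF⟩ := exists_factor_of_mem_permAvoid hσ
      exact ⟨F, fun _ => hF⟩
    · exact ⟨∅, fun h => absurd h hσ⟩
  choose F hF using hex
  refine exists_spreadDist_of_family hpos F (fun σ hσ => (hF σ hσ).1) ?_
  intro S
  rcases ((permAvoid ∅ 𝓑).filter (fun σ => S ⊆ F σ)).eq_empty_or_nonempty with h0 | ⟨σ, hσ⟩
  · rw [h0, card_empty, Nat.cast_zero]; positivity
  obtain ⟨hσ1, hσ2⟩ := mem_filter.1 hσ
  obtain ⟨⟨hc, hd, -⟩, -⟩ := hF σ hσ1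
  have hS : ∀ A ∈ S, A.card = r := fun A hA => (hc A (hσ2 hA)).card_eq
  have hdS : (S : Set (Finset V)).PairwiseDisjoint id := hd.subset (by exact_mod_cast hσ2)
  have hle : r * S.card ≤ Fintype.card V := by
    have h1 : (S.biUnion id).card = r * S.card := by
      rw [(card_biUnion hdS).trans (sum_const_nat (m := r) hS), mul_comm]
    rw [← h1]; exact card_le_univ _
  have ha : a ≤ Fintype.card V := by
    have h1 := Fintype.card_congr e
    rw [Fintype.card_sigma] at h1
    simp only [Fintype.card_fin] at h1
    rw [← h1]
    have h2 := card_nsmul_le_sum (univ : Finset (Fin a)) sz 1 (fun b _ => hM.trans_le (hsz b))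
    simpa using h2
  have hB := card_filter_blocks_le (e := e) (K := 2 * M)
    (B := 2 ^ (r * S.card) * patWeight (Fintype.card V) (r * S.card) * (permAvoid ∅ 𝓑).card)
    hsz2 (permAvoid ∅ 𝓑) hS hdS (by
      intro P hP
      have h1 := card_permAvoid_le_two_pow hε0 hKε hε8 hsparse hK P
      rw [hP] at h1
      refine le_trans ?_ h1
      have h2 : (permAvoid ∅ 𝓑).filter (PermHolds P) ⊆ permAvoid P 𝓑 := by
        intro τ hτ
        obtain ⟨h3, h4⟩ := mem_filter.1 hτ
        exact mem_permAvoid.2 ⟨h4, (mem_permAvoid.1 h3).2⟩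
      exact_mod_cast card_le_card h2)
    (by have := patWeight_nonneg (Fintype.card V) (r * S.card); positivity)
  have h1 : (((permAvoid ∅ 𝓑).filter (fun σ => S ⊆ F σ)).card : ℝ) ≤
      (((permAvoid ∅ 𝓑).filter (fun σ => ∀ A ∈ S, ∃ b,
        A ⊆ univ.image fun i => σ (e ⟨b, i⟩))).card : ℝ) := by
    have h2 : (permAvoid ∅ 𝓑).filter (fun σ => S ⊆ F σ) ⊆
        (permAvoid ∅ 𝓑).filter (fun σ => ∀ A ∈ S, ∃ b,
          A ⊆ univ.image fun i => σ (e ⟨b, i⟩)) := by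
      intro τ hτ
      obtain ⟨h3, h4⟩ := mem_filter.1 hτ
      exact mem_filter.2 ⟨h3, fun A hA => (hF τ h3).2 A (h4 hA)⟩
    exact_mod_cast card_le_card h2
  refine h1.trans (hB.trans ?_)
  have h2 := patWeight_le_exp_div_pow hV hle
  have har : (a : ℝ) ≤ Fintype.card V := by exact_mod_cast ha
  have hw := patWeight_nonneg (Fintype.card V) (r * S.card)
  set s := S.card with hs
  set N := (Fintype.card V : ℝ) with hN
  set T : ℝ := ((permAvoid ∅ 𝓑).card : ℝ) with hT
  have hNr : N ^ r = N ^ (r - 1) * N := by rw [← pow_succ]; congr 1; omega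
  calc (a : ℝ) ^ s * ((2 * M : ℕ) : ℝ) ^ (r * s) *
        (2 ^ (r * s) * patWeight (Fintype.card V) (r * s) * T)
      ≤ N ^ s * ((2 * M : ℕ) : ℝ) ^ (r * s) * (2 ^ (r * s) * (Real.exp 1 / N) ^ (r * s) * T) := by
        gcongr
    _ = ((4 * M * Real.exp 1) ^ r / N ^ (r - 1)) ^ s * T := by
        have h3 : (4 * M * Real.exp 1) ^ r / N ^ (r - 1) =
            N * (((2 * M : ℕ) : ℝ) ^ r * (2 ^ r * (Real.exp 1 / N) ^ r)) := by
          rw [div_pow, hNr, ← mul_assoc, ← mul_assoc]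
          push_cast
          have h4 : (4 * (M : ℝ) * Real.exp 1) ^ r = (2 * M) ^ r * 2 ^ r * Real.exp 1 ^ r := by
            rw [← mul_pow, ← mul_pow]; congr 1; ring
          rw [h4]
          field_simp
        rw [h3, mul_pow, mul_pow, mul_pow, pow_mul, pow_mul, pow_mul]
        ring

lemma exists_block_sizes {r M n : ℕ} (hrM : r ∣ M) (hrn : r ∣ n) (hM : 0 < M) (hMn : M ≤ n) :
    ∃ a, ∃ sz : Fin a → ℕ, (∀ b, M ≤ sz b ∧ sz b ≤ 2 * M ∧ r ∣ sz b) ∧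
      Nonempty ((Σ b, Fin (sz b)) ≃ Fin n) := by
  obtain ⟨a, ha⟩ : ∃ a, n / M = a + 1 :=
    ⟨n / M - 1, by have := Nat.div_pos hMn hM; omega⟩
  refine ⟨a + 1, Fin.cons (M + n % M) (fun _ => M), ?_, ?_⟩
  · intro b
    have h1 := Nat.mod_lt n hM
    refine Fin.cases ?_ ?_ b
    · simp only [Fin.cons_zero]
      exact ⟨by omega, by omega, dvd_add hrM ((Nat.dvd_mod_iff hrM).2 hrn)⟩
    · intro i
      simp only [Fin.cons_succ]
      exact ⟨le_rfl, by omega, hrM⟩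
  · refine ⟨finSigmaFinEquiv.trans (finCongr ?_)⟩
    rw [Fin.sum_univ_succ]
    simp only [Fin.cons_zero, Fin.cons_succ, sum_const, card_univ, Fintype.card_fin, smul_eq_mul]
    have h1 := Nat.div_add_mod n M
    rw [ha] at h1
    nlinarith

/-- Spread `K_r`-factors in the non-sparse setting: for `r ≥ 2` there is `α₀ > 0` such that for
`0 < α < α₀` there are `θ, C > 0` and `n₀` with the following property.  If `G` is an `n`-vertex
graph (`n ≥ n₀`, `r ∣ n`) with `δ(G) ≥ (r-1)n/r - θn` which is not `(r,α)`-sparse (and, when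
`r = 2`, also not `α`-disconnected), then the `K_r`-factors of `G` carry a `(C/n^{r-1})`-spread
distribution (ground set: the `r`-cliques of `G`). -/
theorem statement16 :
    ∀ r : ℕ, 2 ≤ r → ∃ α₀ : ℝ, 0 < α₀ ∧ ∀ α : ℝ, 0 < α → α < α₀ →
    ∃ θ : ℝ, 0 < θ ∧ ∃ C : ℝ, 0 < C ∧ ∃ n₀ : ℕ, ∀ n : ℕ, n₀ ≤ n → r ∣ n →
    ∀ (G : SimpleGraph (Fin n)) (_ : DecidableRel G.Adj),
    (∀ v, ((r : ℝ) - 1) * n / r - θ * n ≤ (G.degree v : ℝ)) →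
    ¬ IsSparse G r α →
    (r = 2 → ¬ IsDisconnectedGraph G α) →
    ∃ μ : Finset (Finset (Fin n)) → ℝ,
      IsSpreadDist (C / (n : ℝ) ^ (r - 1)) (IsKrFactor G r) μ := by
  intro r hr
  refine ⟨1, one_pos, fun α hα hα1 => ?_⟩
  obtain ⟨θ, hθ, M₀, hM₀⟩ := exists_sample_bound hr hα hα1
  set M : ℕ := r * (M₀ + 1) with hM
  have hMpos : 0 < M := by positivity
  have hM₀M : M₀ ≤ M := by nlinarith
  refine ⟨θ, hθ, (4 * M * Real.exp 1) ^ r, by positivity, max (2 * r) (8 * M ^ 2), ?_⟩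
  intro n hn hrn G _ hdeg hsp hdisc
  have hn2 : 2 * r ≤ n := (le_max_left _ _).trans hn
  have hn8 : 8 * M ^ 2 ≤ n := (le_max_right _ _).trans hn
  have hMn : M ≤ n := by nlinarith
  have hr0 : (0 : ℝ) < r := by positivity
  obtain ⟨a, sz, hsz, ⟨e⟩⟩ := exists_block_sizes (Dvd.intro _ hM.symm) hrn hMpos hMn
  have hcard : Fintype.card (Fin n) = n := Fintype.card_fin n
  have hVpos : 0 < Fintype.card (Fin n) := by omega
  have h := exists_spreadDist_of_blocks (G := G) (r := r) (by omega) e hMpos hVpos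
    (fun b => (hsz b).1) (fun b => (hsz b).2.1) (fun b => by
      have h1 := Nat.pow_le_pow_left (hsz b).2.1 2
      rw [hcard]; nlinarith) (fun b i v => hM₀ (sz b) (hM₀M.trans (hsz b).1) (hsz b).2.2 (Fin n) G
        hVpos (by rwa [hcard]) (fun v => by
          have h1 := hdeg v
          rw [hcard]
          have h2 : ((r : ℝ) - 1) * n / r = n - 1 / r * n := by field_simp
          linarith)
        (fun X hX => edgesBetween_self_ge_of_not_isSparse G hr (by rwa [hcard]) hα
          (by rwa [hcard]) hsp X hX) hdisc i v)
  rwa [hcard] at h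
end

section
/- Let Δ ∈ ℕ and C ≥ 1. Let G be an n-vertex graph and let T be an n-vertex tree with maximum degree Δ(T) ≤ Δ. Suppose μ is a (C/n)-vertex-spread distribution on graph embeddings φ: T ↪ G (injections V(T) → V(G) mapping edges of T to edges of G). Then for every set S ⊆ E(G) of edges, the probability under μ that S ⊆ φ(E(T)) is at most (Δ·C²/n)^{|S|}; in other words, the induced distribution on copies of T in G, regarded as edge subsets of G, is (Δ·C²/n)-spread with respect to the ground set E(G). -/
open Finset

/-- A distribution `μ` over functions `X → Y` is `q`-vertex-spread: for all sequences of
distinct `x i` and distinct `y i`, the probability that `φ (x i) = y i` for all `i` is at most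
`q ^ k`.  (The distributions considered are supported on injections.) -/
def IsVertexSpread {X Y : Type*} [Fintype X] [Fintype Y] [DecidableEq X] [DecidableEq Y]
    (q : ℝ) (μ : (X → Y) → ℝ) : Prop :=
  ∀ (k : ℕ) (x : Fin k → X) (y : Fin k → Y), Function.Injective x → Function.Injective y →
    ∑ φ ∈ Finset.univ.filter (fun φ : X → Y => ∀ i, φ (x i) = y i), μ φ ≤ q ^ k

namespace SimpleGraph

lemma IsAcyclic.exists_existsUnique_adj {V : Type*} [Finite V] {G : SimpleGraph V}
    (h : G.IsAcyclic) {a b : V} (hab : G.Adj a b) : ∃ v, ∃! w, G.Adj v w := by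
  have : Nonempty V := ⟨a⟩
  have ⟨u, v, p, hp, hmax⟩ := Walk.exists_isPath_forall_isPath_length_le_length G
  have hnil : ¬p.Nil := by
    intro hn
    have h1 := hmax a b hab.toWalk (by simpa using hab.ne)
    have h2 := Walk.length_eq_zero_iff.mpr hn
    simp [h2] at h1
  refine ⟨u, _, p.adj_snd hnil, fun w hadj ↦ ?_⟩
  apply h.eq_snd_of_adj_start hp hadj
  have : ¬(p.cons hadj.symm).IsPath := by grind [Walk.length_cons]
  grind [hp.cons]

/-- The homomorphisms from a forest with edge set `S` into a graph of maximum degree at most `Δ`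
are covered, on a set `W` of `#S + c` vertices, by at most `|X| ^ c * Δ ^ #S` maps. -/
theorem exists_covering_maps_of_isAcyclic {V X : Type*} [Finite V]
    [Fintype X] [Nonempty X] (T : SimpleGraph X) [DecidableRel T.Adj] {Δ : ℕ}
    (hΔ : ∀ v, T.degree v ≤ Δ) (m : ℕ) (S : Finset (Sym2 V)) (hm : #S = m)
    (hdiag : ∀ e ∈ S, ¬ e.IsDiag) (hS : (fromEdgeSet (S : Set (Sym2 V))).IsAcyclic) :
    ∃ (W : Finset V) (F : Finset (V → X)) (c : ℕ), c ≤ m ∧ #W = m + c ∧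
      (∀ w ∈ W, ∃ e ∈ S, w ∈ e) ∧ #F ≤ Fintype.card X ^ c * Δ ^ m ∧
      ∀ ψ : V → X, (∀ u v, s(u, v) ∈ S → T.Adj (ψ u) (ψ v)) →
        ∃ f ∈ F, ∀ w ∈ W, f w = ψ w := by
  classical
  induction m generalizing S with
  | zero =>
    exact ⟨∅, {fun _ => Classical.arbitrary X}, 0, by simp⟩
  | succ m ih =>
    obtain ⟨e, he⟩ : S.Nonempty := by rw [← card_pos]; omega
    obtain ⟨v, u, hvu, huniq⟩ : ∃ v, ∃! w, (fromEdgeSet (S : Set (Sym2 V))).Adj v w := by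
      induction e with | _ a b =>
      exact hS.exists_existsUnique_adj (a := a) (b := b)
        (by simpa using ⟨he, by simpa using hdiag _ he⟩)
    rw [fromEdgeSet_adj, mem_coe] at hvu
    obtain ⟨hmem, hne⟩ := hvu
    have hv : ∀ e ∈ S.erase s(v, u), v ∉ e := by
      intro e he hve
      obtain ⟨hne', heS⟩ := mem_erase.mp he
      obtain ⟨w, rfl⟩ := Sym2.mem_iff_exists.mp hve
      refine hne' ?_
      rw [huniq w (by simpa using ⟨heS, by simpa using hdiag _ heS⟩)]
    obtain ⟨W, F, c, hcm, hW, hWS, hF, hcov⟩ := ih (S.erase s(v, u))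
      (by rw [card_erase_of_mem hmem, hm]; rfl)
      (fun e he => hdiag e (mem_of_mem_erase he))
      (hS.anti (fromEdgeSet_mono (by simp)))
    have hvW : v ∉ W := fun h => by
      obtain ⟨e, he, hve⟩ := hWS v h
      exact hv e he hve
    have hWS' : ∀ w ∈ W, ∃ e ∈ S, w ∈ e := fun w hw => by
      obtain ⟨e, he, hwe⟩ := hWS w hw
      exact ⟨e, mem_of_mem_erase he, hwe⟩
    have hcov' : ∀ ψ : V → X, (∀ u v, s(u, v) ∈ S → T.Adj (ψ u) (ψ v)) →
        ∃ f ∈ F, ∀ w ∈ W, f w = ψ w := fun ψ hψ =>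
      hcov ψ fun a b hab => hψ a b (mem_of_mem_erase hab)
    by_cases huW : u ∈ W
    · refine ⟨insert v W, F.biUnion fun f =>
        (T.neighborFinset (f u)).image fun t => Function.update f v t, c, by omega, ?_, ?_, ?_, ?_⟩
      · rw [card_insert_of_notMem hvW]; omega
      · simp only [mem_insert, forall_eq_or_imp]
        exact ⟨⟨_, hmem, by simp⟩, hWS'⟩
      · calc _ ≤ #F * Δ := card_biUnion_le_card_mul _ _ _ fun f _ =>
              card_image_le.trans ((T.card_neighborFinset_eq_degree _).trans_le (hΔ _))
          _ ≤ (Fintype.card X ^ c * Δ ^ m) * Δ := by gcongr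
          _ = _ := by ring
      · intro ψ hψ
        obtain ⟨f, hf, hfW⟩ := hcov' ψ hψ
        refine ⟨Function.update f v (ψ v), ?_, ?_⟩
        · simp only [mem_biUnion, mem_image, mem_neighborFinset]
          exact ⟨f, hf, ψ v, by rw [hfW u huW]; exact (hψ v u hmem).symm, rfl⟩
        · intro w hw
          by_cases hwv : w = v
          · simp [hwv]
          · simpa [hwv] using hfW w ((mem_insert.mp hw).resolve_left hwv)
    · refine ⟨insert v (insert u W), (F ×ˢ univ).biUnion fun p => (T.neighborFinset p.2).image
        fun t => Function.update (Function.update p.1 u p.2) v t, c + 1, by omega, ?_, ?_, ?_, ?_⟩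
      · rw [card_insert_of_notMem (by simp [hvW, hne]), card_insert_of_notMem huW]; omega
      · simp only [mem_insert, forall_eq_or_imp]
        exact ⟨⟨_, hmem, by simp⟩, ⟨_, hmem, by simp⟩, hWS'⟩
      · calc _ ≤ #(F ×ˢ (univ : Finset X)) * Δ := card_biUnion_le_card_mul _ _ _ fun f _ =>
              card_image_le.trans ((T.card_neighborFinset_eq_degree _).trans_le (hΔ _))
          _ = (#F * Fintype.card X) * Δ := by rw [card_product, card_univ]
          _ ≤ ((Fintype.card X ^ c * Δ ^ m) * Fintype.card X) * Δ := by gcongr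
          _ = _ := by ring
      · intro ψ hψ
        obtain ⟨f, hf, hfW⟩ := hcov' ψ hψ
        refine ⟨Function.update (Function.update f u (ψ u)) v (ψ v), ?_, ?_⟩
        · simp only [mem_biUnion, mem_image, mem_neighborFinset, mem_product, mem_univ, and_true]
          exact ⟨(f, ψ u), hf, ψ v, (hψ v u hmem).symm, rfl⟩
        · intro w hw
          by_cases hwv : w = v
          · simp [hwv]
          · by_cases hwu : w = u
            · simp [hwu, hne.symm]
            · have : w ∈ W := by simpa [hwv, hwu] using hw
              simpa [hwv, hwu] using hfW w this

end SimpleGraph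

/-- The vertex-spread bound for preimages prescribed on a finite set. -/
lemma IsVertexSpread.sum_le_pow_card {X Y : Type*} [Fintype X] [Fintype Y] [DecidableEq X]
    [DecidableEq Y] {q : ℝ} {μ : (X → Y) → ℝ} (h : IsVertexSpread q μ) (hq : 0 ≤ q)
    (W : Finset Y) (f : Y → X) :
    ∑ φ ∈ univ.filter (fun φ : X → Y => ∀ w ∈ W, φ (f w) = w), μ φ ≤ q ^ #W := by
  by_cases hf : Set.InjOn f W
  · refine (sum_le_sum_of_subset_of_nonneg ?_ ?_ |>.trans
      (h #W (fun i => f (W.equivFin.symm i)) (fun i => W.equivFin.symm i) ?_ ?_))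
    · intro φ
      simp only [mem_filter, mem_univ, true_and]
      exact fun hφ i => hφ _ (W.equivFin.symm i).2
    · intro φ hφ hφ'
      refine absurd ?_ hφ'
      simp only [mem_filter, mem_univ, true_and] at hφ ⊢
      intro w hw
      simpa using hφ (W.equivFin ⟨w, hw⟩)
    · intro i j hij
      exact W.equivFin.symm.injective (Subtype.ext
        (hf (W.equivFin.symm i).2 (W.equivFin.symm j).2 hij))
    · exact Subtype.val_injective.comp W.equivFin.symm.injective
  · rw [filter_eq_empty_iff.mpr, sum_empty]
    · positivity
    · intro φ _ hφ
      refine hf fun a ha b hb hab => ?_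
      rw [← hφ a ha, ← hφ b hb, hab]

/-- Vertex-spread implies edge-spread for bounded-degree trees: if `μ` is a `(C/n)`-vertex-spread
distribution on embeddings of the `n`-vertex tree `T` (with `Δ(T) ≤ Δ`) into the `n`-vertex
graph `G`, then for every edge set `S ⊆ E(G)`, the `μ`-probability that `S ⊆ φ(E(T))` is at
most `(Δ C² / n)^{|S|}`. -/
theorem statement17 (n Δ : ℕ) (C : ℝ) (hC : 1 ≤ C)
    (G T : SimpleGraph (Fin n)) (_ : DecidableRel G.Adj) (_ : DecidableRel T.Adj)
    (hTree : T.IsTree) (hΔ : ∀ v, T.degree v ≤ Δ)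
    (μ : (Fin n → Fin n) → ℝ)
    (hnonneg : ∀ φ, 0 ≤ μ φ) (hsum : ∑ φ : Fin n → Fin n, μ φ = 1)
    (hsupp : ∀ φ, μ φ ≠ 0 →
      Function.Injective φ ∧ ∀ u v, T.Adj u v → G.Adj (φ u) (φ v))
    (hspread : IsVertexSpread (C / (n : ℝ)) μ) :
    ∀ S : Finset (Sym2 (Fin n)), ↑S ⊆ G.edgeSet →
      ∑ φ ∈ Finset.univ.filter (fun φ : Fin n → Fin n =>
          ∀ e ∈ S, ∃ e' ∈ T.edgeFinset, e'.map φ = e), μ φ ≤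
        ((Δ : ℝ) * C ^ 2 / (n : ℝ)) ^ S.card := by
  intro S hSG
  by_cases hex : ∃ φ, μ φ ≠ 0 ∧ ∀ e ∈ S, ∃ e' ∈ T.edgeFinset, e'.map φ = e
  swap
  · rw [sum_eq_zero]
    · positivity
    · intro φ hφ
      by_contra hne
      exact hex ⟨φ, hne, (mem_filter.mp hφ).2⟩
  have hpull : ∀ φ : Fin n → Fin n, μ φ ≠ 0 → (∀ e ∈ S, ∃ e' ∈ T.edgeFinset, e'.map φ = e) →
      ∃ ψ : Fin n → Fin n, Function.Injective ψ ∧ (∀ w, φ (ψ w) = w) ∧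
        ∀ u v, s(u, v) ∈ S → T.Adj (ψ u) (ψ v) := by
    intro φ hφ hS
    have hinj := (hsupp φ hφ).1
    let E := Equiv.ofBijective φ (Finite.injective_iff_bijective.mp hinj)
    refine ⟨E.symm, E.symm.injective, E.apply_symm_apply, fun u v huv => ?_⟩
    obtain ⟨e', he', hmap⟩ := hS _ huv
    have : e' = s(E.symm u, E.symm v) := by
      apply Sym2.map.injective hinj
      rw [hmap, Sym2.map_mk]
      exact congrArg₂ (fun a b => s(a, b)) (E.apply_symm_apply u).symm (E.apply_symm_apply v).symm
    rw [this] at he'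
    simpa using he'
  have hdiag : ∀ e ∈ S, ¬ e.IsDiag := fun e he => G.not_isDiag_of_mem_edgeSet (hSG he)
  have hacyc : (SimpleGraph.fromEdgeSet (S : Set (Sym2 (Fin n)))).IsAcyclic := by
    obtain ⟨φ, hφ, hS⟩ := hex
    obtain ⟨ψ, hψ, -, hadj⟩ := hpull φ hφ hS
    exact hTree.isAcyclic.comap ⟨ψ, fun {a b} hab => hadj a b (by simpa using hab.1)⟩ hψ
  have : Nonempty (Fin n) := hTree.connected.nonempty
  have hn : (0 : ℝ) < n := by exact_mod_cast Fin.pos_iff_nonempty.mpr this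
  obtain ⟨W, F, c, hcm, hW, -, hF, hcov⟩ :=
    T.exists_covering_maps_of_isAcyclic hΔ #S S rfl hdiag hacyc
  rw [Fintype.card_fin] at hF
  calc _ ≤ ∑ f ∈ F, ∑ φ ∈ univ.filter (fun φ : Fin n → Fin n => ∀ w ∈ W, φ (f w) = w), μ φ := by
        simp_rw [sum_filter]
        rw [sum_comm]
        refine sum_le_sum fun φ _ => ?_
        have hterm : ∀ f ∈ F, 0 ≤ if ∀ w ∈ W, φ (f w) = w then μ φ else 0 := fun f _ => by
          split_ifs
          exacts [hnonneg φ, le_rfl]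
        split_ifs with hS
        · by_cases hφ : μ φ = 0
          · rw [hφ]
            simp
          obtain ⟨ψ, -, hinv, hadj⟩ := hpull φ hφ hS
          obtain ⟨f, hf, hfW⟩ := hcov ψ hadj
          refine le_trans ?_ (single_le_sum hterm hf)
          rw [if_pos fun w hw => by rw [hfW w hw, hinv]]
        · exact sum_nonneg hterm
    _ ≤ ∑ _f ∈ F, (C / n) ^ #W :=
        sum_le_sum fun f _ => by
          refine le_trans (le_of_eq ?_) (hspread.sum_le_pow_card (by positivity) W f)
          congr!
    _ = (#F : ℝ) * (C / n) ^ (#S + c) := by rw [sum_const, nsmul_eq_mul, hW]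
    _ ≤ ((n : ℝ) ^ c * (Δ : ℝ) ^ #S) * (C / n) ^ (#S + c) := by
        gcongr
        exact_mod_cast hF
    _ = ((Δ : ℝ) / n) ^ #S * C ^ (#S + c) := by
        simp only [div_pow, pow_add]
        field_simp
    _ ≤ ((Δ : ℝ) / n) ^ #S * C ^ (2 * #S) := by
        gcongr
        omega
    _ = _ := by
        rw [pow_mul, ← mul_pow]
        congr 1
        ring
end
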